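/- arXiv:1108.2221 — 4 statements merged into one kernel-verified Lean document; each statement's English description precedes it below -/
import Mathlib

section
/- Let $V$ be a finite dimensional real normed vector space and let $S$ be a subsemigroup of $GL(V)$ generated by a finite set of pairwise commuting elements. Suppose there exist $v_0 \in V$ and a nonempty open cone $C$ in $V$ such that the orbit $\mathcal{O} = S \cdot v_0$ intersected with $C$ is coarsely dense in $C$. Then the topological closure of $\mathcal{O}$ is a cone in $V$ which contains $C$. -/
open Filter Topology

theorem tendsto_smul_nhdsGT_zero {V : Type*} [NormedAddCommGroup V] [NormedSpace ℝ V] (v : V) :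
    Tendsto (fun c : ℝ => c • v) (𝓝[>] 0) (𝓝 0) := by
  have : Tendsto (fun c : ℝ => c • v) (𝓝 0) (𝓝 ((0 : ℝ) • v)) :=
    (continuous_id.smul continuous_const).tendsto 0
  rw [zero_smul] at this
  exact this.mono_left nhdsWithin_le_nhds

theorem subset_closure_of_coarselyDense {V : Type*} [NormedAddCommGroup V] [NormedSpace ℝ V]
    {C O : Set V} {D : ℝ} (hC : ∀ x ∈ C, ∀ r : ℝ, 0 < r → r • x ∈ C)
    (hD : ∀ x ∈ C, ∃ w ∈ O, dist x w < D)
    (hO : ∀ w ∈ O, ∀ r : ℝ, 0 < r → r • w ∈ closure O) : C ⊆ closure O := by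
  intro x hx
  rw [← closure_closure, Metric.mem_closure_iff]
  intro ε hε
  obtain ⟨n, hn, hn0⟩ := (((tendsto_const_nhds (x := D)).div_atTop
    tendsto_natCast_atTop_atTop).eventually_lt_const hε |>.and (eventually_gt_atTop 0)).exists
  have hn0 : (0 : ℝ) < n := Nat.cast_pos.2 hn0
  obtain ⟨w, hw, hxw⟩ := hD _ (hC x hx n hn0)
  refine ⟨_, hO w hw (n : ℝ)⁻¹ (inv_pos.2 hn0), lt_of_le_of_lt ?_ hn⟩
  rw [← inv_smul_smul₀ hn0.ne' x, dist_smul₀, norm_inv, Real.norm_natCast, inv_mul_eq_div]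
  gcongr

/-- A proper convex cone in a finite dimensional space lies in a closed half space. -/
theorem exists_nonneg_functional_of_ne_top {V : Type*} [NormedAddCommGroup V] [NormedSpace ℝ V]
    [FiniteDimensional ℝ V] (Q : PointedCone ℝ V) (hQ : Q ≠ ⊤) :
    ∃ f : V →L[ℝ] ℝ, f ≠ 0 ∧ ∀ q ∈ Q, 0 ≤ f q := by
  have hsmul : ∀ c : ℝ, 0 ≤ c → ∀ q ∈ Q, c • q ∈ Q := fun c hc q hq =>
    Q.smul_mem hc hq
  have hconv : Convex ℝ (Q : Set V) := fun x hx y hy a b ha hb _ =>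
    Q.add_mem (hsmul a ha x hx) (hsmul b hb y hy)
  by_cases hspan : Submodule.span ℝ (Q : Set V) = ⊤
  · have hint : (interior (Q : Set V)).Nonempty := by
      rw [hconv.interior_nonempty_iff_affineSpan_eq_top,
        ← Set.insert_eq_of_mem (show (0 : V) ∈ (Q : Set V) from Q.zero_mem),
        ← AffineSubspace.coe_eq_univ_iff, affineSpan_insert_zero, hspan, Submodule.top_coe]
    have h0 : (0 : V) ∉ interior (Q : Set V) := by
      intro h0
      refine hQ (eq_top_iff.2 fun x _ => ?_)
      obtain ⟨c, hc, hc0⟩ :=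
        (((tendsto_smul_nhdsGT_zero x).eventually (mem_interior_iff_mem_nhds.1 h0)).and
          self_mem_nhdsWithin).exists
      have hc0 : 0 < c := hc0
      have := hsmul c⁻¹ (inv_nonneg.2 hc0.le) _ hc
      rwa [inv_smul_smul₀ hc0.ne'] at this
    obtain ⟨f, hf0, hf⟩ := geometric_hahn_banach_of_nonempty_interior_point hconv h0 hint
    refine ⟨-f, neg_ne_zero.2 hf0, fun q hq => ?_⟩
    simpa using hf q hq
  · obtain ⟨f, hf, hle⟩ := Submodule.exists_le_ker_of_lt_top _ (lt_top_iff_ne_top.2 hspan)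
    refine ⟨f.toContinuousLinearMap, fun h => hf ?_, fun q hq => ?_⟩
    · ext x
      exact congrArg (fun g : V →L[ℝ] ℝ => g x) h
    · exact (LinearMap.mem_ker.1 (hle (Submodule.subset_span hq))).ge

/-- The directions along which an additive submonoid contains, up to a bounded error,
an increasing sequence. -/
def AddSubmonoid.boundedDirections {V : Type*} [NormedAddCommGroup V] [NormedSpace ℝ V]
    (L : AddSubmonoid V) : PointedCone ℝ V where
  carrier := {z | ∃ y : ℕ → V, (∀ m n, m ≤ n → y n - y m ∈ L) ∧
    ∃ B : ℝ, ∀ n : ℕ, ‖y n - (n : ℝ) • z‖ ≤ B}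
  zero_mem' := ⟨fun _ => 0, fun _ _ _ => by simp, 0, fun n => by simp⟩
  add_mem' := by
    rintro z w ⟨y, hy, B, hB⟩ ⟨y', hy', B', hB'⟩
    refine ⟨fun n => y n + y' n, fun m n h => ?_, B + B', fun n => ?_⟩
    · rw [add_sub_add_comm]
      exact L.add_mem (hy m n h) (hy' m n h)
    · rw [smul_add, add_sub_add_comm]
      exact norm_add_le_of_le (hB n) (hB' n)
  smul_mem' := by
    rintro ⟨c, hc⟩ z ⟨y, hy, B, hB⟩
    refine ⟨fun n => y ⌊n * c⌋₊, fun m n h => hy _ _ (Nat.floor_mono (by gcongr)),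
      B + ‖z‖, fun n => ?_⟩
    have hfl : ‖((⌊n * c⌋₊ : ℝ) - n * c) • z‖ ≤ ‖z‖ := by
      rw [norm_smul, Real.norm_eq_abs]
      refine mul_le_of_le_one_left (norm_nonneg z) ?_
      have h1 := Nat.floor_le (mul_nonneg n.cast_nonneg hc : (0 : ℝ) ≤ n * c)
      have h2 := Nat.lt_floor_add_one (n * c : ℝ)
      rw [abs_le]
      constructor <;> linarith
    have : y ⌊n * c⌋₊ - (n : ℝ) • ((⟨c, hc⟩ : {c : ℝ // 0 ≤ c}) • z)
        = (y ⌊n * c⌋₊ - (⌊n * c⌋₊ : ℝ) • z) + ((⌊n * c⌋₊ : ℝ) - n * c) • z := by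
      rw [sub_smul, mul_smul]
      change _ - (n : ℝ) • c • z = _
      abel
    rw [this]
    exact norm_add_le_of_le (hB _) hfl

theorem AddSubmonoid.mem_boundedDirections {V : Type*} [NormedAddCommGroup V] [NormedSpace ℝ V]
    {L : AddSubmonoid V} {x : V} (hx : x ∈ L) : x ∈ L.boundedDirections := by
  refine ⟨fun n => n • x, fun m n h => ?_, 0, fun n => ?_⟩
  · obtain ⟨d, rfl⟩ := Nat.exists_eq_add_of_le h
    simpa [add_smul] using L.nsmul_mem hx d
  · simp [Nat.cast_smul_eq_nsmul]

theorem AddSubmonoid.neg_mem_closure_of_boundedDirections_eq_top {V : Type*}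
    [NormedAddCommGroup V] [NormedSpace ℝ V] [FiniteDimensional ℝ V] {L : AddSubmonoid V}
    (hL : L.boundedDirections = ⊤) {x : V} (hx : x ∈ L) : -x ∈ _root_.closure (L : Set V) := by
  obtain ⟨y, hy, B, hB⟩ : -x ∈ L.boundedDirections := hL ▸ Submodule.mem_top
  have : ProperSpace V := FiniteDimensional.proper ℝ V
  obtain ⟨w, -, φ, hφ, hw⟩ := tendsto_subseq_of_bounded
    (Metric.isBounded_closedBall (x := (0 : V)) (r := B))
    (x := fun n : ℕ => y n - (n : ℝ) • -x) (fun n => by simpa using hB n)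
  rw [Metric.mem_closure_iff]
  intro ε hε
  obtain ⟨N, hN⟩ := Metric.cauchySeq_iff.1 hw.cauchySeq ε hε
  have hlt : φ N < φ (N + 1) := hφ N.lt_succ_self
  obtain ⟨d, hd⟩ := Nat.exists_eq_add_of_lt hlt
  refine ⟨(y (φ (N + 1)) - y (φ N)) + d • x, L.add_mem (hy _ _ hlt.le) (L.nsmul_mem hx d), ?_⟩
  have := hN N le_rfl (N + 1) N.le_succ
  rw [dist_eq_norm] at this ⊢
  convert this using 2
  simp only [Function.comp, hd]
  push_cast
  simp only [add_smul, Nat.cast_smul_eq_nsmul, one_smul, smul_neg]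
  abel

theorem exists_finset_of_sum_le {ι : Type*} [Fintype ι] {m : ι → ℝ} (hm : ∀ i, 0 ≤ m i) :
    ∃ κ : ℝ, 0 < κ ∧ ∀ X : ℝ, ∃ F : Finset ℝ,
      (F.card : ℝ) ≤ (κ * |X| + 1) ^ Fintype.card ι ∧
      ∀ α : ι → ℕ, ∑ i, α i * m i ≤ X → ∑ i, α i * m i ∈ F := by
  classical
  obtain ⟨μ, hμ, hμm⟩ : ∃ μ : ℝ, 0 < μ ∧ ∀ i, m i ≠ 0 → μ ≤ m i := by
    have h : ∀ᶠ μ in 𝓝[>] (0 : ℝ), ∀ i, m i ≠ 0 → μ ≤ m i := by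
      rw [eventually_all]
      intro i
      by_cases hi : m i = 0
      · simp [hi]
      · have : 0 < m i := lt_of_le_of_ne (hm i) (Ne.symm hi)
        filter_upwards [Ioo_mem_nhdsGT this] with μ hμ _ using hμ.2.le
    obtain ⟨μ, h1, h2⟩ := (h.and self_mem_nhdsWithin).exists
    exact ⟨μ, h2, h1⟩
  refine ⟨μ⁻¹, inv_pos.2 hμ, fun X => ⟨(Fintype.piFinset fun _ : ι =>
    Finset.range (⌊μ⁻¹ * |X|⌋₊ + 1)).image fun α => ∑ i, (α i : ℝ) * m i, ?_, fun α hα => ?_⟩⟩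
  · calc _ ≤ (((⌊μ⁻¹ * |X|⌋₊ + 1) ^ Fintype.card ι : ℕ) : ℝ) := by
          refine Nat.cast_le.2 (Finset.card_image_le.trans ?_)
          simp
      _ ≤ _ := by
          push_cast
          gcongr
          exact Nat.floor_le (by positivity)
  · refine Finset.mem_image.2 ⟨fun i => if m i = 0 then 0 else α i, ?_, ?_⟩
    · rw [Fintype.mem_piFinset]
      intro i
      rw [Finset.mem_range, Nat.lt_succ_iff]
      split_ifs with hi
      · exact Nat.zero_le _
      · refine Nat.le_floor ?_
        rw [le_inv_mul_iff₀ hμ, mul_comm]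
        calc (α i : ℝ) * μ ≤ α i * m i := by gcongr; exact hμm i hi
          _ ≤ ∑ i, α i * m i :=
            Finset.single_le_sum (f := fun i => (α i : ℝ) * m i)
              (fun j _ => mul_nonneg (Nat.cast_nonneg _) (hm j)) (Finset.mem_univ i)
          _ ≤ |X| := hα.trans (le_abs_self X)
    · refine Finset.sum_congr rfl fun i _ => ?_
      by_cases hi : m i = 0 <;> simp [hi]

theorem tendsto_const_mul_log_add_pow_div_atTop (p q c : ℝ) (n : ℕ) :
    Tendsto (fun r : ℝ => (p * Real.log r + q) ^ n * (c / r)) atTop (𝓝 0) := by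
  have h1 : (fun r : ℝ => p * Real.log r + q) =O[atTop] Real.log :=
    ((Asymptotics.isBigO_refl _ _).const_mul_left p).add
      (Real.isLittleO_const_log_atTop.isBigO)
  have h2 := ((h1.pow n).trans_isLittleO
    (Real.isLittleO_pow_log_id_atTop (n := n))).tendsto_div_nhds_zero
  have h3 := h2.const_mul c
  rw [mul_zero] at h3
  refine h3.congr fun r => ?_
  simp only [id]
  ring

/-- The values of a finitely generated additive submonoid of `[0, ∞)` have only polynomial
growth, so they cannot be `c / r`-dense in an interval near `p * log r` for all large `r`. -/
theorem not_forall_exists_sum_near_log {ι : Type*} [Fintype ι] {m : ι → ℝ} (hm : ∀ i, 0 ≤ m i)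
    {p q δ c R : ℝ} (hδ : 0 < δ)
    (h : ∀ r, R ≤ r → ∀ τ ∈ Set.Icc 0 δ, ∃ α : ι → ℕ,
      |∑ i, α i * m i - (τ + p * Real.log r + q)| ≤ c / r) : False := by
  obtain ⟨κ, hκ, hF⟩ := exists_finset_of_sum_le hm
  have hlim := tendsto_const_mul_log_add_pow_div_atTop (κ * |p|) (κ * (δ + |q| + |c|) + 1)
    (2 * c) (Fintype.card ι)
  obtain ⟨r, ⟨hr, hrR⟩, hr1⟩ := ((hlim.eventually_lt_const hδ).and
    (eventually_ge_atTop R)|>.and (eventually_ge_atTop 1)).exists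
  have hlog : 0 ≤ Real.log r := Real.log_nonneg hr1
  have hc0 : 0 ≤ c / r := by
    obtain ⟨α, hα⟩ := h r hrR 0 ⟨le_rfl, hδ.le⟩
    exact (abs_nonneg _).trans hα
  have hcr : c / r ≤ |c| := by
    rw [div_le_iff₀ (by linarith)]
    nlinarith [abs_nonneg c, le_abs_self c]
  obtain ⟨F, hcard, hFm⟩ := hF (|p| * Real.log r + (δ + |q| + |c|))
  rw [abs_of_nonneg (by positivity)] at hcard
  set s := p * Real.log r + q with hs
  have hcover : Set.Icc s (s + δ) ⊆ ⋃ x ∈ F, Metric.closedBall x (c / r) := by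
    intro x hx
    obtain ⟨α, hα⟩ := h r hrR (x - s) ⟨by linarith [hx.1], by linarith [hx.2]⟩
    have hx' : x - s + p * Real.log r + q = x := by rw [hs]; ring
    rw [hx'] at hα
    refine Set.mem_biUnion (hFm α ?_) (by rwa [Metric.mem_closedBall', Real.dist_eq])
    have h1 := (abs_le.1 hα).2
    have h2 : p * Real.log r ≤ |p| * Real.log r := by gcongr; exact le_abs_self p
    linarith [hx.2, le_abs_self q]
  have hvol := (MeasureTheory.measure_mono (μ := MeasureTheory.volume) hcover).trans
    (MeasureTheory.measure_biUnion_finset_le F _)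
  simp only [Real.volume_Icc, Real.volume_closedBall, Finset.sum_const, nsmul_eq_mul,
    add_sub_cancel_left] at hvol
  rw [← ENNReal.ofReal_natCast, ← ENNReal.ofReal_mul (Nat.cast_nonneg _),
    ENNReal.ofReal_le_ofReal_iff (by positivity)] at hvol
  have : (F.card : ℝ) * (2 * (c / r)) ≤ (κ * |p| * Real.log r + (κ * (δ + |q| + |c|) + 1)) ^
      Fintype.card ι * (2 * c / r) := by
    rw [mul_div_assoc]
    gcongr
    refine hcard.trans_eq ?_
    ring
  linarith

/-- Density criterion for an additive submonoid `L` containing a subgroup `Λ`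
and finitely many vectors `a i`. -/
theorem AddSubmonoid.dense_of_forall_exists_near_log {V : Type*} [NormedAddCommGroup V]
    [NormedSpace ℝ V] [FiniteDimensional ℝ V] {ι : Type*} [Fintype ι] {L : AddSubmonoid V}
    {a : ι → V} (ha : ∀ i, a i ∈ L) {Λ : AddSubgroup V} (hΛ : Λ.toAddSubmonoid ≤ L)
    {e b : V} {c R ρ : ℝ} (hρ : 0 < ρ)
    (h : ∀ r, R ≤ r → ∀ u ∈ Metric.ball (0 : V) ρ, ∃ α : ι → ℕ, ∃ l ∈ Λ,
      ‖∑ i, α i • a i + l - (u + Real.log r • e + b)‖ ≤ c / r) :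
    Dense (L : Set V) := by
  have htop : L.boundedDirections = ⊤ := by
    by_contra hne
    obtain ⟨f, hf0, hf⟩ := exists_nonneg_functional_of_ne_top _ hne
    have hfL : ∀ x ∈ L, 0 ≤ f x := fun x hx => hf x (AddSubmonoid.mem_boundedDirections hx)
    have hfΛ : ∀ x ∈ Λ, f x = 0 := fun x hx => by
      have h1 := hfL x (hΛ hx)
      have h2 := hfL (-x) (hΛ (Λ.neg_mem hx))
      rw [map_neg] at h2
      linarith
    obtain ⟨u, hu, hfu⟩ : ∃ u ∈ Metric.ball (0 : V) ρ, 0 < f u := by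
      obtain ⟨v, hv⟩ : ∃ v, 0 < f v := by
        obtain ⟨v, hv⟩ := DFunLike.ne_iff.1 hf0
        rcases lt_or_gt_of_ne hv with hv | hv
        · exact ⟨-v, by simpa using hv⟩
        · exact ⟨v, hv⟩
      obtain ⟨t, ht, ht0⟩ := (((tendsto_smul_nhdsGT_zero v).eventually
        (Metric.ball_mem_nhds 0 hρ)).and self_mem_nhdsWithin).exists
      exact ⟨t • v, ht, by simpa using mul_pos ht0 hv⟩
    refine not_forall_exists_sum_near_log (m := fun i => f (a i)) (fun i => hfL _ (ha i))
      (p := f e) (q := f b) (c := ‖f‖ * c) (R := max R 1) hfu fun r hr τ hτ => ?_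
    obtain ⟨α, l, hl, hle⟩ := h r (le_of_max_le_left hr) ((τ / f u) • u) (by
      rw [mem_ball_zero_iff] at hu ⊢
      refine lt_of_le_of_lt ?_ hu
      rw [norm_smul, Real.norm_eq_abs, abs_of_nonneg (div_nonneg hτ.1 hfu.le)]
      exact mul_le_of_le_one_left (norm_nonneg _) ((div_le_one hfu).2 hτ.2))
    refine ⟨α, ?_⟩
    have h1 := (f.le_opNorm _).trans (mul_le_mul_of_nonneg_left hle (norm_nonneg f))
    rw [Real.norm_eq_abs] at h1
    simp only [map_sub, map_add, map_sum, map_nsmul, map_smul, hfΛ l hl, smul_eq_mul,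
      div_mul_cancel₀ _ hfu.ne', nsmul_eq_mul, add_zero] at h1
    rw [mul_div_assoc, mul_comm (f e)]
    exact h1
  have hmem : ∀ u ∈ Metric.ball (0 : V) ρ, u ∈ _root_.closure (L : Set V) := by
    intro u hu
    have hL : ∀ x ∈ _root_.closure (L : Set V), ∀ y ∈ _root_.closure (L : Set V),
        x + y ∈ _root_.closure (L : Set V) :=
      fun x hx y hy => L.topologicalClosure.add_mem hx hy
    rw [← _root_.closure_closure, Metric.mem_closure_iff]
    intro ε hε
    have hlim : Tendsto (fun r : ℝ => c / r) atTop (𝓝 0) := tendsto_const_nhds.div_atTop tendsto_id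
    obtain ⟨r, hr, hrR⟩ := ((hlim.eventually_lt_const (half_pos hε)).and
      (eventually_ge_atTop R)).exists
    have key : ∀ α : ι → ℕ, ∀ l ∈ Λ, ∑ i, α i • a i + l ∈ L := fun α l hl =>
      L.add_mem (L.sum_mem fun i _ => L.nsmul_mem (ha i) _) (hΛ hl)
    obtain ⟨α, l, hl, h1⟩ := h r hrR u hu
    obtain ⟨α', l', hl', h2⟩ := h r hrR 0 (Metric.mem_ball_self hρ)
    refine ⟨_, hL _ (_root_.subset_closure (key α l hl)) _
      (AddSubmonoid.neg_mem_closure_of_boundedDirections_eq_top htop (key α' l' hl')), ?_⟩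
    rw [dist_comm, dist_eq_norm]
    generalize ∑ i, α i • a i + l = A at *
    generalize ∑ i, α' i • a i + l' = A' at *
    calc ‖A + -A' - u‖ = ‖(A - (u + Real.log r • e + b)) - (A' - (0 + Real.log r • e + b))‖ := by
          congr 1; abel
      _ ≤ c / r + c / r := norm_sub_le_of_le h1 h2
      _ < ε := by linarith
  intro x
  have ht : Tendsto (fun n : ℕ => (n : ℝ)⁻¹ • x) atTop (𝓝 0) := by
    simpa using (tendsto_inv_atTop_nhds_zero_nat (𝕜 := ℝ)).smul_const x
  obtain ⟨n, hn, hn0⟩ := ((ht.eventually (Metric.ball_mem_nhds 0 hρ)).and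
    (eventually_gt_atTop 0)).exists
  have := L.topologicalClosure.nsmul_mem (hmem _ hn) n
  rwa [← Nat.cast_smul_eq_nsmul ℝ, smul_inv_smul₀ (by positivity)] at this

theorem exists_exp_eq_of_norm_sub_one_lt (A : Type*) [NormedRing A] [NormedAlgebra ℝ A]
    [CompleteSpace A] : ∃ δ > 0, ∃ K : ℝ, ∀ z : A, ‖z - 1‖ < δ →
      ∃ x, NormedSpace.exp x = z ∧ ‖x‖ ≤ K * ‖z - 1‖ := by
  have hf : HasStrictFDerivAt (NormedSpace.exp : A → A)
      (ContinuousLinearEquiv.refl ℝ A : A →L[ℝ] A) 0 := hasStrictFDerivAt_exp_zero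
  have h1 := hf.eventually_right_inverse
  obtain ⟨K, h2⟩ := hf.to_localInverse.hasFDerivAt.isBigO_sub.bound
  rw [hf.localInverse_apply_image] at h2
  rw [NormedSpace.exp_zero] at h1 h2
  obtain ⟨δ, hδ, h⟩ := Metric.eventually_nhds_iff.1 (h1.and h2)
  refine ⟨δ, hδ, K, fun z hz => ?_⟩
  obtain ⟨h1, h2⟩ := h (by rwa [dist_eq_norm])
  exact ⟨_, h1, by simpa using h2⟩

section CommutativeAlgebra

variable {A : Type*} [NormedCommRing A] [NormedAlgebra ℝ A]

theorem isUnit_exp [CompleteSpace A] (x : A) : IsUnit (NormedSpace.exp x) := by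
  let _ := NormedAlgebra.restrictScalars ℚ ℝ A
  refine IsUnit.of_mul_eq_one (NormedSpace.exp (-x)) ?_
  rw [← NormedSpace.exp_add, add_neg_cancel, NormedSpace.exp_zero]

theorem eventually_mem_range_exp_iff [CompleteSpace A] (y : Aˣ) :
    ∀ᶠ z : A in 𝓝 (y : A), z ∈ Set.range (NormedSpace.exp : A → A) ↔
      (y : A) ∈ Set.range (NormedSpace.exp : A → A) := by
  let _ := NormedAlgebra.restrictScalars ℚ ℝ A
  obtain ⟨δ, hδ, K, hK⟩ := exists_exp_eq_of_norm_sub_one_lt A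
  have hc : Tendsto (fun z : A => z * (↑y⁻¹ : A)) (𝓝 (y : A)) (𝓝 1) := by
    have : Continuous fun z : A => z * (↑y⁻¹ : A) := by fun_prop
    simpa using this.tendsto (y : A)
  filter_upwards [hc.eventually (Metric.ball_mem_nhds 1 hδ)] with z hz
  obtain ⟨x, hx, -⟩ := hK _ (by simpa [dist_eq_norm] using hz)
  have hzx : z = y * NormedSpace.exp x := by rw [hx, mul_left_comm, Units.mul_inv, mul_one]
  constructor
  · rintro ⟨w, hw⟩
    refine ⟨w - x, ?_⟩
    rw [sub_eq_add_neg, NormedSpace.exp_add, hw, hzx, mul_assoc, ← NormedSpace.exp_add,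
      add_neg_cancel, NormedSpace.exp_zero, mul_one]
  · rintro ⟨w, hw⟩
    exact ⟨w + x, by rw [NormedSpace.exp_add, hw, hzx]⟩

theorem mem_range_exp_of_isPreconnected [CompleteSpace A] {s : Set A} (hs : IsPreconnected s)
    (hunit : ∀ z ∈ s, IsUnit z) (h1 : 1 ∈ s) : s ⊆ Set.range (NormedSpace.exp : A → A) := by
  refine hs.subset_of_closure_inter_subset ?_ ⟨1, h1, 0, NormedSpace.exp_zero⟩ ?_
  · rw [isOpen_iff_mem_nhds]
    rintro _ ⟨x, rfl⟩
    obtain ⟨y, hy⟩ := isUnit_exp x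
    have := eventually_mem_range_exp_iff y
    rw [hy] at this
    filter_upwards [this] with z hz using hz.2 ⟨x, rfl⟩
  · rintro z ⟨hz, hzs⟩
    obtain ⟨y, rfl⟩ := hunit z hzs
    obtain ⟨w, hw, hwy⟩ := ((mem_closure_iff_frequently.1 hz).and_eventually
      (eventually_mem_range_exp_iff y)).exists
    exact hwy.1 hw

theorem exists_pow_mul_ne_neg (x : ℂ) :
    ∃ k : ℕ, 0 < k ∧ ∀ j : ℕ, ∀ r : ℝ, r < 0 → x ^ (k * j) ≠ (r : ℂ) := by
  by_cases h : ∃ m : ℕ, 0 < m ∧ ∃ s : ℝ, x ^ m = (s : ℂ)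
  · obtain ⟨m, hm, s, hs⟩ := h
    refine ⟨m * 2, by positivity, fun j r hr hj => ?_⟩
    rw [pow_mul, pow_mul, hs, ← pow_mul] at hj
    have : s ^ (2 * j) = r := by exact_mod_cast hj
    rw [pow_mul] at this
    have : 0 ≤ (s ^ 2) ^ j := by positivity
    linarith
  · push Not at h
    refine ⟨1, one_pos, fun j r hr hj => ?_⟩
    rcases j.eq_zero_or_pos with rfl | hj0
    · rw [mul_zero, pow_zero] at hj
      have : (1 : ℝ) = r := by exact_mod_cast hj
      linarith
    · exact h j hj0 r (by simpa using hj)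

theorem exists_forall_pow_ne_neg (s : Finset ℂ) :
    ∃ k : ℕ, 0 < k ∧ ∀ x ∈ s, ∀ r : ℝ, r < 0 → x ^ k ≠ (r : ℂ) := by
  choose k hk h using exists_pow_mul_ne_neg
  refine ⟨∏ x ∈ s, k x, Finset.prod_pos fun x _ => hk x, fun x hx => ?_⟩
  rw [← Finset.mul_prod_erase s k hx]
  exact h x _

/-- Some power of any unit of a finite dimensional commutative real algebra has a logarithm. -/
theorem exists_exp_eq_pow [FiniteDimensional ℝ A] (t : Aˣ) :
    ∃ k : ℕ, 0 < k ∧ ∃ x : A, NormedSpace.exp x = (t : A) ^ k := by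
  have : CompleteSpace A := FiniteDimensional.complete ℝ A
  have hint : IsIntegral ℝ (t : A) := Algebra.IsIntegral.isIntegral _
  set p := minpoly ℝ (t : A) with hp
  obtain ⟨k, hk, hroot⟩ := exists_forall_pow_ne_neg (p.aroots ℂ).toFinset
  refine ⟨k, hk, ?_⟩
  let γ : ℝ → A := fun z => (1 - z) • 1 + z • (t : A) ^ k
  have hγ : Continuous γ := by fun_prop
  have hsub := mem_range_exp_of_isPreconnected (s := γ '' Set.Icc 0 1)
    (isPreconnected_Icc.image γ hγ.continuousOn) ?_ ⟨0, by simp, by simp [γ]⟩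
  · exact hsub ⟨1, by simp, by simp [γ]⟩
  rintro _ ⟨z, ⟨hz0, hz1⟩, rfl⟩
  rcases hz1.eq_or_lt with rfl | hz1
  · simpa [γ] using t.isUnit.pow k
  rcases hz0.eq_or_lt with rfl | hz0
  · simp [γ]
  let q : Polynomial ℝ := Polynomial.C (1 - z) + Polynomial.C z * Polynomial.X ^ k
  have hq : Polynomial.aeval (t : A) q = γ z := by
    simp [q, γ, Algebra.smul_def]
  have hcop : IsCoprime p q := by
    rw [Polynomial.isCoprime_iff_aeval_ne_zero_of_isAlgClosed ℝ ℂ]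
    intro x
    by_contra! hx
    refine hroot x ?_ (-((1 - z) / z)) (neg_neg_of_pos (div_pos (by linarith) hz0)) ?_
    · rw [Multiset.mem_toFinset, Polynomial.mem_aroots]
      exact ⟨minpoly.ne_zero hint, hx.1⟩
    · have h2 := hx.2
      have hz : (z : ℂ) ≠ 0 := by exact_mod_cast hz0.ne'
      simp [q] at h2
      push_cast
      field_simp
      linear_combination h2
  obtain ⟨u, v, huv⟩ := hcop
  have := congrArg (Polynomial.aeval (t : A)) huv
  simp only [map_add, map_mul, map_one, hp, minpoly.aeval, mul_zero, zero_add, hq] at this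
  exact IsUnit.of_mul_eq_one (Polynomial.aeval (t : A) v) (by rw [mul_comm, this])

theorem exists_forall_exp_eq_pow [FiniteDimensional ℝ A] {ι : Type*} [Fintype ι] (t : ι → Aˣ) :
    ∃ k : ℕ, 0 < k ∧ ∃ a : ι → A, ∀ i, NormedSpace.exp (a i) = (t i : A) ^ k := by
  classical
  let _ := NormedAlgebra.restrictScalars ℚ ℝ A
  have : CompleteSpace A := FiniteDimensional.complete ℝ A
  choose k hk a ha using fun i => exists_exp_eq_pow (t i)
  refine ⟨∏ i, k i, Finset.prod_pos fun i _ => hk i,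
    fun i => (∏ j ∈ Finset.univ.erase i, k j) • a i, fun i => ?_⟩
  rw [NormedSpace.exp_nsmul, ha, ← pow_mul, Finset.mul_prod_erase _ _ (Finset.mem_univ i)]

theorem exp_smul_one [CompleteSpace A] (s : ℝ) :
    NormedSpace.exp (s • (1 : A)) = Real.exp s • (1 : A) := by
  rw [← Algebra.algebraMap_eq_smul_one, ← NormedSpace.algebraMap_exp_comm,
    Algebra.algebraMap_eq_smul_one, Real.exp_eq_exp_ℝ]

/-- If a point `p` lies within bounded distance of `r • (x * exp u)` with `r` large, then it is
obtained from it by a multiplicative perturbation of size `O(1 / r)`. -/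
theorem exists_eq_mul_exp_of_norm_sub_le [CompleteSpace A] (x : Aˣ) (D : ℝ) :
    ∃ c R ρ : ℝ, 0 < ρ ∧ 0 < R ∧ ∀ r, R ≤ r → ∀ u : A, ‖u‖ < ρ → ∀ p : A,
      ‖p - r • (x * NormedSpace.exp u)‖ ≤ D →
      ∃ ε : A, ‖ε‖ ≤ c / r ∧ p = x * NormedSpace.exp (u + Real.log r • 1 + ε) := by
  let _ := NormedAlgebra.restrictScalars ℚ ℝ A
  obtain ⟨δ, hδ, K, hK⟩ := exists_exp_eq_of_norm_sub_one_lt A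
  have hcont : Continuous fun u : A => ‖(↑x⁻¹ : A) * NormedSpace.exp (-u)‖ :=
    (continuous_const.mul (NormedSpace.exp_continuous.comp continuous_neg)).norm
  obtain ⟨ρ, hρ, hN⟩ := Metric.eventually_nhds_iff.1
    (hcont.continuousAt.eventually_lt_const (lt_add_one (‖(↑x⁻¹ : A) * NormedSpace.exp (-0)‖)))
  set N := ‖(↑x⁻¹ : A) * NormedSpace.exp (-0)‖ + 1
  refine ⟨|K| * (D * N), max 1 (D * N / δ + 1), ρ, hρ, by positivity, fun r hr u hu p hp => ?_⟩
  have hr0 : 0 < r := one_pos.trans_le (le_of_max_le_left hr)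
  have hr1 : D * N / r < δ := by
    have : D * N / δ < r := by linarith [le_of_max_le_right hr]
    rw [div_lt_iff₀ hδ] at this
    rw [div_lt_iff₀ hr0]
    linarith
  have hexp : NormedSpace.exp u * NormedSpace.exp (-u) = 1 := by
    rw [← NormedSpace.exp_add, add_neg_cancel, NormedSpace.exp_zero]
  set X : A := r • (x * NormedSpace.exp u) with hX
  set Y : A := r⁻¹ • (↑x⁻¹ * NormedSpace.exp (-u)) with hY
  have hXY : X * Y = 1 := by
    rw [hX, hY, smul_mul_smul_comm, mul_inv_cancel₀ hr0.ne', one_smul, mul_mul_mul_comm,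
      Units.mul_inv, hexp, one_mul]
  have hz : ‖p * Y - 1‖ ≤ D * N / r := by
    rw [← hXY, ← sub_mul]
    refine (norm_mul_le _ _).trans ?_
    have hYn : ‖Y‖ ≤ r⁻¹ * N := by
      rw [hY, norm_smul, norm_inv, Real.norm_eq_abs, abs_of_pos hr0]
      gcongr
      exact (hN (by rwa [dist_zero_right])).le
    calc _ ≤ D * (r⁻¹ * N) := mul_le_mul hp hYn (norm_nonneg _) ((norm_nonneg _).trans hp)
      _ = D * N / r := by ring
  obtain ⟨ε, hε, hεn⟩ := hK _ (hz.trans_lt hr1)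
  refine ⟨ε, ?_, ?_⟩
  · calc ‖ε‖ ≤ |K| * ‖p * Y - 1‖ := hεn.trans (by gcongr; exact le_abs_self K)
      _ ≤ |K| * (D * N / r) := by gcongr
      _ = _ := by ring
  · rw [NormedSpace.exp_add, NormedSpace.exp_add, exp_smul_one, Real.exp_log hr0, hε]
    calc p = p * (X * Y) := by rw [hXY, mul_one]
      _ = X * (p * Y) := by ring
      _ = _ := by
        clear_value Y
        simp only [hX, Algebra.smul_def]
        ring

/-- If the submonoid generated by finitely many units is coarsely dense in an open cone
containing a unit, then all positive scalars belong to its closure. -/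
theorem smul_one_mem_closure_of_coarselyDense [FiniteDimensional ℝ A] {ι : Type*} [Fintype ι]
    (t : ι → Aˣ) {C : Set A} (hC : IsOpen C) (hcone : ∀ x ∈ C, ∀ r : ℝ, 0 < r → r • x ∈ C)
    (x₀ : Aˣ) (hx₀ : (x₀ : A) ∈ C) {D : ℝ}
    (hD : ∀ x ∈ C, ∃ α : ι → ℕ, ‖∏ i, (t i : A) ^ α i - x‖ ≤ D) {r : ℝ} (hr : 0 < r) :
    r • (1 : A) ∈ closure (Submonoid.closure (Set.range fun i => (t i : A)) : Set A) := by
  let _ := NormedAlgebra.restrictScalars ℚ ℝ A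
  have : CompleteSpace A := FiniteDimensional.complete ℝ A
  obtain ⟨k, hk, a, ha⟩ := exists_forall_exp_eq_pow t
  have hk' : (k : ℝ) ≠ 0 := by positivity
  set M := Submonoid.closure (Set.range fun i => (t i : A)) with hM
  let L : AddSubmonoid A :=
    { carrier := {x | NormedSpace.exp x ∈ M}
      zero_mem' := by
        change NormedSpace.exp 0 ∈ M
        rw [NormedSpace.exp_zero]; exact M.one_mem
      add_mem' := fun {x y} hx hy => by
        change NormedSpace.exp (x + y) ∈ M
        rw [NormedSpace.exp_add]; exact M.mul_mem hx hy }
  let Λ : AddSubgroup A :=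
    { carrier := {x | NormedSpace.exp x = 1}
      zero_mem' := NormedSpace.exp_zero
      add_mem' := fun {x y} hx hy => by
        change NormedSpace.exp (x + y) = 1
        rw [NormedSpace.exp_add, hx, hy, one_mul]
      neg_mem' := fun {x} hx => by
        have h : NormedSpace.exp x * NormedSpace.exp (-x) = 1 := by
          rw [← NormedSpace.exp_add, add_neg_cancel, NormedSpace.exp_zero]
        change NormedSpace.exp (-x) = 1
        rwa [show NormedSpace.exp x = 1 from hx, one_mul] at h }
  suffices hdense : Dense (L : Set A) by
    have := map_mem_closure NormedSpace.exp_continuous (hdense (Real.log r • 1))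
      (show Set.MapsTo _ (L : Set A) (M : Set A) from fun x hx => hx)
    rwa [exp_smul_one, Real.exp_log hr] at this
  obtain ⟨c, R, ρ, hρ, hR, hloc⟩ := exists_eq_mul_exp_of_norm_sub_le x₀ D
  have hCev : ∀ᶠ u : A in 𝓝 0, (x₀ : A) * NormedSpace.exp u ∈ C := by
    have hcont : Continuous fun u : A => (x₀ : A) * NormedSpace.exp u :=
      continuous_const.mul NormedSpace.exp_continuous
    refine hcont.continuousAt.eventually_mem (hC.mem_nhds ?_)
    rwa [NormedSpace.exp_zero, mul_one]
  obtain ⟨ρ', hρ', hC'⟩ := Metric.eventually_nhds_iff.1 hCev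
  have key : ∀ r, R ≤ r → ∀ u ∈ Metric.ball (0 : A) (k * min ρ ρ'), ∃ α : ι → ℕ, ∃ ε : A,
      ‖ε‖ ≤ k * c / r ∧ NormedSpace.exp (∑ i, α i • a i) =
        (x₀ : A) ^ k * NormedSpace.exp (u + Real.log r • (k : ℝ) • 1 + ε) := by
    intro r hr u hu
    have hu' : ‖(k : ℝ)⁻¹ • u‖ < min ρ ρ' := by
      rw [norm_smul, norm_inv, Real.norm_natCast, inv_mul_lt_iff₀ (by positivity)]
      simpa using hu
    obtain ⟨α, hα⟩ := hD _ (hcone _ (hC' (by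
      rw [dist_zero_right]; exact hu'.trans_le (min_le_right _ _))) r (hR.trans_le hr))
    obtain ⟨ε, hε, h⟩ := hloc r hr _ (hu'.trans_le (min_le_left _ _)) _ hα
    refine ⟨α, k • ε, ?_, ?_⟩
    · refine (norm_nsmul_le).trans ?_
      rw [mul_div_assoc]
      gcongr
    · have h1 : NormedSpace.exp (∑ i, α i • a i) = (∏ i, (t i : A) ^ α i) ^ k := by
        rw [NormedSpace.exp_sum, ← Finset.prod_pow]
        refine Finset.prod_congr rfl fun i _ => ?_
        rw [NormedSpace.exp_nsmul, ha, ← pow_mul, ← pow_mul, mul_comm]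
      rw [h1, h, mul_pow, ← NormedSpace.exp_nsmul]
      congr 2
      rw [smul_add, smul_add, ← Nat.cast_smul_eq_nsmul ℝ k ((k : ℝ)⁻¹ • u), smul_inv_smul₀ hk',
        ← Nat.cast_smul_eq_nsmul ℝ k (Real.log r • (1 : A)), smul_comm]
  have hρk : 0 < k * min ρ ρ' := mul_pos (by positivity) (lt_min hρ hρ')
  obtain ⟨α₀, ε₀, -, h₀⟩ := key R le_rfl 0 (Metric.mem_ball_self hρk)
  refine AddSubmonoid.dense_of_forall_exists_near_log (L := L) (a := a) (Λ := Λ)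
    (e := (k : ℝ) • 1) (c := k * c) (R := R)
    (b := ∑ i, α₀ i • a i - (0 + Real.log R • (k : ℝ) • 1 + ε₀))
    (fun i => ?_) (fun x hx => ?_) hρk fun r hr u hu => ?_
  · change NormedSpace.exp (a i) ∈ M
    rw [ha]
    exact M.pow_mem (Submonoid.subset_closure ⟨i, rfl⟩) k
  · change NormedSpace.exp x ∈ M
    rw [show NormedSpace.exp x = 1 from hx]
    exact M.one_mem
  · obtain ⟨α, ε, hε, h⟩ := key r hr u hu
    generalize ∑ i, α₀ i • a i = s₀ at *
    generalize 0 + Real.log R • (k : ℝ) • (1 : A) + ε₀ = w₀ at *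
    refine ⟨α, u + Real.log r • (k : ℝ) • 1 + ε + (s₀ - w₀) - ∑ i, α i • a i, ?_, ?_⟩
    · have hinv : ∀ w : A, NormedSpace.exp w * NormedSpace.exp (-w) = 1 := fun w => by
        rw [← NormedSpace.exp_add, add_neg_cancel, NormedSpace.exp_zero]
      have hb : NormedSpace.exp (s₀ - w₀) = (x₀ : A) ^ k := by
        rw [sub_eq_add_neg, NormedSpace.exp_add, h₀, mul_assoc, hinv, mul_one]
      change NormedSpace.exp _ = 1
      rw [sub_eq_add_neg, NormedSpace.exp_add, NormedSpace.exp_add, hb, mul_comm _ ((x₀ : A) ^ k),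
        ← h, hinv]
    · refine le_of_eq_of_le (congrArg norm ?_) hε
      abel

theorem smul_one_mem_closure_of_coarselyDense_orbit [FiniteDimensional ℝ A]
    {V : Type*} [NormedAddCommGroup V] [NormedSpace ℝ V] [FiniteDimensional ℝ V]
    (φ : A →ₐ[ℝ] (V →L[ℝ] V)) (hφ : Function.Injective φ) {ι : Type*} [Fintype ι] (t : ι → Aˣ)
    {v₀ : V} {C : Set V} (hCne : C.Nonempty) (hC : IsOpen C)
    (hcone : ∀ x ∈ C, ∀ r : ℝ, 0 < r → r • x ∈ C) {D : ℝ}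
    (hD : ∀ x ∈ C, ∃ m ∈ Submonoid.closure (Set.range fun i => (t i : A)),
      φ m v₀ ∈ C ∧ dist x (φ m v₀) < D) {r : ℝ} (hr : 0 < r) :
    r • (1 : A) ∈ closure (Submonoid.closure (Set.range fun i => (t i : A)) : Set A) := by
  let ev : A →ₗ[ℝ] V := (ContinuousLinearMap.apply ℝ V v₀).toLinearMap ∘ₗ φ.toLinearMap
  have hev : ∀ a, ev a = φ a v₀ := fun a => rfl
  have hCrange : C ⊆ LinearMap.range ev := by
    have hclosed : IsClosed (LinearMap.range ev : Set V) := Submodule.closed_of_finiteDimensional _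
    rw [← hclosed.closure_eq]
    refine subset_closure_of_coarselyDense (D := D) hcone (fun x hx => ?_) fun w hw r _ =>
      subset_closure ((LinearMap.range ev).smul_mem r hw)
    obtain ⟨m, -, -, hm⟩ := hD x hx
    exact ⟨_, ⟨m, rfl⟩, hm⟩
  have hrange : LinearMap.range ev = ⊤ :=
    Submodule.eq_top_of_nonempty_interior' _ (hCne.mono (interior_maximal hCrange hC))
  have hsurj : Function.Surjective ev := LinearMap.range_eq_top.1 hrange
  have hinj : Function.Injective ev := by
    rw [injective_iff_map_eq_zero]
    intro a ha
    apply hφ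
    rw [map_zero]
    ext v
    obtain ⟨b, rfl⟩ := hsurj v
    rw [hev, ← mul_apply_eq_comp, ← map_mul, mul_comm, map_mul,
      mul_apply_eq_comp, ← hev a, ha, map_zero, zero_apply]
  let E : A ≃L[ℝ] V := (LinearEquiv.ofBijective ev ⟨hinj, hsurj⟩).toContinuousLinearEquiv
  have hE : ∀ a, E a = φ a v₀ := fun a => rfl
  obtain ⟨x, hx⟩ := hCne
  obtain ⟨m, hm, hmC, -⟩ := hD x hx
  obtain ⟨α, rfl⟩ := Submonoid.mem_closure_range_iff_of_fintype.1 hm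
  refine smul_one_mem_closure_of_coarselyDense t (C := E ⁻¹' C) (hC.preimage E.continuous)
    (fun x hx r hr => ?_) (∏ i, t i ^ α i) ?_ (D := ‖(E.symm : V →L[ℝ] A)‖ * D)
    (fun x hx => ?_) hr
  · rw [Set.mem_preimage, map_smul]
    exact hcone _ hx r hr
  · rw [Set.mem_preimage, hE]
    simpa using hmC
  · obtain ⟨m, hm, -, hd⟩ := hD _ hx
    obtain ⟨β, rfl⟩ := Submonoid.mem_closure_range_iff_of_fintype.1 hm
    refine ⟨β, ?_⟩
    generalize ∏ i, (t i : A) ^ β i = m at *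
    have h := (E.symm : V →L[ℝ] A).le_opNorm (E m - E x)
    rw [← map_sub, ContinuousLinearEquiv.coe_coe, E.symm_apply_apply, map_sub] at h
    refine h.trans ?_
    gcongr
    rw [dist_comm, dist_eq_norm] at hd
    exact hd.le

end CommutativeAlgebra

/-- Let `V` be a finite dimensional real normed space and `S` a
subsemigroup of `GL(V)` generated by a finite set of pairwise commuting elements.
If for some `v₀ ∈ V` and some nonempty open cone `C` the set `S ⬝ v₀ ∩ C` is coarsely
dense in `C`, then the closure of the orbit is a cone containing `C`. -/
theorem closure_orbit_is_cone
    {V : Type*} [NormedAddCommGroup V] [NormedSpace ℝ V] [FiniteDimensional ℝ V]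
    (T : Set (V →L[ℝ] V)ˣ) (hTfin : T.Finite)
    (hTcomm : ∀ s ∈ T, ∀ t ∈ T, s * t = t * s)
    (S : Subsemigroup (V →L[ℝ] V)ˣ) (hS : S = Subsemigroup.closure T)
    (v₀ : V)
    (C : Set V) (hCne : C.Nonempty) (hCopen : IsOpen C)
    (hCcone : ∀ x ∈ C, ∀ r : ℝ, 0 < r → r • x ∈ C)
    (hcd : ∃ D : ℝ, 0 < D ∧ ∀ x ∈ C, ∃ s ∈ S,
      (s : V →L[ℝ] V) v₀ ∈ C ∧ dist x ((s : V →L[ℝ] V) v₀) < D) :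
    C ⊆ closure {w : V | ∃ s ∈ S, (s : V →L[ℝ] V) v₀ = w} ∧
      ∀ x ∈ closure {w : V | ∃ s ∈ S, (s : V →L[ℝ] V) v₀ = w}, ∀ r : ℝ, 0 < r →
        r • x ∈ closure {w : V | ∃ s ∈ S, (s : V →L[ℝ] V) v₀ = w} := by
  obtain ⟨D, -, hD⟩ := hcd
  have := hTfin.fintype
  set X : Set (V →L[ℝ] V) := (fun u : (V →L[ℝ] V)ˣ => (u : V →L[ℝ] V)) '' (T ∪ T⁻¹)
  have hXcomm : ∀ x ∈ X, ∀ y ∈ X, x * y = y * x := by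
    have hT : ∀ s ∈ T, ∀ t ∈ T, Commute s t := hTcomm
    have hT' : ∀ s ∈ T ∪ T⁻¹, ∀ t ∈ T, Commute s t := by
      rintro s (hs | hs) t ht
      · exact hT s hs t ht
      · exact Commute.inv_left_iff.1 (hT _ hs t ht)
    rintro _ ⟨s, hs, rfl⟩ _ ⟨t, ht, rfl⟩
    refine Commute.units_val (u₁ := s) (u₂ := t) ?_
    rcases ht with ht | ht
    · exact hT' s hs t ht
    · exact Commute.inv_right_iff.1 (hT' s hs _ ht)
  have hcomm := Algebra.isMulCommutative_adjoin ℝ hXcomm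
  set A := Algebra.adjoin ℝ X
  let _ : NormedCommRing A := { (inferInstance : NormedRing A) with
    mul_comm := hcomm.is_comm.comm }
  have hXA : ∀ u ∈ T ∪ T⁻¹, (u : V →L[ℝ] V) ∈ A := fun u hu =>
    Algebra.subset_adjoin ⟨u, hu, rfl⟩
  let t : T → Aˣ := fun s =>
    ⟨⟨(s : (V →L[ℝ] V)ˣ), hXA _ (Or.inl s.2)⟩,
      ⟨((s : (V →L[ℝ] V)ˣ)⁻¹ : (V →L[ℝ] V)ˣ), hXA _ (Or.inr (by simp))⟩,
      Subtype.ext (Units.mul_inv _), Subtype.ext (Units.inv_mul _)⟩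
  set M := Submonoid.closure (Set.range fun i => (t i : A))
  have hSM : ∀ s ∈ S, ∃ m ∈ M, A.val m = (s : V →L[ℝ] V) := by
    intro s hs
    rw [hS] at hs
    induction hs using Subsemigroup.closure_induction with
    | mem s hs => exact ⟨t ⟨s, hs⟩, Submonoid.subset_closure ⟨_, rfl⟩, rfl⟩
    | mul s s' _ _ ih ih' =>
      obtain ⟨m, hm, h⟩ := ih
      obtain ⟨m', hm', h'⟩ := ih'
      exact ⟨m * m', M.mul_mem hm hm', by rw [map_mul, h, h', Units.val_mul]⟩
  have hMS : ∀ m ∈ M, ∀ s ∈ S, ∃ s' ∈ S, (s' : V →L[ℝ] V) = A.val m * s := by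
    intro m hm
    induction hm using Submonoid.closure_induction with
    | mem m hm =>
      obtain ⟨i, rfl⟩ := hm
      intro s hs
      refine ⟨i * s, S.mul_mem ?_ hs, rfl⟩
      rw [hS]
      exact Subsemigroup.subset_closure i.2
    | one => exact fun s hs => ⟨s, hs, by rw [map_one, one_mul]⟩
    | mul m m' _ _ ih ih' =>
      intro s hs
      obtain ⟨s', hs', h'⟩ := ih' s hs
      obtain ⟨s'', hs'', h''⟩ := ih s' hs'
      exact ⟨s'', hs'', by rw [h'', h', map_mul, mul_assoc]⟩
  have hscalar : ∀ r : ℝ, 0 < r → r • (1 : A) ∈ closure (M : Set A) := fun r hr =>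
    smul_one_mem_closure_of_coarselyDense_orbit A.val Subtype.val_injective t hCne hCopen hCcone
      (fun x hx => by
        obtain ⟨s, hs, h⟩ := hD x hx
        obtain ⟨m, hm, hms⟩ := hSM s hs
        exact ⟨m, hm, by rwa [hms]⟩) hr
  set O : Set V := {w : V | ∃ s ∈ S, (s : V →L[ℝ] V) v₀ = w}
  have hO : ∀ w ∈ O, ∀ r : ℝ, 0 < r → r • w ∈ closure O := by
    rintro _ ⟨s, hs, rfl⟩ r hr
    have hcont : Continuous fun a : A => (a : V →L[ℝ] V) ((s : V →L[ℝ] V) v₀) := by fun_prop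
    have := map_mem_closure hcont (hscalar r hr) (t := O) fun m hm => by
      obtain ⟨s', hs', h⟩ := hMS m hm s hs
      exact ⟨s', hs', by rw [h]; rfl⟩
    simpa using this
  have hcone : ∀ x ∈ closure O, ∀ r : ℝ, 0 < r → r • x ∈ closure O := by
    intro x hx r hr
    have := map_mem_closure (continuous_const_smul r) hx (t := closure O) fun w hw => hO w hw r hr
    rwa [closure_closure] at this
  refine ⟨subset_closure_of_coarselyDense (D := D) hCcone (fun x hx => ?_) hO, hcone⟩
  obtain ⟨s, hs, -, hd⟩ := hD x hx
  exact ⟨_, ⟨s, hs, rfl⟩, hd⟩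
end

section
/- Let $V$ be a finite dimensional real normed vector space and let $S$ be a subsemigroup of $GL(V)$ generated by a finite set of pairwise commuting elements. Suppose there exist $v_0 \in V$ and a nonempty open cone $C$ in $V$ such that the orbit $S \cdot v_0$ intersected with $C$ is coarsely dense in $C$. Then the topological closure $\overline{S}$ of $S$ in the topological group $GL(V)$ is a subgroup of $GL(V)$. -/
open Filter Topology

theorem exists_pos_combination_eq_zero_or_exists_dual_nonneg {ι E : Type*} [Fintype ι]
    [AddCommGroup E] [Module ℝ E] (a : ι → E) :
    (∃ c : ι → ℝ, (∀ i, 0 < c i) ∧ ∑ i, c i • a i = 0) ∨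
      ∃ l : E →ₗ[ℝ] ℝ, (∀ i, 0 ≤ l (a i)) ∧ ∃ i, l (a i) ≠ 0 := by
  classical
  rw [or_iff_not_imp_left]
  intro hno
  set F : (ι → ℝ) →ₗ[ℝ] E := Fintype.linearCombination ℝ a with hF
  set P : Set (ι → ℝ) := Set.univ.pi fun _ => Set.Ioi 0 with hP
  have hPmem : ∀ c : ι → ℝ, c ∈ P ↔ ∀ i, 0 < c i := fun c => by simp [hP]
  have hdisj : Disjoint P (LinearMap.ker F : Set (ι → ℝ)) := by
    rw [Set.disjoint_left]
    intro c hc hker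
    refine hno ⟨c, (hPmem c).1 hc, ?_⟩
    simpa [hF, Fintype.linearCombination_apply] using hker
  obtain ⟨f, u, hf1, hf2⟩ := geometric_hahn_banach_open
    (convex_pi fun _ _ => convex_Ioi (0 : ℝ)) (isOpen_set_pi Set.finite_univ fun _ _ => isOpen_Ioi)
    (LinearMap.ker F).convex hdisj
  have hu : u ≤ 0 := by simpa using hf2 0 (Submodule.zero_mem _)
  have hker : ∀ c ∈ LinearMap.ker F, f c = 0 := by
    intro c hc
    by_contra hne
    have := hf2 (((u - 1) / f c) • c) (Submodule.smul_mem _ _ hc)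
    rw [map_smul, smul_eq_mul, div_mul_cancel₀ _ hne] at this
    linarith
  have hrange : (f : (ι → ℝ) →ₗ[ℝ] ℝ) ∈ F.dualMap.range := by
    rw [LinearMap.range_dualMap_eq_dualAnnihilator_ker, Submodule.mem_dualAnnihilator]
    exact hker
  obtain ⟨l, hl⟩ := hrange
  have hlf : ∀ i, l (a i) = f (Pi.single i 1) := by
    intro i
    have := LinearMap.congr_fun hl (Pi.single i 1)
    simpa [hF] using this
  have hle : ∀ i, f (Pi.single i 1) ≤ 0 := by
    intro i
    have hc : Continuous fun s : ℝ => f (Pi.single i 1 + s • (1 : ι → ℝ)) := by fun_prop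
    have ht : Tendsto (fun s : ℝ => f (Pi.single i 1 + s • (1 : ι → ℝ))) (𝓝[>] 0)
        (𝓝 (f (Pi.single i 1))) := by
      simpa using (hc.tendsto 0).mono_left nhdsWithin_le_nhds
    refine le_of_tendsto ht ?_
    filter_upwards [self_mem_nhdsWithin] with s hs
    refine ((hf1 _ ((hPmem _).2 fun j => ?_)).le).trans hu
    have hs : 0 < s := hs
    have : (0 : ℝ) ≤ (Pi.single i 1 : ι → ℝ) j := by
      by_cases h : j = i
      · subst h; simp
      · simp [h]
    simp only [Pi.add_apply, Pi.smul_apply, Pi.one_apply, smul_eq_mul, mul_one]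
    linarith
  refine ⟨-l, fun i => ?_, ?_⟩
  · simpa [hlf] using hle i
  · by_contra! h
    have h1 : f 1 < u := hf1 _ ((hPmem _).2 fun i => by simp)
    have h2 : (1 : ι → ℝ) = ∑ i, Pi.single i 1 := (Finset.univ_sum_single _).symm
    rw [h2, map_sum] at h1
    have h3 : ∀ i, f (Pi.single i 1) = 0 := fun i => by simpa [hlf] using h i
    simp only [h3, Finset.sum_const_zero] at h1
    linarith

theorem exists_nat_forall_abs_mul_sub_int_lt {κ : Type*} [Finite κ] (e : κ → ℝ) (K : ℕ)
    {ε : ℝ} (hε : 0 < ε) :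
    ∃ N : ℕ, K ≤ N ∧ ∃ m : κ → ℤ, ∀ j, |N * e j - m j| < ε := by
  have := Fintype.ofFinite κ
  obtain ⟨y, -, φ, hφ, hlim⟩ := (isCompact_Icc (a := (0 : κ → ℝ)) (b := 1)).tendsto_subseq
    (x := fun N : ℕ => fun j => Int.fract (N * e j))
    (fun N => ⟨fun j => Int.fract_nonneg _, fun j => (Int.fract_lt_one _).le⟩)
  obtain ⟨M, hM⟩ := Metric.cauchySeq_iff.1 hlim.cauchySeq ε hε
  have h := hM (M + K) (by omega) M le_rfl
  have hge : φ M + K ≤ φ (M + K) := by simpa [add_comm] using hφ.add_le_nat K M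
  refine ⟨φ (M + K) - φ M, by omega, fun j => ⌊φ (M + K) * e j⌋ - ⌊φ M * e j⌋, fun j => ?_⟩
  have hj := (dist_le_pi_dist _ _ j).trans_lt h
  rw [Real.dist_eq] at hj
  simp only [Function.comp, Int.fract] at hj
  rw [Nat.cast_sub (by omega)]
  push_cast
  refine lt_of_eq_of_lt (congrArg _ ?_) hj
  ring

theorem not_exists_nat_combination_near {ι : Type*} [Fintype ι] {α : ι → ℝ}
    (hα : ∀ i, 0 ≤ α i)
    {p q K δ : ℝ} (hδ : 0 < δ) {M : ℕ}
    (h : ∀ m : ℕ, M ≤ m → ∀ t ∈ Set.Icc 0 δ, ∃ n : ι → ℕ,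
      |∑ i, n i * α i - (p * m + q + t)| ≤ K * Real.exp (-m)) : False := by
  classical
  have hK : 0 ≤ K := by
    obtain ⟨n, hn⟩ := h M le_rfl 0 ⟨le_rfl, hδ.le⟩
    exact nonneg_of_mul_nonneg_left ((abs_nonneg _).trans hn) (Real.exp_pos _)
  set C : ℝ := |p| + |q| + δ + K with hC
  have hC0 : 0 ≤ C := by positivity
  obtain ⟨B, hB⟩ := exists_nat_ge (∑ i, C / α i)
  set k := Fintype.card ι
  have hlim : Tendsto (fun m : ℕ => 2 * K * (B + 1) ^ k * 2 ^ k *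
      ((m : ℝ) ^ k * Real.exp (-m))) atTop (𝓝 0) := by
    simpa using ((Real.tendsto_pow_mul_exp_neg_atTop_nhds_zero k).comp
      tendsto_natCast_atTop_atTop).const_mul (2 * K * (B + 1) ^ k * 2 ^ k)
  obtain ⟨m, ⟨hmlt, hmM⟩, hm1⟩ := ((hlim.eventually (gt_mem_nhds hδ)).and
    (eventually_ge_atTop M) |>.and (eventually_ge_atTop 1)).exists
  set N : ℕ := (B * (m + 1) + 1) ^ k with hN
  have hNpos : (0 : ℝ) < N := by rw [hN]; positivity
  have hex : ∀ j : Fin (N + 1), ∃ n : ι → Fin (B * (m + 1) + 1),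
      |∑ i, (n i : ℕ) * α i - (p * m + q + δ * j / N)| ≤ K * Real.exp (-m) := by
    intro j
    have hj : ((j : ℕ) : ℝ) ≤ N := by exact_mod_cast Nat.lt_succ_iff.1 j.2
    have hjle : δ * j / N ≤ δ := by
      rw [div_le_iff₀ hNpos]; gcongr
    obtain ⟨n, hn⟩ := h m hmM (δ * j / N) ⟨by positivity, hjle⟩
    set n' : ι → ℕ := fun i => if α i = 0 then 0 else n i with hn'
    have hterm : ∀ i, (n' i : ℝ) * α i = n i * α i := by
      intro i
      by_cases h0 : α i = 0 <;> simp [hn', h0]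
    have hsum : ∑ i, n i * α i ≤ C * (m + 1) := by
      have h1 := (abs_le.1 hn).2
      have h2 : Real.exp (-m) ≤ 1 := Real.exp_le_one_iff.2 (by simp)
      have h3 : K * Real.exp (-m) ≤ K := mul_le_of_le_one_right hK h2
      have h4 : p * m ≤ |p| * m := by gcongr; exact le_abs_self p
      have h5 := le_abs_self q
      have h6 : (0 : ℝ) ≤ m := by positivity
      rw [hC]
      nlinarith [abs_nonneg p, abs_nonneg q]
    have hbd : ∀ i, n' i < B * (m + 1) + 1 := by
      intro i
      rw [Nat.lt_succ_iff]
      by_cases h0 : α i = 0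
      · simp [hn', h0]
      have hpos : 0 < α i := lt_of_le_of_ne (hα i) (Ne.symm h0)
      have h1 : (n' i : ℝ) * α i ≤ C * (m + 1) := by
        rw [hterm]
        exact (Finset.single_le_sum (f := fun i => (n i : ℝ) * α i)
          (fun i _ => mul_nonneg (by positivity) (hα i)) (Finset.mem_univ i)).trans hsum
      have h2 : C / α i ≤ B := (Finset.single_le_sum (f := fun i => C / α i)
          (fun i _ => div_nonneg hC0 (hα i)) (Finset.mem_univ i)).trans hB
      have h3 : (n' i : ℝ) ≤ B * (m + 1) := by
        calc (n' i : ℝ) ≤ C * (m + 1) / α i := (le_div_iff₀ hpos).2 h1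
          _ = C / α i * (m + 1) := by ring
          _ ≤ B * (m + 1) := by gcongr
      exact_mod_cast h3
    refine ⟨fun i => ⟨n' i, hbd i⟩, ?_⟩
    simpa only [hterm] using hn
  choose n hn using hex
  obtain ⟨j, j', hne, heq⟩ := Fintype.exists_ne_map_eq_of_card_lt n (by simp [hN, k])
  have h1 := hn j
  have h2 := hn j'
  rw [heq] at h1
  have h3 : |δ * j / N - δ * j' / N| ≤ 2 * (K * Real.exp (-m)) := by
    rw [abs_le] at h1 h2 ⊢
    constructor <;> linarith [h1.1, h1.2, h2.1, h2.2]
  have h4 : (1 : ℝ) ≤ |(j : ℝ) - j'| := by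
    have : (j : ℤ) - j' ≠ 0 := by
      intro h0
      exact hne (Fin.ext (by omega))
    have := Int.one_le_abs this
    exact_mod_cast this
  have h5 : δ / N ≤ 2 * (K * Real.exp (-m)) := by
    refine le_trans ?_ h3
    rw [← sub_div, ← mul_sub, abs_div, abs_mul, abs_of_pos hδ, abs_of_pos hNpos]
    gcongr
    exact le_mul_of_one_le_right hδ.le h4
  have h6 : (N : ℝ) ≤ (B + 1) ^ k * 2 ^ k * m ^ k := by
    rw [hN, ← mul_pow, ← mul_pow]
    push_cast
    gcongr
    have : (1 : ℝ) ≤ m := by exact_mod_cast hm1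
    have hB0 : (0 : ℝ) ≤ B := by positivity
    nlinarith
  rw [div_le_iff₀ hNpos] at h5
  have h7 : 2 * (K * Real.exp (-m)) * N ≤
      2 * (K * Real.exp (-m)) * ((B + 1) ^ k * 2 ^ k * m ^ k) := by gcongr
  linarith

section Exponential

open NormedSpace

variable {A : Type*} [NormedCommRing A] [NormedAlgebra ℝ A]

theorem exists_exp_eq_one_add [CompleteSpace A] :
    ∃ L > 0, ∃ η > 0, ∀ z : A, ‖z‖ < η → ∃ v : A, exp v = 1 + z ∧ ‖v‖ ≤ L * ‖z‖ := by
  have h : HasStrictFDerivAt exp ((ContinuousLinearEquiv.refl ℝ A : A ≃L[ℝ] A) : A →L[ℝ] A) 0 :=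
    hasStrictFDerivAt_exp_zero
  have hr := h.eventually_right_inverse
  have hO := h.to_localInverse.hasFDerivAt.isBigO_sub
  rw [h.localInverse_apply_image] at hO
  obtain ⟨L, hL, hO⟩ := hO.exists_pos
  rw [Asymptotics.IsBigOWith] at hO
  rw [exp_zero] at hr hO
  obtain ⟨η, hη, H⟩ := Metric.eventually_nhds_iff.1 (hr.and hO)
  refine ⟨L, hL, η, hη, fun z hz => ?_⟩
  have := @H (1 + z) (by simpa [dist_eq_norm] using hz)
  exact ⟨_, this.1, by simpa using this.2⟩

theorem eventually_mem_range_exp_iff_s15 [CompleteSpace A] {u : A} (hu : IsUnit u) :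
    ∀ᶠ y in 𝓝 u, (y ∈ Set.range (exp : A → A)) = (u ∈ Set.range (exp : A → A)) := by
  let _ : NormedAlgebra ℚ A := NormedAlgebra.restrictScalars ℚ ℝ A
  obtain ⟨L, -, η, hη, H⟩ := exists_exp_eq_one_add (A := A)
  obtain ⟨w, hw⟩ := hu.exists_right_inv
  have hc : ContinuousAt (fun y : A => w * y - 1) u := by fun_prop
  have h0 : ‖w * u - 1‖ < η := by rw [mul_comm, hw]; simpa using hη
  have : ∀ᶠ y in 𝓝 u, ‖w * y - 1‖ < η := hc.norm.eventually (gt_mem_nhds h0)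
  filter_upwards [this] with y hy
  obtain ⟨v, hv, -⟩ := H _ hy
  have hy' : y = u * exp v := by rw [hv]; linear_combination (-y) * hw
  apply propext
  constructor
  · rintro ⟨a, ha⟩
    refine ⟨a - v, ?_⟩
    have h1 : exp v * exp (-v) = (1 : A) := by rw [← exp_add]; simp
    rw [sub_eq_add_neg, exp_add, ha, hy', mul_assoc, h1, mul_one]
  · rintro ⟨a, ha⟩
    exact ⟨a + v, by rw [exp_add, ha, hy']⟩

open Polynomial in
theorem exists_forall_isUnit_quadratic [FiniteDimensional ℝ A] {g : A} (hg : IsUnit g) :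
    ∃ c : ℝ, ∀ t : ℝ, IsUnit (g ^ 2 - algebraMap ℝ A (2 * t * c) * g + algebraMap ℝ A (t ^ 2)) := by
  have hgint : IsIntegral ℝ g := Algebra.IsIntegral.isIntegral g
  set p := minpoly ℝ g with hp
  have hp0 : p ≠ 0 := minpoly.ne_zero hgint
  have hfin : ((fun w : ℂ => (w.re / ‖w‖) ^ 2) '' (p.rootSet ℂ)).Finite :=
    (p.rootSet_finite ℂ).image _
  have hfin2 : {c : ℝ | c ^ 2 ∈ (fun w : ℂ => (w.re / ‖w‖) ^ 2) '' (p.rootSet ℂ)}.Finite := by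
    refine Set.Finite.preimage' hfin fun b _ => ?_
    refine (Set.toFinite {√b, -√b}).subset fun c hc => ?_
    have hc : c ^ 2 = b := hc
    rcases abs_choice c with h | h
    · left; rw [← hc, Real.sqrt_sq_eq_abs, h]
    · right; rw [← hc, Real.sqrt_sq_eq_abs, h]; simp
  obtain ⟨c, hc, hcn⟩ := (Set.Ioo_infinite (show (-1 : ℝ) < 1 by norm_num)).exists_notMem_finite hfin2
  refine ⟨c, fun t => ?_⟩
  rcases eq_or_ne t 0 with rfl | ht
  · simpa using hg.pow 2
  have hcop : IsCoprime p (X ^ 2 - C (2 * t * c) * X + C (t ^ 2)) := by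
    rw [isCoprime_iff_aeval_ne_zero_of_isAlgClosed ℝ ℂ]
    intro w
    by_contra! hw
    obtain ⟨hw1, hw2⟩ := hw
    have hmem : w ∈ p.rootSet ℂ := (mem_rootSet_of_ne hp0).2 hw1
    apply hcn
    refine ⟨w, hmem, ?_⟩
    have hre := congrArg Complex.re hw2
    have him := congrArg Complex.im hw2
    simp [pow_two] at hre him
    have hc2 : c ^ 2 < 1 := by nlinarith [hc.1, hc.2]
    have ht2 : 0 < t ^ 2 := by positivity
    have hwre : w.re = t * c := by
      have : w.im * (w.re - t * c) = 0 := by linarith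
      rcases mul_eq_zero.1 this with h | h
      · rw [h] at hre
        nlinarith [sq_nonneg (w.re - t * c), mul_pos ht2 (sub_pos.2 hc2)]
      · linarith
    have hn : ‖w‖ ^ 2 = t ^ 2 := by
      rw [← Complex.normSq_eq_norm_sq, Complex.normSq_apply]
      rw [hwre] at hre ⊢
      linarith
    change (w.re / ‖w‖) ^ 2 = c ^ 2
    rw [div_pow, hn, hwre]
    field_simp
  obtain ⟨a, b, hab⟩ := hcop
  have := congrArg (aeval g) hab
  simp only [map_add, map_mul, hp, minpoly.aeval, mul_zero, zero_add, map_one, map_sub, map_pow,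
    aeval_X, aeval_C] at this
  refine IsUnit.of_mul_eq_one_right (aeval g b) ?_
  simpa using this

theorem exists_exp_eq_sq [FiniteDimensional ℝ A] {g : A} (hg : IsUnit g) :
    ∃ a : A, exp a = g ^ 2 := by
  have := FiniteDimensional.complete ℝ A
  let _ : NormedAlgebra ℚ A := NormedAlgebra.restrictScalars ℚ ℝ A
  obtain ⟨c, hc⟩ := exists_forall_isUnit_quadratic hg
  set Q : ℝ → A := fun t => g ^ 2 - algebraMap ℝ A (2 * t * c) * g + algebraMap ℝ A (t ^ 2) with hQ
  have halg : Continuous (algebraMap ℝ A) := continuous_algebraMap ℝ A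
  have hQc : Continuous Q := by fun_prop
  have hloc : IsLocallyConstant (fun t => Q t ∈ Set.range (exp : A → A)) := by
    rw [IsLocallyConstant.iff_eventually_eq]
    intro t
    exact hQc.continuousAt.eventually (eventually_mem_range_exp_iff_s15 (hc t))
  have hlim : Tendsto (fun t : ℝ => algebraMap ℝ A (t⁻¹ ^ 2) * Q t) atTop (𝓝 1) := by
    have h1 : Tendsto (fun t : ℝ => algebraMap ℝ A (t⁻¹ ^ 2) * g ^ 2
        - algebraMap ℝ A (2 * t⁻¹ * c) * g + 1) atTop (𝓝 (algebraMap ℝ A (0 ^ 2) * g ^ 2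
        - algebraMap ℝ A (2 * 0 * c) * g + 1)) := by
      have h0 : Continuous (fun s : ℝ => algebraMap ℝ A (s ^ 2) * g ^ 2
        - algebraMap ℝ A (2 * s * c) * g + 1) := by fun_prop
      exact (h0.tendsto 0).comp tendsto_inv_atTop_zero
    simp only [ne_eq, OfNat.ofNat_ne_zero, not_false_eq_true, zero_pow, map_zero, zero_mul,
      mul_zero, sub_self, zero_add] at h1
    refine h1.congr' ?_
    filter_upwards [eventually_gt_atTop 0] with t ht
    have e1 : t⁻¹ ^ 2 * (2 * t * c) = 2 * t⁻¹ * c := by field_simp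
    have e2 : t⁻¹ ^ 2 * t ^ 2 = 1 := by field_simp
    rw [hQ]
    simp only
    rw [mul_add, mul_sub, ← mul_assoc _ _ g, ← map_mul, ← map_mul, e1, e2, map_one]
  have h1 := hlim.eventually (eventually_mem_range_exp_iff_s15 (isUnit_one (M := A)))
  obtain ⟨t, ht, htpos⟩ := (h1.and (eventually_gt_atTop 0)).exists
  have hmem : Q t ∈ Set.range (exp : A → A) := by
    have : algebraMap ℝ A (t⁻¹ ^ 2) * Q t ∈ Set.range (exp : A → A) := by
      rw [ht]; exact ⟨0, exp_zero⟩
    obtain ⟨a, ha⟩ := this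
    refine ⟨algebraMap ℝ A (Real.log (t ^ 2)) + a, ?_⟩
    rw [exp_add, ha, ← algebraMap_exp_comm, ← Real.exp_eq_exp_ℝ, Real.exp_log (by positivity),
      ← mul_assoc, ← map_mul]
    have e2 : t ^ 2 * t⁻¹ ^ 2 = 1 := by field_simp
    rw [e2, map_one, one_mul]
  have h2 := hloc.apply_eq_of_preconnectedSpace t 0
  rw [h2] at hmem
  simpa [hQ] using hmem

theorem exp_sum_nsmul_eq_sq [CompleteSpace A] {ι : Type*} [Fintype ι] {g a : ι → A}
    (ha : ∀ i, exp (a i) = g i ^ 2) (n : ι → ℕ) :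
    exp (∑ i, n i • a i) = (∏ i, g i ^ n i) ^ 2 := by
  let _ : NormedAlgebra ℚ A := NormedAlgebra.restrictScalars ℚ ℝ A
  rw [exp_sum, ← Finset.prod_pow]
  refine Finset.prod_congr rfl fun i _ => ?_
  rw [exp_nsmul, ha, ← pow_mul, ← pow_mul, mul_comm]

theorem dual_apply_eq_zero_of_coarselyDense [FiniteDimensional ℝ A] {ι : Type*} [Fintype ι]
    {g a : ι → A} (hg : ∀ i, IsUnit (g i)) (ha : ∀ i, exp (a i) = g i ^ 2)
    {C : Set A} (hCne : C.Nonempty) (hCopen : IsOpen C)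
    (hCcone : ∀ x ∈ C, ∀ r : ℝ, 0 < r → r • x ∈ C) {D : ℝ}
    (hcd : ∀ x ∈ C, ∃ n : ι → ℕ, ∏ i, g i ^ n i ∈ C ∧ ‖x - ∏ i, g i ^ n i‖ < D)
    (l : A →ₗ[ℝ] ℝ) (hl : ∀ x, exp x = 1 → l x = 0) (hnonneg : ∀ i, 0 ≤ l (a i)) (i₀ : ι) :
    l (a i₀) = 0 := by
  have := FiniteDimensional.complete ℝ A
  let _ : NormedAlgebra ℚ A := NormedAlgebra.restrictScalars ℚ ℝ A
  by_contra hne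
  have hpos : 0 < l (a i₀) := lt_of_le_of_ne (hnonneg i₀) (Ne.symm hne)
  set e := a i₀
  obtain ⟨x, hx⟩ := hCne
  obtain ⟨n₀, hs₀, hxD⟩ := hcd x hx
  have hD : 0 < D := (norm_nonneg _).trans_lt hxD
  set s₀ := ∏ i, g i ^ n₀ i with hs₀def
  set b := ∑ i, n₀ i • a i with hb
  have hs₀b : exp b = s₀ ^ 2 := exp_sum_nsmul_eq_sq ha n₀
  have hu : IsUnit s₀ := by
    rw [hs₀def]
    exact (IsUnit.prod_univ_iff).2 fun i => (hg i).pow _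
  obtain ⟨w, hw⟩ := hu.exists_right_inv
  obtain ⟨L, hL, η, hη, hlog⟩ := exists_exp_eq_one_add (A := A)
  obtain ⟨Λ, hΛ⟩ : ∃ Λ : ℝ, 0 ≤ Λ ∧ ∀ v, |l v| ≤ Λ * ‖v‖ :=
    ⟨‖LinearMap.toContinuousLinearMap l‖, norm_nonneg _,
      fun v => (LinearMap.toContinuousLinearMap l).le_opNorm v⟩
  set B : ℝ := ‖(1 : A)‖ + 1
  have hexp : Continuous (exp : A → A) := exp_continuous
  have hnear : ∀ᶠ t : ℝ in 𝓝 0, s₀ * exp (t • e) ∈ C ∧ ‖exp (-(t • e))‖ < B := by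
    have h1 : Continuous fun t : ℝ => s₀ * exp (t • e) := by fun_prop
    have h2 : Continuous fun t : ℝ => ‖exp (-(t • e))‖ := by fun_prop
    refine (h1.continuousAt.eventually (hCopen.mem_nhds ?_)).and
      (h2.continuousAt.eventually (gt_mem_nhds ?_))
    · simpa using hs₀
    · simp [B]
  obtain ⟨δ, hδ, hball⟩ := Metric.eventually_nhds_iff.1 hnear
  have hsmall : Tendsto (fun m : ℕ => ‖w‖ * B * D * Real.exp (-m)) atTop (𝓝 0) := by
    simpa using ((Real.tendsto_exp_neg_atTop_nhds_zero).comp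
      tendsto_natCast_atTop_atTop).const_mul (‖w‖ * B * D)
  obtain ⟨M, hM⟩ := eventually_atTop.1 (hsmall.eventually (gt_mem_nhds hη))
  refine not_exists_nat_combination_near hnonneg (p := 2 * l 1) (q := l b)
    (K := 2 * (Λ * (L * (‖w‖ * B * D)))) (δ := l e * δ) (M := M) (by positivity) ?_
  intro m hm t' ht'
  set t := t' / (2 * l e) with ht
  have htδ : dist t 0 < δ := by
    rw [Real.dist_eq, sub_zero, abs_of_nonneg (div_nonneg ht'.1 (by positivity)),
      div_lt_iff₀ (by positivity)]
    nlinarith [ht'.2, mul_pos hpos hδ]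
  obtain ⟨hmem, hB⟩ := hball htδ
  set y := Real.exp m • (s₀ * exp (t • e)) with hy
  obtain ⟨n, -, hn⟩ := hcd y (hCcone _ hmem _ (Real.exp_pos _))
  set G := ∏ i, g i ^ n i with hG
  set z := Real.exp (-m) • (w * exp (-(t • e)) * (G - y)) with hz
  have hznorm : ‖z‖ ≤ ‖w‖ * B * D * Real.exp (-m) := by
    rw [hz, norm_smul, Real.norm_eq_abs, Real.abs_exp, mul_comm]
    gcongr
    refine (norm_mul_le _ _).trans ?_
    gcongr
    · refine (norm_mul_le _ _).trans ?_
      gcongr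
    · rw [norm_sub_rev]; exact hn.le
  obtain ⟨v, hv, hvz⟩ := hlog z (hznorm.trans_lt (hM m hm))
  have hmm : Real.exp m * Real.exp (-m) = 1 := by rw [← Real.exp_add]; simp
  have hee : exp (t • e) * exp (-(t • e)) = 1 := by rw [← exp_add]; simp
  have hyz : y * z = G - y := by
    calc y * z = (Real.exp m * Real.exp (-m)) •
          ((s₀ * w) * (exp (t • e) * exp (-(t • e))) * (G - y)) := by
          rw [hy, hz, smul_mul_smul_comm]; congr 1; ring
      _ = G - y := by rw [hmm, hw, hee]; simp
  have hGy : G = y * exp v := by rw [hv, mul_add, hyz]; ring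
  have hm : exp (algebraMap ℝ A m) = algebraMap ℝ A (Real.exp m) := by
    rw [← algebraMap_exp_comm, ← Real.exp_eq_exp_ℝ]
  have hGexp : exp (∑ i, n i • a i) = exp (b + 2 • (algebraMap ℝ A m + t • e + v)) := by
    rw [exp_sum_nsmul_eq_sq ha n, ← hG, hGy, exp_add, exp_nsmul, exp_add, exp_add, hm, hs₀b, hy,
      Algebra.smul_def]
    ring
  have hlG : l (∑ i, n i • a i) = l (b + 2 • (algebraMap ℝ A m + t • e + v)) := by
    rw [← sub_eq_zero, ← map_sub]
    apply hl
    rw [sub_eq_add_neg, exp_add, hGexp, ← exp_add, add_neg_cancel, exp_zero]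
  refine ⟨n, ?_⟩
  have h1 : l (∑ i, n i • a i) = ∑ i, n i * l (a i) := by
    rw [map_sum]
    exact Finset.sum_congr rfl fun i _ => by rw [map_nsmul, nsmul_eq_mul]
  have h2 : l (b + 2 • (algebraMap ℝ A m + t • e + v)) =
      2 * l 1 * m + l b + t' + 2 * l v := by
    have : t * l e = t' / 2 := by rw [ht]; field_simp
    rw [map_add, map_nsmul, map_add, map_add, map_smul, Algebra.algebraMap_eq_smul_one, map_smul,
      smul_eq_mul, smul_eq_mul, this, nsmul_eq_mul, Nat.cast_ofNat]
    ring
  rw [← h1, hlG, h2, add_sub_cancel_left, abs_mul, abs_two]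
  calc 2 * |l v| ≤ 2 * (Λ * (L * (‖w‖ * B * D * Real.exp (-m)))) := by
        have := hΛ.2 v
        have := hΛ.1
        gcongr
        exact (hΛ.2 v).trans (by gcongr; exact hvz.trans (by gcongr))
    _ = _ := by ring

theorem exists_prod_pow_near_one_of_combination_mem_span [FiniteDimensional ℝ A] {ι : Type*}
    [Fintype ι] {g a : ι → A} (ha : ∀ i, exp (a i) = g i ^ 2)
    {c : ι → ℝ} (hc : ∀ i, 0 < c i)
    (hmem : ∑ i, c i • a i ∈ Submodule.span ℝ {x : A | exp x = 1}) {ε : ℝ} (hε : 0 < ε) :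
    ∃ n : ι → ℕ, (∀ i, 1 ≤ n i) ∧ ‖∏ i, g i ^ n i - 1‖ < ε := by
  have := FiniteDimensional.complete ℝ A
  let _ : NormedAlgebra ℚ A := NormedAlgebra.restrictScalars ℚ ℝ A
  obtain ⟨k, d, y, hy⟩ := Submodule.mem_span_set'.1 hmem
  set Φ : (ι ⊕ Fin k → ℝ) → A :=
    fun f => ∑ i, f (Sum.inl i) • a i - ∑ j, f (Sum.inr j) • (y j : A) with hΦ
  have hexp : Continuous (exp : A → A) := exp_continuous
  have hΦc : Continuous fun f => ‖exp (-Φ f) - 1‖ := by fun_prop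
  have hΦ0 : ‖exp (-Φ 0) - 1‖ < ε := by simpa [hΦ] using hε
  obtain ⟨δ, hδ, hball⟩ := Metric.eventually_nhds_iff.1
    (hΦc.continuousAt.eventually (gt_mem_nhds hΦ0))
  obtain ⟨K, hK⟩ := exists_nat_ge (∑ i, 2 / c i)
  set v : ι ⊕ Fin k → ℝ := Sum.elim c d
  obtain ⟨N, hNK, m, hm⟩ := exists_nat_forall_abs_mul_sub_int_lt v K (lt_min hδ one_pos)
  have hmpos : ∀ i, 1 ≤ m (Sum.inl i) := by
    intro i
    have h1 : 2 / c i ≤ N := by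
      refine (Finset.single_le_sum (f := fun i => 2 / c i)
        (fun i _ => div_nonneg two_pos.le (hc i).le) (Finset.mem_univ i)).trans (hK.trans ?_)
      exact_mod_cast hNK
    rw [div_le_iff₀ (hc i)] at h1
    have h2 := (abs_lt.1 ((hm (Sum.inl i)).trans_le (min_le_right _ _))).2
    simp only [v, Sum.elim_inl] at h2
    have : (1 : ℝ) < m (Sum.inl i) := by linarith
    exact_mod_cast this.le
  have hexpy : exp (∑ j, m (Sum.inr j) • (y j : A)) = 1 := by
    rw [exp_sum]
    refine Finset.prod_eq_one fun j _ => ?_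
    have hj : exp (y j : A) = 1 := (y j).2
    have hjn : exp (-(y j : A)) = 1 := by
      have : exp (y j : A) * exp (-(y j : A)) = 1 := by rw [← exp_add]; simp
      rwa [hj, one_mul] at this
    obtain ⟨p, hp | hp⟩ := (m (Sum.inr j)).eq_nat_or_neg
    · rw [hp, natCast_zsmul, exp_nsmul, hj, one_pow]
    · rw [hp, neg_smul, natCast_zsmul, ← smul_neg, exp_nsmul, hjn, one_pow]
  have hcd : ∑ i, c i • a i - ∑ j, d j • (y j : A) = 0 := by rw [hy, sub_self]
  set f : ι ⊕ Fin k → ℝ := fun j => N * v j - m j with hf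
  have hΦf : ∑ i, (m (Sum.inl i)).toNat • a i = -Φ f + ∑ j, m (Sum.inr j) • (y j : A) := by
    have h1 : ∀ i, (m (Sum.inl i)).toNat • a i = (m (Sum.inl i) : ℝ) • a i := by
      intro i
      rw [← natCast_zsmul, Int.toNat_of_nonneg (by linarith [hmpos i]), Int.cast_smul_eq_zsmul]
    have h2 : Φ f = (N : ℝ) • (∑ i, c i • a i - ∑ j, d j • (y j : A))
        - ∑ i, (m (Sum.inl i) : ℝ) • a i + ∑ j, m (Sum.inr j) • (y j : A) := by
      simp only [hΦ, hf, v, Sum.elim_inl, Sum.elim_inr, sub_smul, Finset.sum_sub_distrib, mul_smul,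
        Finset.smul_sum, smul_sub, Int.cast_smul_eq_zsmul]
      abel
    rw [h2, hcd, smul_zero, Finset.sum_congr rfl fun i _ => h1 i]
    abel
  refine ⟨fun i => 2 * (m (Sum.inl i)).toNat, fun i => ?_, ?_⟩
  · have := hmpos i
    show 1 ≤ 2 * (m (Sum.inl i)).toNat
    omega
  · have hprod : ∏ i, g i ^ (2 * (m (Sum.inl i)).toNat) = exp (-Φ f) := by
      have h := exp_sum_nsmul_eq_sq ha fun i => (m (Sum.inl i)).toNat
      rw [hΦf, exp_add, hexpy, mul_one] at h
      rw [h, ← Finset.prod_pow]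
      exact Finset.prod_congr rfl fun i _ => by rw [mul_comm, pow_mul]
    rw [hprod]
    apply hball
    rw [dist_pi_lt_iff hδ]
    intro j
    rw [Real.dist_eq, Pi.zero_apply, sub_zero]
    exact (hm j).trans_le (min_le_left _ _)

theorem exists_prod_pow_near_one_of_coarselyDense [FiniteDimensional ℝ A] {ι : Type*} [Fintype ι]
    {g : ι → A} (hg : ∀ i, IsUnit (g i))
    {C : Set A} (hCne : C.Nonempty) (hCopen : IsOpen C)
    (hCcone : ∀ x ∈ C, ∀ r : ℝ, 0 < r → r • x ∈ C) {D : ℝ}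
    (hcd : ∀ x ∈ C, ∃ n : ι → ℕ, ∏ i, g i ^ n i ∈ C ∧ ‖x - ∏ i, g i ^ n i‖ < D)
    {ε : ℝ} (hε : 0 < ε) :
    ∃ n : ι → ℕ, (∀ i, 1 ≤ n i) ∧ ‖∏ i, g i ^ n i - 1‖ < ε := by
  choose a ha using fun i => exists_exp_eq_sq (hg i)
  set W := Submodule.span ℝ {x : A | exp x = 1} with hW
  rcases exists_pos_combination_eq_zero_or_exists_dual_nonneg fun i => W.mkQ (a i) with
    ⟨c, hc, hsum⟩ | ⟨l, hl, i, hi⟩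
  · refine exists_prod_pow_near_one_of_combination_mem_span ha hc ?_ hε
    rw [← hW, ← Submodule.ker_mkQ W, LinearMap.mem_ker, map_sum]
    simpa using hsum
  · refine absurd (dual_apply_eq_zero_of_coarselyDense hg ha hCne hCopen hCcone hcd
      (l.comp W.mkQ) (fun x hx => ?_) hl i) hi
    have : W.mkQ x = 0 := by
      rw [← LinearMap.mem_ker, Submodule.ker_mkQ]
      exact Submodule.subset_span hx
    rw [LinearMap.comp_apply, this, map_zero]

end Exponential

theorem isUnit_of_map_injective {K A R : Type*} [Field K] [CommRing A] [Algebra K A]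
    [FiniteDimensional K A] [Ring R] [Algebra K R] {φ : A →ₐ[K] R} (hφ : Function.Injective φ)
    {x : A} (hx : IsUnit (φ x)) : IsUnit x := by
  have hinj : Function.Injective (LinearMap.mulLeft K x) := fun y z hyz =>
    hφ (hx.mul_left_cancel (by simpa using congrArg φ hyz))
  obtain ⟨y, hy⟩ := LinearMap.injective_iff_surjective.1 hinj 1
  exact IsUnit.of_mul_eq_one y hy

theorem Submodule.eq_top_of_coarselyDense_cone {V : Type*} [NormedAddCommGroup V] [NormedSpace ℝ V]
    [FiniteDimensional ℝ V] (W : Submodule ℝ V) {C : Set V} (hCne : C.Nonempty) (hCopen : IsOpen C)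
    (hCcone : ∀ x ∈ C, ∀ r : ℝ, 0 < r → r • x ∈ C) {D : ℝ} (hD : 0 < D)
    (hW : ∀ x ∈ C, ∃ w ∈ W, dist x w < D) : W = ⊤ := by
  refine W.eq_top_of_nonempty_interior' (hCne.mono (interior_maximal (fun x hx => ?_) hCopen))
  rw [← W.closed_of_finiteDimensional.closure_eq, Metric.mem_closure_iff]
  intro ε hε
  have hr : 0 < D / ε := div_pos hD hε
  obtain ⟨w, hw, hd⟩ := hW _ (hCcone x hx _ hr)
  refine ⟨(D / ε)⁻¹ • w, W.smul_mem _ hw, ?_⟩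
  have h : x = (D / ε)⁻¹ • (D / ε) • x := by rw [inv_smul_smul₀ hr.ne']
  rw [h, dist_smul₀, Real.norm_eq_abs, abs_of_pos (inv_pos.2 hr), inv_mul_lt_iff₀ hr]
  rwa [div_mul_cancel₀ _ hε.ne']

theorem Submonoid.eq_one_or_mem_subsemigroup_closure {M : Type*} [Monoid M] {T : Set M} {u : M}
    (hu : u ∈ Submonoid.closure T) : u = 1 ∨ u ∈ Subsemigroup.closure T := by
  induction hu using Submonoid.closure_induction with
  | mem x hx => exact Or.inr (Subsemigroup.subset_closure hx)
  | one => exact Or.inl rfl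
  | mul x y _ _ hx hy =>
    rcases hx with rfl | hx
    · rwa [one_mul]
    · rcases hy with rfl | hy
      · rw [mul_one]; exact Or.inr hx
      · exact Or.inr (mul_mem hx hy)

theorem one_mem_closure_mul_left_submonoid_of_commAlgebra
    {V : Type*} [NormedAddCommGroup V] [NormedSpace ℝ V] [FiniteDimensional ℝ V]
    {A : Type*} [NormedCommRing A] [NormedAlgebra ℝ A] [FiniteDimensional ℝ A]
    {φ : A →ₐ[ℝ] (V →L[ℝ] V)} (hφ : Isometry φ)
    {T : Set (V →L[ℝ] V)ˣ} (hTfin : T.Finite) {g : T → A}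
    (hg : ∀ s : T, φ (g s) = (s : (V →L[ℝ] V)ˣ))
    (v₀ : V) {C : Set V} (hCne : C.Nonempty) (hCopen : IsOpen C)
    (hCcone : ∀ x ∈ C, ∀ r : ℝ, 0 < r → r • x ∈ C) {D : ℝ} (hD : 0 < D)
    (hcd : ∀ x ∈ C, ∃ s ∈ Submonoid.closure T,
      (s : V →L[ℝ] V) v₀ ∈ C ∧ dist x ((s : V →L[ℝ] V) v₀) < D)
    {t : (V →L[ℝ] V)ˣ} (ht : t ∈ T) :
    (1 : (V →L[ℝ] V)ˣ) ∈
      closure ((fun u => t * u) '' (Submonoid.closure T : Set (V →L[ℝ] V)ˣ)) := by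
  classical
  have := hTfin.fintype
  have := FiniteDimensional.complete ℝ V
  have hunits : ∀ i, IsUnit (g i) := fun i =>
    isUnit_of_map_injective hφ.injective (hg i ▸ (i : (V →L[ℝ] V)ˣ).isUnit)
  have hsingle : ∀ s : T, ∏ i, g i ^ (Pi.single s 1 : T → ℕ) i = g s := by
    intro s
    rw [Finset.prod_eq_single s (fun j _ hj => by simp [Pi.single_eq_of_ne hj]) (by simp)]
    simp
  have hprod : ∀ s ∈ Submonoid.closure T, ∃ n : T → ℕ,
      φ (∏ i, g i ^ n i) = (s : V →L[ℝ] V) := by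
    intro s hs
    induction hs using Submonoid.closure_induction with
    | mem x hx => exact ⟨Pi.single ⟨x, hx⟩ 1, by rw [hsingle, hg]⟩
    | one => exact ⟨0, by simp⟩
    | mul x y _ _ hx hy =>
      obtain ⟨n, hn⟩ := hx
      obtain ⟨m, hm⟩ := hy
      refine ⟨n + m, ?_⟩
      simp only [Pi.add_apply, pow_add, Finset.prod_mul_distrib]
      rw [Units.val_mul, ← hn, ← hm, map_mul]
  have hunit : ∀ n : T → ℕ, ∃ u ∈ Submonoid.closure T,
      (u : V →L[ℝ] V) = φ (∏ i, g i ^ n i) := by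
    intro n
    let N : Submonoid A :=
      ((Submonoid.closure T).map (Units.coeHom (V →L[ℝ] V))).comap φ.toMonoidHom
    have : ∏ i, g i ^ n i ∈ N := Submonoid.prod_mem _ fun i _ => Submonoid.pow_mem _
      (Submonoid.mem_comap.2 (Submonoid.mem_map.2
        ⟨i.1, Submonoid.subset_closure i.2, (hg i).symm⟩)) _
    exact Submonoid.mem_map.1 (Submonoid.mem_comap.1 this)
  let Φ : A →ₗ[ℝ] V :=
    { toFun := fun a => φ a v₀
      map_add' := fun _ _ => by simp
      map_smul' := fun _ _ => by simp }
  have hΦ : ∀ a, Φ a = φ a v₀ := fun _ => rfl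
  have hsurj : LinearMap.range Φ = ⊤ := by
    refine Submodule.eq_top_of_coarselyDense_cone _ hCne hCopen hCcone hD fun x hx => ?_
    obtain ⟨s, hs, -, hsd⟩ := hcd x hx
    obtain ⟨n, hn⟩ := hprod s hs
    exact ⟨_, ⟨∏ i, g i ^ n i, by rw [hΦ, hn]⟩, hsd⟩
  have hinj : Function.Injective Φ := by
    rw [injective_iff_map_eq_zero]
    intro a ha
    apply hφ.injective
    rw [map_zero]
    ext v
    obtain ⟨b, rfl⟩ := LinearMap.range_eq_top.1 hsurj v
    rw [hΦ] at ha ⊢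
    rw [← mul_apply_eq_comp, ← map_mul, mul_comm, map_mul,
      mul_apply_eq_comp, ha, map_zero, zero_apply]
  let e : A ≃L[ℝ] V :=
    (LinearEquiv.ofBijective Φ ⟨hinj, LinearMap.range_eq_top.1 hsurj⟩).toContinuousLinearEquiv
  have he : ∀ a : A, e a = φ a v₀ := fun a => rfl
  have hcdA : ∀ x ∈ e ⁻¹' C, ∃ n : T → ℕ, ∏ i, g i ^ n i ∈ e ⁻¹' C ∧
      ‖x - ∏ i, g i ^ n i‖ < (‖(e.symm : V →L[ℝ] A)‖ + 1) * D := by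
    intro x hx
    obtain ⟨s, hs, hsC, hsd⟩ := hcd _ hx
    obtain ⟨n, hn⟩ := hprod s hs
    have hn' : e (∏ i, g i ^ n i) = (s : V →L[ℝ] V) v₀ := by rw [he, hn]
    refine ⟨n, by rwa [Set.mem_preimage, hn'], ?_⟩
    have h := (e.symm : V →L[ℝ] A).le_opNorm (e (x - ∏ i, g i ^ n i))
    rw [ContinuousLinearEquiv.coe_coe, e.symm_apply_apply, map_sub, hn', ← dist_eq_norm (e x)] at h
    refine h.trans_lt ?_
    nlinarith [norm_nonneg (e.symm : V →L[ℝ] A), dist_nonneg (x := e x)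
      (y := (s : V →L[ℝ] V) v₀)]
  have hneA : (e ⁻¹' C).Nonempty := hCne.preimage e.surjective
  have hconeA : ∀ x ∈ e ⁻¹' C, ∀ r : ℝ, 0 < r → r • x ∈ e ⁻¹' C := by
    intro x hx r hr
    rw [Set.mem_preimage, map_smul]
    exact hCcone _ hx r hr
  rw [Units.isOpenEmbedding_val.isInducing.closure_eq_preimage_closure_image, Set.mem_preimage,
    Metric.mem_closure_iff]
  intro ε hε
  obtain ⟨n, hn1, hn⟩ := exists_prod_pow_near_one_of_coarselyDense hunits hneA
    (hCopen.preimage e.continuous) hconeA hcdA hε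
  obtain ⟨u, hu, huv⟩ := hunit (n - Pi.single ⟨t, ht⟩ 1)
  refine ⟨_, ⟨_, ⟨u, hu, rfl⟩, rfl⟩, ?_⟩
  have hsplit : ∏ i, g i ^ n i =
      g ⟨t, ht⟩ * ∏ i, g i ^ (n - Pi.single ⟨t, ht⟩ 1 : T → ℕ) i := by
    conv_rhs => rw [← hsingle ⟨t, ht⟩]
    rw [← Finset.prod_mul_distrib]
    refine Finset.prod_congr rfl fun i _ => ?_
    rw [← pow_add, Pi.sub_apply, Nat.add_sub_cancel']
    refine le_trans ?_ (hn1 i)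
    by_cases h : i = ⟨t, ht⟩
    · subst h; simp
    · simp [Pi.single_eq_of_ne h]
  have hval : ((t * u : (V →L[ℝ] V)ˣ) : V →L[ℝ] V) = φ (∏ i, g i ^ n i) := by
    rw [hsplit, Units.val_mul, huv, map_mul, hg]
  rw [dist_comm, hval, Units.val_one, ← map_one φ, hφ.dist_eq, dist_eq_norm]
  exact hn

theorem one_mem_closure_mul_left_submonoid_of_coarselyDense
    {V : Type*} [NormedAddCommGroup V] [NormedSpace ℝ V] [FiniteDimensional ℝ V]
    {T : Set (V →L[ℝ] V)ˣ} (hTfin : T.Finite) (hTcomm : ∀ s ∈ T, ∀ t ∈ T, s * t = t * s)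
    (v₀ : V) {C : Set V} (hCne : C.Nonempty) (hCopen : IsOpen C)
    (hCcone : ∀ x ∈ C, ∀ r : ℝ, 0 < r → r • x ∈ C) {D : ℝ} (hD : 0 < D)
    (hcd : ∀ x ∈ C, ∃ s ∈ Submonoid.closure T,
      (s : V →L[ℝ] V) v₀ ∈ C ∧ dist x ((s : V →L[ℝ] V) v₀) < D)
    {t : (V →L[ℝ] V)ˣ} (ht : t ∈ T) :
    (1 : (V →L[ℝ] V)ˣ) ∈
      closure ((fun u => t * u) '' (Submonoid.closure T : Set (V →L[ℝ] V)ˣ)) := by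
  set A := Algebra.adjoin ℝ (Units.val '' T)
  have hcomm : ∀ x y : A, x * y = y * x := by
    have : IsMulCommutative A := Algebra.isMulCommutative_adjoin ℝ (by
      rintro _ ⟨s, hs, rfl⟩ _ ⟨t, ht, rfl⟩
      exact congrArg Units.val (hTcomm s hs t ht))
    exact fun x y => mul_comm' x y
  let _ : NormedCommRing A := { A.normedRing with mul_comm := hcomm }
  let _ : NormedAlgebra ℝ A := A.toNormedAlgebra
  exact one_mem_closure_mul_left_submonoid_of_commAlgebra (A := A) (φ := A.val)
    isometry_subtype_coe hTfin
    (g := fun s => ⟨(s : (V →L[ℝ] V)ˣ), Algebra.subset_adjoin ⟨s, s.2, rfl⟩⟩) (fun _ => rfl)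
    v₀ hCne hCopen hCcone hD hcd ht

/-- Let `V` be a finite dimensional real normed space and `S` a
subsemigroup of `GL(V)` generated by a finite set of pairwise commuting elements.
If for some `v₀ ∈ V` and some nonempty open cone `C` the set `S ⬝ v₀ ∩ C` is coarsely
dense in `C`, then the topological closure of `S` in `GL(V)` is a subgroup. -/
theorem closure_semigroup_is_group_GL
    {V : Type*} [NormedAddCommGroup V] [NormedSpace ℝ V] [FiniteDimensional ℝ V]
    (T : Set (V →L[ℝ] V)ˣ) (hTfin : T.Finite)
    (hTcomm : ∀ s ∈ T, ∀ t ∈ T, s * t = t * s)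
    (S : Subsemigroup (V →L[ℝ] V)ˣ) (hS : S = Subsemigroup.closure T)
    (v₀ : V)
    (C : Set V) (hCne : C.Nonempty) (hCopen : IsOpen C)
    (hCcone : ∀ x ∈ C, ∀ r : ℝ, 0 < r → r • x ∈ C)
    (hcd : ∃ D : ℝ, 0 < D ∧ ∀ x ∈ C, ∃ s ∈ S,
      (s : V →L[ℝ] V) v₀ ∈ C ∧ dist x ((s : V →L[ℝ] V) v₀) < D) :
    ∃ H : Subgroup (V →L[ℝ] V)ˣ,
      (H : Set (V →L[ℝ] V)ˣ) = closure (S : Set (V →L[ℝ] V)ˣ) := by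
  subst hS
  obtain ⟨D, hD, hcd⟩ := hcd
  have hle : ∀ s ∈ Subsemigroup.closure T, s ∈ Submonoid.closure T := fun s hs =>
    (Subsemigroup.closure_le (S := (Submonoid.closure T).toSubsemigroup)).2
      Submonoid.subset_closure hs
  have hone : ∀ t ∈ T, (1 : (V →L[ℝ] V)ˣ) ∈
      closure ((fun u => t * u) '' (Submonoid.closure T : Set (V →L[ℝ] V)ˣ)) := fun t ht =>
    one_mem_closure_mul_left_submonoid_of_coarselyDense hTfin hTcomm v₀ hCne hCopen hCcone hD
      (fun x hx => (hcd x hx).imp fun s hs => ⟨hle s hs.1, hs.2⟩) ht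
  set G := (Subsemigroup.closure T).topologicalClosure with hG
  have hGS : (G : Set (V →L[ℝ] V)ˣ) = closure (Subsemigroup.closure T : Set (V →L[ℝ] V)ˣ) := rfl
  have hGcl : IsClosed (G : Set (V →L[ℝ] V)ˣ) := isClosed_closure
  have hTG : ∀ t ∈ T, t ∈ G := fun t ht => subset_closure (Subsemigroup.subset_closure ht)
  obtain ⟨x, hx⟩ := hCne
  obtain ⟨s, hs, -⟩ := hcd x hx
  have hTne : T.Nonempty := by
    rw [Set.nonempty_iff_ne_empty]
    rintro rfl
    rw [Subsemigroup.closure_empty] at hs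
    exact Subsemigroup.notMem_bot hs
  obtain ⟨t₀, ht₀⟩ := hTne
  have hone_mem : (1 : (V →L[ℝ] V)ˣ) ∈ G := by
    refine closure_mono ?_ (hone t₀ ht₀)
    rintro _ ⟨u, hu, rfl⟩
    rcases Submonoid.eq_one_or_mem_subsemigroup_closure hu with rfl | hu
    · simpa using Subsemigroup.subset_closure ht₀
    · exact mul_mem (Subsemigroup.subset_closure ht₀) hu
  have hinvT : ∀ t ∈ T, t⁻¹ ∈ G := by
    intro t ht
    have h := map_mem_closure (continuous_const_mul t⁻¹) (hone t ht) (t := (G : Set _)) (by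
      rintro _ ⟨u, hu, rfl⟩
      simp only [inv_mul_cancel_left]
      rcases Submonoid.eq_one_or_mem_subsemigroup_closure hu with rfl | hu
      · exact hone_mem
      · exact subset_closure hu)
    rwa [mul_one, hGcl.closure_eq] at h
  have hinvS : ∀ s ∈ Subsemigroup.closure T, s⁻¹ ∈ G := by
    intro s hs
    induction hs using Subsemigroup.closure_induction with
    | mem t ht => exact hinvT t ht
    | mul a b _ _ ha hb => rw [mul_inv_rev]; exact mul_mem hb ha
  refine ⟨{ carrier := G, mul_mem' := G.mul_mem, one_mem' := hone_mem, inv_mem' := ?_ }, rfl⟩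
  intro a ha
  have h := map_mem_closure continuous_inv ha hinvS
  exact hGcl.closure_eq ▸ h
end

section
/- Let $V$ be a finite dimensional real normed vector space and let $S$ be a subsemigroup of $GL(V)$ generated by a finite set of pairwise commuting elements. Suppose there exist $v_0 \in V$ and a nonempty open cone $C$ in $V$ such that the orbit $S \cdot v_0$ intersected with $C$ is coarsely dense in $C$. Let $\overline{S}$ denote the topological closure of $S$ in $GL(V)$. Then the map $\overline{S} \to V$, $g \mapsto g(v_0)$, is injective, its image $\overline{S} \cdot v_0$ is an open cone in $V$, and the map is a homeomorphism of $\overline{S}$ onto this open cone. -/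
open Filter Topology Set

section ExpUnits
variable {A : Type*} [NormedCommRing A] [NormedAlgebra ℝ A] [CompleteSpace A]

/-- The exponential as a map into the group of units. -/
noncomputable def expUnit (X : A) : Aˣ where
  val := NormedSpace.exp X
  inv := NormedSpace.exp (-X)
  val_inv := by
    let := NormedAlgebra.restrictScalars ℚ ℝ A
    rw [← NormedSpace.exp_add, add_neg_cancel, NormedSpace.exp_zero]
  inv_val := by
    let := NormedAlgebra.restrictScalars ℚ ℝ A
    rw [← NormedSpace.exp_add, neg_add_cancel, NormedSpace.exp_zero]

theorem val_expUnit (X : A) : (expUnit X : A) = NormedSpace.exp X := rfl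

theorem expUnit_add (X Y : A) : expUnit (X + Y) = expUnit X * expUnit Y := by
  let := NormedAlgebra.restrictScalars ℚ ℝ A
  ext
  exact NormedSpace.exp_add

theorem expUnit_zero : expUnit (0 : A) = 1 := by
  ext
  exact NormedSpace.exp_zero

theorem expUnit_neg (X : A) : expUnit (-X) = (expUnit X)⁻¹ := by
  rw [eq_inv_iff_mul_eq_one, ← expUnit_add, neg_add_cancel, expUnit_zero]

theorem expUnit_nsmul (n : ℕ) (X : A) : expUnit (n • X) = expUnit X ^ n := by
  induction n with
  | zero => simp [expUnit_zero]
  | succ n ih => rw [succ_nsmul, expUnit_add, ih, pow_succ]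

theorem continuous_expUnit : Continuous (expUnit : A → Aˣ) := by
  let := NormedAlgebra.restrictScalars ℚ ℝ A
  exact Units.isOpenEmbedding_val.isInducing.continuous_iff.2 NormedSpace.exp_continuous

theorem val_expUnit_log_smul_one {r : ℝ} (hr : 0 < r) :
    (expUnit (Real.log r • (1 : A)) : A) = r • 1 := by
  rw [val_expUnit, ← Algebra.algebraMap_eq_smul_one, ← Algebra.algebraMap_eq_smul_one,
    ← NormedSpace.algebraMap_exp_comm, ← Real.exp_eq_exp_ℝ, Real.exp_log hr]

/-- Near `1`, every element is an exponential, and `log (1 + h) = h + o(h)`. -/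
theorem exists_expUnit_eq_one_add {η : ℝ} (hη : 0 < η) :
    ∃ ρ > 0, ∀ h : A, ‖h‖ < ρ → ∃ Y : A, (expUnit Y : A) = 1 + h ∧ ‖Y - h‖ ≤ η * ‖h‖ := by
  have hf : HasStrictFDerivAt (NormedSpace.exp : A → A)
      ((ContinuousLinearEquiv.refl ℝ A : A ≃L[ℝ] A) : A →L[ℝ] A) 0 :=
    hasStrictFDerivAt_exp_zero
  have h1 := hf.eventually_right_inverse
  have h2 := hf.to_localInverse.hasFDerivAt.isLittleO.def hη
  have h0 : hf.localInverse _ _ _ (NormedSpace.exp 0) = 0 := hf.localInverse_apply_image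
  rw [h0] at h2
  rw [NormedSpace.exp_zero] at h1 h2
  obtain ⟨ρ, hρ, H⟩ := Metric.eventually_nhds_iff.1 (h1.and h2)
  refine ⟨ρ, hρ, fun h hh => ?_⟩
  have := @H (1 + h) (by simpa using hh)
  exact ⟨_, this.1, by simpa using this.2⟩

variable (A) in
/-- The subgroup of units that are exponentials. -/
noncomputable def expSubgroup : Subgroup Aˣ where
  carrier := range expUnit
  mul_mem' := by
    rintro _ _ ⟨X, rfl⟩ ⟨Y, rfl⟩
    exact ⟨X + Y, expUnit_add X Y⟩
  one_mem' := ⟨0, expUnit_zero⟩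
  inv_mem' := by
    rintro _ ⟨X, rfl⟩
    exact ⟨-X, expUnit_neg X⟩

theorem isOpen_expSubgroup : IsOpen (expSubgroup A : Set Aˣ) := by
  refine Subgroup.isOpen_of_mem_nhds _ (g := 1) ?_
  obtain ⟨ρ, hρ, H⟩ := exists_expUnit_eq_one_add (A := A) one_pos
  have : ∀ᶠ u : Aˣ in 𝓝 1, ‖(u : A) - 1‖ < ρ := by
    have : ContinuousAt (fun u : Aˣ => ‖(u : A) - 1‖) 1 := by fun_prop
    exact this.eventually (gt_mem_nhds (by simpa using hρ))
  filter_upwards [this] with u hu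
  obtain ⟨Y, hY, -⟩ := H _ hu
  exact ⟨Y, by ext; simpa using hY⟩

theorem mem_expSubgroup_of_segment {b : Aˣ}
    (hb : ∀ t : ℝ, 0 ≤ t → t ≤ 1 → IsUnit ((1 - t) • (1 : A) + t • (b : A))) :
    b ∈ expSubgroup A := by
  let γ : unitInterval → Aˣ := fun t => (hb t t.2.1 t.2.2).unit
  have hγ : Continuous γ := by
    refine Units.isOpenEmbedding_val.isInducing.continuous_iff.2 ?_
    change Continuous fun t : unitInterval => (1 - (t : ℝ)) • (1 : A) + (t : ℝ) • (b : A)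
    fun_prop
  have hcl : IsClopen (γ ⁻¹' (expSubgroup A : Set Aˣ)) :=
    ⟨((expSubgroup A).isClosed_of_isOpen isOpen_expSubgroup).preimage hγ,
      isOpen_expSubgroup.preimage hγ⟩
  have h0 : γ 0 = 1 := by ext; simp [γ]
  have h1 : γ 1 = b := by ext; simp [γ]
  have := hcl.eq_univ ⟨0, by simp [h0, (expSubgroup A).one_mem]⟩
  have h : (1 : unitInterval) ∈ γ ⁻¹' (expSubgroup A : Set Aˣ) := this ▸ mem_univ _
  simpa [h1] using h

end ExpUnits

open Polynomial in
theorem exists_finite_forall_isUnit_sq_add {A : Type*} [CommRing A] [Algebra ℝ A]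
    [FiniteDimensional ℝ A] (a : A) :
    ∃ B : Set ℝ, B.Finite ∧ ∀ e ∉ B, ∀ s : ℝ, 0 ≤ s →
      IsUnit ((a + e • (1 : A)) ^ 2 + s • (1 : A)) := by
  have hintegral : IsIntegral ℝ a := Algebra.IsIntegral.isIntegral a
  have hp : minpoly ℝ a ≠ 0 := minpoly.ne_zero hintegral
  refine ⟨(fun z : ℂ => -z.re) '' ((minpoly ℝ a).rootSet ℂ),
    ((minpoly ℝ a).rootSet_finite ℂ).image _, fun e he s hs => ?_⟩
  have hcop : IsCoprime (minpoly ℝ a) ((X + C e) ^ 2 + C s) := by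
    refine (Polynomial.isCoprime_iff_aeval_ne_zero_of_isAlgClosed ℝ ℂ _ _).2 ?_
    intro z
    by_contra! h
    apply he
    refine ⟨z, (Polynomial.mem_rootSet).2 ⟨hp, h.1⟩, ?_⟩
    have h2 := h.2
    simp only [map_add, map_pow, aeval_X, aeval_C, Complex.coe_algebraMap] at h2
    have hre := congrArg Complex.re h2
    have him := congrArg Complex.im h2
    simp [pow_two] at hre him
    have : (z.re + e) * z.im = 0 := by linarith
    rcases mul_eq_zero.1 this with h | h
    · simp only; linarith
    · rw [h] at hre
      have : (z.re + e) = 0 := by nlinarith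
      simp only; linarith
  obtain ⟨u, v, huv⟩ := hcop
  have := congrArg (aeval a) huv
  simp only [map_add, map_mul, minpoly.aeval, mul_zero, zero_add, map_pow, aeval_X, aeval_C,
    map_one, Algebra.algebraMap_eq_smul_one] at this
  exact IsUnit.of_mul_eq_one_right _ this

theorem exists_expUnit_eq_sq {A : Type*} [NormedCommRing A] [NormedAlgebra ℝ A] [CompleteSpace A]
    [FiniteDimensional ℝ A] (a : Aˣ) : ∃ X : A, expUnit X = a ^ 2 := by
  obtain ⟨B, hB, H⟩ := exists_finite_forall_isUnit_sq_add (a : A)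
  obtain ⟨ρ, hρ, hlog⟩ := exists_expUnit_eq_one_add (A := A) one_pos
  have hev : ∀ᶠ e : ℝ in 𝓝 0, ‖e • ((a⁻¹ : Aˣ) : A)‖ < ρ := by
    have : ContinuousAt (fun e : ℝ => ‖e • ((a⁻¹ : Aˣ) : A)‖) 0 := by fun_prop
    exact this.eventually (gt_mem_nhds (by simpa using hρ))
  have hev2 : ∀ᶠ e : ℝ in 𝓝[≠] 0, e ∉ B := by
    have h := (hB.subset (sdiff_subset (t := {0}))).isClosed.isOpen_compl.mem_nhds
      (show (0 : ℝ) ∈ (B \ {0})ᶜ by simp)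
    filter_upwards [nhdsWithin_le_nhds h, self_mem_nhdsWithin] with e h1 h2 h3
    exact h1 ⟨h3, h2⟩
  obtain ⟨e, he1, he2⟩ := ((hev.filter_mono nhdsWithin_le_nhds).and hev2).exists
  obtain ⟨Y, hY, -⟩ := hlog _ he1
  have hval : ((a * expUnit Y : Aˣ) : A) = a + e • (1 : A) := by
    rw [Units.val_mul, hY, mul_add, mul_one, mul_smul_comm, Units.mul_inv]
  have hmem : (a * expUnit Y) ^ 2 ∈ expSubgroup A := by
    apply mem_expSubgroup_of_segment
    intro t ht0 ht1
    rcases ht0.eq_or_lt with rfl | ht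
    · simp
    · have := H e he2 ((1 - t) / t) (div_nonneg (by linarith) ht.le)
      rw [Units.val_pow_eq_pow_val, hval]
      have h2 := (this.smul (Units.mk0 t ht.ne'))
      convert h2 using 1
      rw [Units.smul_def, Units.val_mk0, smul_add, smul_smul, mul_div_cancel₀ _ ht.ne', add_comm]
  have : a ^ 2 = (a * expUnit Y) ^ 2 * ((expUnit Y) ^ 2)⁻¹ := by
    rw [mul_pow, mul_inv_cancel_right]
  have h2 : a ^ 2 ∈ expSubgroup A := by
    rw [this]
    exact mul_mem hmem (inv_mem (pow_mem (show expUnit Y ∈ expSubgroup A from ⟨Y, rfl⟩) 2))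
  exact h2

theorem AddSubmonoid.card_le_of_mem_closure_of_le (F : Finset ℝ) (hF : ∀ x ∈ F, 0 ≤ x) :
    ∃ δ > 0, ∀ (M : ℝ) (P : Finset ℝ),
      (∀ p ∈ P, p ∈ AddSubmonoid.closure (F : Set ℝ) ∧ p ≤ M) →
        P.card ≤ (⌊M / δ⌋₊ + 1) ^ F.card := by
  classical
  obtain ⟨δ, hδ, hmin⟩ : ∃ δ > 0, ∀ x ∈ F, x ≠ 0 → δ ≤ x := by
    have : ∀ᶠ δ : ℝ in 𝓝[>] 0, ∀ x ∈ F, x ≠ 0 → δ ≤ x := by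
      refine (Filter.eventually_all_finset F).2 fun x hx => ?_
      by_cases h : x = 0
      · simp [h]
      · have : 0 < x := lt_of_le_of_ne (hF x hx) (Ne.symm h)
        filter_upwards [nhdsWithin_le_nhds (gt_mem_nhds this)] with d hd _ using hd.le
    obtain ⟨δ, h1, h2⟩ := (this.and self_mem_nhdsWithin).exists
    exact ⟨δ, h2, h1⟩
  refine ⟨δ, hδ, fun M P hP => ?_⟩
  have hrep : ∀ p ∈ P, ∃ n : F → ℕ, p = ∑ i, n i • (i : ℝ) ∧ ∀ i, n i ≤ ⌊M / δ⌋₊ := by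
    intro p hp
    obtain ⟨n, hn⟩ := AddSubmonoid.mem_closure_finset'.1 (hP p hp).1
    refine ⟨fun i => if (i : ℝ) = 0 then 0 else n i, ?_, fun i => ?_⟩
    · rw [hn]
      refine Finset.sum_congr rfl fun i _ => ?_
      dsimp only
      split_ifs with h <;> simp [h]
    · dsimp only
      split_ifs with h
      · exact Nat.zero_le _
      · apply Nat.le_floor
        rw [le_div_iff₀ hδ]
        have h1 : n i • (i : ℝ) ≤ ∑ j, n j • (j : ℝ) :=
          Finset.single_le_sum (f := fun j : F => n j • (j : ℝ))
            (fun j _ => nsmul_nonneg (hF j j.2) _) (Finset.mem_univ i)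
        rw [← hn, nsmul_eq_mul] at h1
        have h2 := hmin i i.2 h
        have h3 : (n i : ℝ) * δ ≤ n i * i := by gcongr
        linarith [(hP p hp).2]
  choose! n hn hn' using hrep
  have hcard : (Fintype.piFinset fun _ : F => Finset.range (⌊M / δ⌋₊ + 1)).card
      = (⌊M / δ⌋₊ + 1) ^ F.card := by simp
  rw [← hcard]
  refine Finset.card_le_card_of_injOn n (fun p hp => ?_) (fun p hp q hq hpq => ?_)
  · simpa [Nat.lt_succ_iff] using hn' p hp
  · rw [hn p hp, hn q hq, hpq]


theorem PointedCone.exists_nonneg_of_ne_top {E : Type*} [NormedAddCommGroup E] [NormedSpace ℝ E]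
    [FiniteDimensional ℝ E] (K : PointedCone ℝ E) (hK : K ≠ ⊤) :
    ∃ f : StrongDual ℝ E, f ≠ 0 ∧ ∀ x ∈ K, 0 ≤ f x := by
  by_cases hcl : closure (K : Set E) = univ
  · exfalso
    apply hK
    have hconv : Convex ℝ (K : Set E) := K.toConvexCone.convex
    have hspan : Submodule.span ℝ (K : Set E) = ⊤ := by
      rw [← SetLike.coe_set_eq, Submodule.top_coe, ← univ_subset_iff, ← hcl]
      exact closure_minimal Submodule.subset_span (Submodule.closed_of_finiteDimensional _)
    have haff : affineSpan ℝ (K : Set E) = ⊤ := by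
      rw [AffineSubspace.affineSpan_eq_top_iff_vectorSpan_eq_top_of_nonempty ℝ E E ⟨0, K.zero_mem⟩,
        vectorSpan_eq_span_vsub_set_right ℝ K.zero_mem]
      simpa using hspan
    have hintr := hconv.interior_nonempty_iff_affineSpan_eq_top.2 haff
    have h := hconv.interior_closure_eq_interior_of_nonempty_interior hintr
    rw [hcl, interior_univ] at h
    rw [← SetLike.coe_set_eq, Submodule.top_coe, ← univ_subset_iff, h]
    exact interior_subset
  · obtain ⟨x, hx⟩ := (ne_univ_iff_exists_notMem _).1 hcl
    obtain ⟨f, hf, hfx⟩ := ProperCone.hyperplane_separation_point (Submodule.closure K) hx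
    refine ⟨f, ?_, fun y hy => hf y (subset_closure hy)⟩
    rintro rfl
    simp at hfx

/-- Either a set is contained in a closed half-space, or the additive monoid it generates is
dense in a group. -/
theorem exists_nonneg_or_neg_mem_closure {E : Type*} [NormedAddCommGroup E]
    [NormedSpace ℝ E] [FiniteDimensional ℝ E] (X : Set E) :
    (∃ f : StrongDual ℝ E, f ≠ 0 ∧ ∀ x ∈ X, 0 ≤ f x) ∨
      ∀ x ∈ X, -x ∈ closure (AddSubmonoid.closure X : Set E) := by
  rw [or_iff_not_imp_left]
  intro hno x hx
  have hspan : PointedCone.hull ℝ X = ⊤ := by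
    by_contra h
    obtain ⟨f, hf, hfK⟩ := PointedCone.exists_nonneg_of_ne_top _ h
    exact hno ⟨f, hf, fun y hy => hfK y (Submodule.subset_span hy)⟩
  have hmem : -x ∈ PointedCone.hull ℝ X := hspan ▸ Submodule.mem_top
  obtain ⟨n, c, g, hg⟩ := Submodule.mem_span_set'.1 hmem
  let r : ℕ → E := fun N => N • x + ∑ i, ⌊(N : ℝ) * (c i : ℝ)⌋₊ • (g i : E)
  have hr : ∀ N, r N = -∑ i, ((N : ℝ) * c i - ⌊(N : ℝ) * (c i : ℝ)⌋₊) • (g i : E) := by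
    intro N
    have h2 : ∑ i, ((N : ℝ) * c i) • (g i : E) = -((N : ℝ) • x) := by
      rw [← smul_neg, ← hg, Finset.smul_sum]
      exact Finset.sum_congr rfl fun i _ => by rw [mul_smul]; rfl
    simp only [r, sub_smul, Finset.sum_sub_distrib, h2, Nat.cast_smul_eq_nsmul]
    abel
  have hbdd : ∀ N, r N ∈ Metric.closedBall (0 : E) (∑ i, ‖(g i : E)‖) := by
    intro N
    rw [mem_closedBall_zero_iff, hr, norm_neg]
    refine norm_sum_le_of_le _ fun i _ => ?_
    rw [norm_smul]
    refine mul_le_of_le_one_left (norm_nonneg _) ?_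
    have h0 : 0 ≤ (N : ℝ) * c i := mul_nonneg N.cast_nonneg (c i).2
    rw [Real.norm_eq_abs, abs_le]
    constructor <;> linarith [Nat.floor_le h0, Nat.lt_floor_add_one ((N : ℝ) * c i)]
  obtain ⟨a, -, φ, hφ, hlim⟩ := (isCompact_closedBall (0 : E) _).tendsto_subseq hbdd
  have hdiff : Tendsto (fun k => r (φ (k + 1)) - r (φ k) - x) atTop (𝓝 (-x)) := by
    have := ((hlim.comp (tendsto_add_atTop_nat 1)).sub hlim).sub_const x
    simpa using this
  refine mem_closure_of_tendsto hdiff (Eventually.of_forall fun k => ?_)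
  have hlt : φ k + 1 ≤ φ (k + 1) := hφ (Nat.lt_succ_self k)
  have hfl : ∀ i, ⌊(φ k : ℝ) * (c i : ℝ)⌋₊ ≤ ⌊(φ (k + 1) : ℝ) * (c i : ℝ)⌋₊ := fun i =>
    Nat.floor_le_floor (mul_le_mul_of_nonneg_right
      (by exact_mod_cast (Nat.le_of_succ_le hlt)) (c i).2)
  have heq : r (φ (k + 1)) - r (φ k) - x = (φ (k + 1) - φ k - 1) • x +
      ∑ i, (⌊(φ (k + 1) : ℝ) * (c i : ℝ)⌋₊ - ⌊(φ k : ℝ) * (c i : ℝ)⌋₊) • (g i : E) := by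
    have h1 : φ (k + 1) • x = (φ (k + 1) - φ k - 1) • x + φ k • x + x := by
      rw [← add_nsmul, ← succ_nsmul]
      congr 1
      omega
    have h2 : ∑ i, ⌊(φ (k + 1) : ℝ) * (c i : ℝ)⌋₊ • (g i : E) =
        ∑ i, (⌊(φ (k + 1) : ℝ) * (c i : ℝ)⌋₊ - ⌊(φ k : ℝ) * (c i : ℝ)⌋₊) • (g i : E) +
        ∑ i, ⌊(φ k : ℝ) * (c i : ℝ)⌋₊ • (g i : E) := by
      rw [← Finset.sum_add_distrib]
      exact Finset.sum_congr rfl fun i _ => by rw [← add_nsmul, Nat.sub_add_cancel (hfl i)]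
    simp only [r, h1, h2]
    abel
  rw [heq]
  exact add_mem (nsmul_mem (AddSubmonoid.subset_closure hx) _)
    (sum_mem fun i _ => nsmul_mem (AddSubmonoid.subset_closure (g i).2) _)

theorem exists_nat_add_mul_log_pow_lt (a b : ℝ) (k : ℕ) (ha : 0 ≤ a) (hb : 0 ≤ b) :
    ∃ m : ℕ, 1 ≤ m ∧ (a + b * Real.log m) ^ k < m + 1 := by
  have hpos : 0 < ((a + b) ^ k + 1)⁻¹ := by positivity
  have h1 := (Real.isLittleO_pow_log_id_atTop (n := k)).def hpos
  have h2 : ∀ᶠ m : ℕ in atTop, ‖Real.log m ^ k‖ ≤ ((a + b) ^ k + 1)⁻¹ * ‖(m : ℝ)‖ :=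
    tendsto_natCast_atTop_atTop.eventually h1
  obtain ⟨m, hm, hm3⟩ := (h2.and (eventually_ge_atTop 3)).exists
  refine ⟨m, by omega, ?_⟩
  have hm3' : (3 : ℝ) ≤ m := by exact_mod_cast hm3
  have hlog : 1 ≤ Real.log m := by
    rw [Real.le_log_iff_exp_le (by linarith)]
    linarith [Real.exp_one_lt_three]
  rw [Real.norm_of_nonneg (by positivity), Real.norm_of_nonneg (by positivity),
    inv_mul_eq_div, le_div_iff₀ (by positivity)] at hm
  have h3 : (a + b * Real.log m) ^ k ≤ ((a + b) * Real.log m) ^ k := by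
    gcongr
    nlinarith
  rw [mul_pow] at h3
  have : 0 ≤ Real.log m ^ k := by positivity
  nlinarith

section Algebra
variable {A : Type*} [NormedCommRing A] [NormedAlgebra ℝ A]

/-- A linear functional on the Lie algebra of `Aˣ` that vanishes on the kernel of the exponential
cannot be nonnegative on a finitely generated semigroup that is coarsely dense in an open cone:
it would take too few values on the semigroup. -/
theorem not_nonneg_of_coarselyDense [FiniteDimensional ℝ A] [CompleteSpace A]
    (T : Set Aˣ) (hT : T.Finite) (C : Set A)
    (hCne : C.Nonempty) (hCopen : IsOpen C) (hCcone : ∀ x ∈ C, ∀ r : ℝ, 0 < r → r • x ∈ C)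
    (D : ℝ) (hcd : ∀ x ∈ C, ∃ s ∈ Subsemigroup.closure T, (s : A) ∈ C ∧ ‖(s : A) - x‖ ≤ D)
    (f : StrongDual ℝ A) (hf : f ≠ 0) (hker : ∀ Y : A, expUnit Y = 1 → f Y = 0)
    (hnonneg : ∀ t ∈ T, ∀ X : A, expUnit X = t ^ 2 → 0 ≤ f X) : False := by
  classical
  choose L hL using exists_expUnit_eq_sq (A := A)
  obtain ⟨χ, hχdef⟩ : ∃ χ : Aˣ → ℝ, ∀ g, χ g = f (L g) := ⟨_, fun _ => rfl⟩
  have hχ : ∀ (g : Aˣ) (X : A), expUnit X = g ^ 2 → χ g = f X := by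
    intro g X hX
    have := hker (L g - X) (by
      rw [sub_eq_add_neg, expUnit_add, expUnit_neg, hL, hX, mul_inv_cancel])
    rw [map_sub] at this
    rw [hχdef]
    linarith
  have hmul : ∀ g h : Aˣ, χ (g * h) = χ g + χ h := by
    intro g h
    rw [hχ (g * h) (L g + L h) (by rw [expUnit_add, hL, hL, mul_pow]), map_add, hχdef, hχdef]
  have hexp : ∀ Y : A, χ (expUnit Y) = 2 * f Y := by
    intro Y
    rw [hχ _ (2 • Y) (expUnit_nsmul 2 Y), map_nsmul, two_nsmul, two_mul]
  obtain ⟨x₀, hx₀⟩ := hCne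
  obtain ⟨x, -, hxC, hx⟩ := hcd x₀ hx₀
  have hD : 0 ≤ D := (norm_nonneg _).trans hx
  obtain ⟨w, hw⟩ : ∃ w, f w = 1 := by
    obtain ⟨v, hv⟩ := DFunLike.ne_iff.1 hf
    refine ⟨(f v)⁻¹ • v, ?_⟩
    rw [map_smul, smul_eq_mul, inv_mul_cancel₀ hv]
  obtain ⟨ε, hε, hεC⟩ : ∃ ε : ℝ, 0 < ε ∧ ∀ τ ∈ Icc 0 ε, ((x * expUnit (τ • w) : Aˣ) : A) ∈ C := by
    have hcont : Continuous fun τ : ℝ => ((x * expUnit (τ • w) : Aˣ) : A) :=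
      Units.continuous_val.comp (continuous_const.mul
        (continuous_expUnit.comp (continuous_id.smul continuous_const)))
    have hmem := (hCopen.preimage hcont).mem_nhds (x := 0) (by simpa [expUnit_zero] using hxC)
    obtain ⟨ε, hε, H⟩ := Metric.mem_nhds_iff.1 hmem
    refine ⟨ε / 2, half_pos hε, fun τ hτ => H ?_⟩
    rw [Metric.mem_ball, Real.dist_eq, sub_zero, abs_of_nonneg hτ.1]
    linarith [hτ.2]
  obtain ⟨K, hK⟩ : ∃ K, ∀ τ ∈ Icc 0 ε, ‖(((x * expUnit (τ • w))⁻¹ : Aˣ) : A)‖ ≤ K := by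
    refine isCompact_Icc.exists_bound_of_continuousOn (Continuous.continuousOn ?_)
    exact Units.continuous_val.comp (continuous_const.mul
        (continuous_expUnit.comp (continuous_id.smul continuous_const))).inv
  have hK0 : 0 ≤ K := (norm_nonneg _).trans (hK 0 ⟨le_rfl, hε.le⟩)
  obtain ⟨ρ, hρ, hlog⟩ := exists_expUnit_eq_one_add (A := A) one_pos
  have happrox : ∃ B > 0, ∃ t₀ > 0, ∀ t ≥ t₀, ∀ τ ∈ Icc 0 ε, ∃ s ∈ Subsemigroup.closure T,
      |χ s - (χ x + 2 * (Real.log t * f 1 + τ))| ≤ B / t := by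
    refine ⟨4 * ‖f‖ * (K * D) + 1, by positivity, K * D / ρ + 1, by positivity,
      fun t ht τ hτ => ?_⟩
    have ht0 : 0 < t := lt_of_lt_of_le (by positivity) ht
    obtain ⟨z, hz⟩ : ∃ z : Aˣ, z = x * expUnit (τ • w) := ⟨_, rfl⟩
    obtain ⟨s, hs, -, hsD⟩ := hcd (t • (z : A)) (hCcone _ (hz ▸ hεC τ hτ) t ht0)
    have hzK : ‖((z⁻¹ : Aˣ) : A)‖ ≤ K := hz ▸ hK τ hτ
    obtain ⟨h, hh⟩ : ∃ h : A, h = t⁻¹ • (((z⁻¹ : Aˣ) : A) * (s - t • (z : A))) := ⟨_, rfl⟩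
    have hhn : ‖h‖ ≤ K * D / t := by
      rw [hh, norm_smul, Real.norm_of_nonneg (by positivity), inv_mul_eq_div]
      gcongr
      exact (norm_mul_le _ _).trans (by gcongr)
    obtain ⟨Y, hY, hYh⟩ := hlog h (hhn.trans_lt (by
      rw [div_lt_iff₀ ht0]
      have : K * D / ρ * ρ = K * D := div_mul_cancel₀ _ hρ.ne'
      nlinarith))
    have hYn : ‖Y‖ ≤ 2 * (K * D / t) := by
      have := norm_add_le (Y - h) h
      rw [sub_add_cancel] at this
      linarith
    have hseq : s = expUnit (Real.log t • (1 : A)) * z * expUnit Y := by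
      ext
      rw [Units.val_mul, Units.val_mul, hY, val_expUnit_log_smul_one ht0, hh, smul_mul_assoc,
        one_mul, mul_add, mul_one, smul_mul_smul_comm, mul_inv_cancel₀ ht0.ne', one_smul,
        Units.mul_inv_cancel_left, add_sub_cancel]
    refine ⟨s, hs, ?_⟩
    have hval : χ s - (χ x + 2 * (Real.log t * f 1 + τ)) = 2 * f Y := by
      rw [hseq, hz, hmul, hmul, hmul, hexp, hexp, hexp, map_smul, map_smul, hw]
      simp only [smul_eq_mul]
      ring
    rw [hval, abs_mul, abs_two]
    have h1 : |f Y| ≤ ‖f‖ * ‖Y‖ := f.le_opNorm Y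
    calc 2 * |f Y| ≤ 2 * (‖f‖ * (2 * (K * D / t))) := by
          refine mul_le_mul_of_nonneg_left (h1.trans ?_) zero_le_two
          gcongr
      _ = 4 * ‖f‖ * (K * D) / t := by ring
      _ ≤ _ := by gcongr; linarith
  obtain ⟨B, hB, t₀, ht₀, happ⟩ := happrox
  obtain ⟨F, hF⟩ : ∃ F : Finset ℝ, F = hT.toFinset.image χ := ⟨_, rfl⟩
  have hFmem : ∀ s ∈ Subsemigroup.closure T, χ s ∈ AddSubmonoid.closure (F : Set ℝ) := by
    intro s hs
    induction hs using Subsemigroup.closure_induction with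
    | mem t ht =>
      refine AddSubmonoid.subset_closure ?_
      rw [hF, Finset.mem_coe, Finset.mem_image]
      exact ⟨t, hT.mem_toFinset.2 ht, rfl⟩
    | mul g h _ _ ihg ihh => rw [hmul]; exact add_mem ihg ihh
  obtain ⟨δ, hδ, hcount⟩ := AddSubmonoid.card_le_of_mem_closure_of_le F (by
    intro p hp
    rw [hF, Finset.mem_image] at hp
    obtain ⟨t, ht, rfl⟩ := hp
    rw [hχdef]
    exact hnonneg t (hT.mem_toFinset.1 ht) _ (hL t))
  obtain ⟨κ, hκ⟩ : ∃ κ : ℝ, κ = t₀ + B / ε := ⟨_, rfl⟩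
  have hκ0 : 0 < κ := by rw [hκ]; positivity
  have hκB : B < κ * ε := by
    rw [hκ, add_mul, div_mul_cancel₀ _ hε.ne']
    linarith [mul_pos ht₀ hε]
  obtain ⟨m, hm1, hm⟩ := exists_nat_add_mul_log_pow_lt
    ((|χ x| + 2 * (|Real.log κ| * |f 1|) + 3 * ε) / δ + 1) (2 * |f 1| / δ) F.card
    (by positivity) (by positivity)
  have hm0 : (1 : ℝ) ≤ m := by exact_mod_cast hm1
  have hmpos : (0 : ℝ) < m := by linarith
  have herr : B / (κ * m) < ε / m := by
    rw [div_lt_div_iff₀ (by positivity) hmpos]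
    nlinarith
  have hex : ∀ i : ℕ, ∃ s ∈ Subsemigroup.closure T, i ≤ m →
      |χ s - (χ x + 2 * (Real.log (κ * m) * f 1 + i * (ε / m)))| < ε / m := by
    intro i
    by_cases hi : i ≤ m
    · have hi' : (i : ℝ) ≤ m := by exact_mod_cast hi
      obtain ⟨s, hs, h⟩ := happ (κ * m) (by
        have : t₀ ≤ κ := by rw [hκ]; linarith [div_pos hB hε]
        nlinarith) (i * (ε / m)) ⟨by positivity, by
          rw [← mul_div_assoc, div_le_iff₀ hmpos]; nlinarith⟩
      exact ⟨s, hs, fun _ => h.trans_lt herr⟩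
    · obtain ⟨s, hs, -⟩ := hcd _ hx₀
      exact ⟨s, hs, fun h => absurd h hi⟩
  choose s hs hsχ using hex
  have hinj : InjOn (fun i => χ (s i)) (Finset.range (m + 1) : Set ℕ) := by
    intro i hi j hj hij
    have hi1 := abs_lt.1 (hsχ i (by simpa [Nat.lt_succ_iff] using hi))
    have hj1 := abs_lt.1 (hsχ j (by simpa [Nat.lt_succ_iff] using hj))
    simp only at hij
    rw [hij] at hi1
    have hpos : 0 < ε / m := by positivity
    rcases lt_trichotomy i j with h | h | h
    · have : (i : ℝ) + 1 ≤ j := by exact_mod_cast h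
      nlinarith
    · exact h
    · have : (j : ℝ) + 1 ≤ i := by exact_mod_cast h
      nlinarith
  have hlogm : 0 ≤ Real.log m := Real.log_nonneg hm0
  obtain ⟨M, hM⟩ : ∃ M, M = |χ x| + 2 * ((|Real.log κ| + Real.log m) * |f 1|) + 3 * ε := ⟨_, rfl⟩
  have hM0 : 0 ≤ M := by rw [hM]; positivity
  have hle := hcount M ((Finset.range (m + 1)).image fun i => χ (s i)) (by
    intro p hp
    obtain ⟨i, hi, rfl⟩ := Finset.mem_image.1 hp
    refine ⟨hFmem _ (hs i), ?_⟩
    have him : i ≤ m := by simpa [Nat.lt_succ_iff] using hi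
    have hi1 := abs_lt.1 (hsχ i him)
    have him' : (i : ℝ) ≤ m := by exact_mod_cast him
    have h1 : (i : ℝ) * (ε / m) ≤ ε := by
      rw [← mul_div_assoc, div_le_iff₀ hmpos]; nlinarith
    have h2 : ε / m ≤ ε := div_le_self hε.le hm0
    have h3 : Real.log (κ * m) * f 1 ≤ (|Real.log κ| + Real.log m) * |f 1| := by
      refine (le_abs_self _).trans ?_
      rw [abs_mul, Real.log_mul hκ0.ne' hmpos.ne']
      gcongr
      exact (abs_add_le _ _).trans (by rw [abs_of_nonneg hlogm])
    rw [hM]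
    linarith [le_abs_self (χ x)])
  rw [Finset.card_image_of_injOn hinj, Finset.card_range] at hle
  have hle' : (m : ℝ) + 1 ≤ (M / δ + 1) ^ F.card := by
    have h1 : ((m + 1 : ℕ) : ℝ) ≤ (((⌊M / δ⌋₊ + 1) ^ F.card : ℕ) : ℝ) := by exact_mod_cast hle
    push_cast at h1
    refine h1.trans ?_
    gcongr
    exact Nat.floor_le (by positivity)
  have hMeq : M / δ + 1 = (|χ x| + 2 * (|Real.log κ| * |f 1|) + 3 * ε) / δ + 1 +
      2 * |f 1| / δ * Real.log m := by
    rw [hM]; ring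
  rw [hMeq] at hle'
  linarith

/-- If the closure of a coarsely dense semigroup contains the inverses of its elements, then it
contains all exponentials. -/
theorem expUnit_mem_closure_of_inv_mem [CompleteSpace A] (S : Subsemigroup Aˣ) (C : Set A)
    (hCne : C.Nonempty) (hCopen : IsOpen C) (hCcone : ∀ x ∈ C, ∀ r : ℝ, 0 < r → r • x ∈ C)
    (D : ℝ) (hcd : ∀ x ∈ C, ∃ s ∈ S, (s : A) ∈ C ∧ ‖(s : A) - x‖ ≤ D)
    (hinv : ∀ s ∈ S, s⁻¹ ∈ closure (S : Set Aˣ)) (u : A) :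
    expUnit u ∈ closure (S : Set Aˣ) := by
  have hmulmem : ∀ g ∈ closure (S : Set Aˣ), ∀ h ∈ closure (S : Set Aˣ),
      g * h ∈ closure (S : Set Aˣ) := fun g hg h hh =>
    map_mem_closure₂ continuous_mul hg hh fun a ha b hb => mul_mem ha hb
  obtain ⟨x₀, hx₀⟩ := hCne
  obtain ⟨x, hxS, hxC, hx⟩ := hcd x₀ hx₀
  have hD : 0 ≤ D := (norm_nonneg _).trans hx
  have hone : (1 : Aˣ) ∈ closure (S : Set Aˣ) := by
    simpa using hmulmem x (subset_closure hxS) _ (hinv x hxS)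
  have hpow : ∀ g ∈ closure (S : Set Aˣ), ∀ n : ℕ, g ^ n ∈ closure (S : Set Aˣ) := by
    intro g hg n
    induction n with
    | zero => simpa using hone
    | succ n ih => rw [pow_succ]; exact hmulmem _ ih _ hg
  obtain ⟨K, hK⟩ : ∃ K : ℝ, K = ‖((x⁻¹ : Aˣ) : A)‖ := ⟨_, rfl⟩
  have hK0 : 0 ≤ K := hK ▸ norm_nonneg _
  have hsmall : ∀ η > 0, ∃ R > 0, ∀ᶠ t : ℝ in atTop, ∃ q : A,
      expUnit q ∈ closure (S : Set Aˣ) ∧ ‖q - (R / t) • u‖ ≤ η * (R / t) := by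
    intro η hη
    obtain ⟨θ, hθ⟩ : ∃ θ : ℝ, θ = min 1 (η / (2 * (‖u‖ + 1))) := ⟨_, rfl⟩
    have hθ0 : 0 < θ := hθ ▸ lt_min one_pos (by positivity)
    have hθ1 : θ ≤ 1 := hθ ▸ min_le_left _ _
    have hθu : θ * ‖u‖ ≤ η / 2 := by
      have h1 : θ ≤ η / (2 * (‖u‖ + 1)) := hθ ▸ min_le_right _ _
      rw [le_div_iff₀ (by positivity)] at h1
      nlinarith [norm_nonneg u]
    obtain ⟨ρ, hρ, hlog⟩ := exists_expUnit_eq_one_add (A := A) hθ0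
    obtain ⟨R, hR⟩ : ∃ R : ℝ, R = 8 * (K * D) / η + 1 := ⟨_, rfl⟩
    have hR0 : 0 < R := by rw [hR]; positivity
    have hRη : 8 * (K * D) ≤ η * R := by
      rw [hR, mul_add, mul_div_cancel₀ _ hη.ne']; linarith
    refine ⟨R, hR0, ?_⟩
    have hC' : ∀ᶠ t : ℝ in atTop, (x : A) + (R / t) • (x * u) ∈ C := by
      have h1 : Tendsto (fun t : ℝ => (x : A) + (R / t) • (x * u)) atTop
          (𝓝 ((x : A) + (0 : ℝ) • (x * u))) :=
        ((tendsto_const_nhds.div_atTop tendsto_id).smul_const _).const_add _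
      rw [zero_smul, add_zero] at h1
      exact h1.eventually (hCopen.mem_nhds hxC)
    filter_upwards [hC', eventually_gt_atTop 0, eventually_gt_atTop ((R * ‖u‖ + K * D) / ρ)]
      with t htC ht0 htρ
    rw [div_lt_iff₀ hρ] at htρ
    obtain ⟨s, hs, -, hsD⟩ := hcd _ (hCcone _ hxC t ht0)
    obtain ⟨s', hs', -, hsD'⟩ := hcd _ (hCcone _ htC t ht0)
    have key : ∀ (e : A) (r : Aˣ), ‖e‖ ≤ D → ∀ c : ℝ, 0 ≤ c → c ≤ R →
        (r : A) = t • ((x : A) + (c / t) • (x * u)) + e → ∃ Y : A,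
        r = expUnit (Real.log t • (1 : A)) * x * expUnit Y ∧
        ‖Y - (c / t) • u‖ ≤ (θ * (c * ‖u‖ + K * D) + K * D) / t := by
      intro e r he c hc0 hcR hr
      obtain ⟨h, hh⟩ : ∃ h : A, h = (c / t) • u + t⁻¹ • (((x⁻¹ : Aˣ) : A) * e) := ⟨_, rfl⟩
      have h1 : ‖t⁻¹ • (((x⁻¹ : Aˣ) : A) * e)‖ ≤ K * D / t := by
        rw [norm_smul, Real.norm_of_nonneg (by positivity), inv_mul_eq_div]
        gcongr
        exact (norm_mul_le _ _).trans (by rw [← hK]; gcongr)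
      have h2 : ‖h‖ ≤ (c * ‖u‖ + K * D) / t := by
        rw [hh, add_div]
        refine (norm_add_le _ _).trans (add_le_add ?_ h1)
        rw [norm_smul, Real.norm_of_nonneg (by positivity), div_mul_eq_mul_div]
      obtain ⟨Y, hY, hYh⟩ := hlog h (h2.trans_lt (by
        rw [div_lt_iff₀ ht0]
        nlinarith [norm_nonneg u]))
      refine ⟨Y, ?_, ?_⟩
      · ext
        rw [Units.val_mul, Units.val_mul, hY, val_expUnit_log_smul_one ht0, hr, hh, smul_mul_assoc,
          one_mul, mul_add, mul_one, mul_add, smul_mul_smul_comm, smul_mul_smul_comm,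
          mul_inv_cancel₀ ht0.ne', one_smul, Units.mul_inv_cancel_left, smul_add, smul_smul,
          add_assoc]
      · have h3 : Y - (c / t) • u = (Y - h) + t⁻¹ • (((x⁻¹ : Aˣ) : A) * e) := by
          rw [hh]; abel
        rw [h3, add_div]
        refine (norm_add_le _ _).trans (add_le_add (hYh.trans ?_) h1)
        rw [mul_div_assoc]
        gcongr
    obtain ⟨Y, hY, hYn⟩ := key (s - t • (x : A)) s hsD 0 le_rfl hR0.le (by simp)
    obtain ⟨Y', hY', hYn'⟩ := key _ s' hsD' R hR0.le le_rfl (by simp)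
    refine ⟨Y' - Y, ?_, ?_⟩
    · have : expUnit (Y' - Y) = s' * s⁻¹ := by
        rw [hY, hY', sub_eq_add_neg, expUnit_add, expUnit_neg, mul_inv, mul_mul_mul_comm,
          mul_inv_cancel, one_mul]
      rw [this]
      exact hmulmem _ (subset_closure hs') _ (hinv s hs)
    · rw [zero_div, zero_smul, sub_zero] at hYn
      have h3 : Y' - Y - (R / t) • u = (Y' - (R / t) • u) - Y := by abel
      rw [h3]
      refine (norm_sub_le _ _).trans ((add_le_add hYn' hYn).trans ?_)
      rw [← add_div, ← mul_div_assoc]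
      gcongr
      have hKD : 0 ≤ K * D := by positivity
      nlinarith
  have hclosed : IsClosed {Z : A | expUnit Z ∈ closure (S : Set Aˣ)} :=
    isClosed_closure.preimage continuous_expUnit
  change u ∈ {Z : A | expUnit Z ∈ closure (S : Set Aˣ)}
  rw [← hclosed.closure_eq, Metric.mem_closure_iff]
  intro η hη
  obtain ⟨R, hR, hev⟩ := hsmall (η / 4) (by positivity)
  obtain ⟨t, ⟨q, hq, hqu⟩, ht0, htR, htη⟩ := (hev.and ((eventually_gt_atTop 0).and
    ((eventually_ge_atTop R).and (eventually_gt_atTop (2 * (R * ‖u‖) / η))))).exists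
  obtain ⟨d, hd⟩ : ∃ d : ℝ, d = R / t := ⟨_, rfl⟩
  rw [← hd] at hqu
  have hd0 : 0 < d := hd ▸ div_pos hR ht0
  have hd1 : d ≤ 1 := by rw [hd, div_le_one ht0]; exact htR
  have hdu : d * ‖u‖ < η / 2 := by
    rw [div_lt_iff₀ hη] at htη
    rw [hd, div_mul_eq_mul_div, div_lt_iff₀ ht0]
    linarith
  have hn1 := Nat.floor_le (inv_nonneg.2 hd0.le)
  have hn2 := Nat.lt_floor_add_one d⁻¹
  set n := ⌊d⁻¹⌋₊
  have hdd : d⁻¹ * d = 1 := inv_mul_cancel₀ hd0.ne'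
  refine ⟨n • q, ?_, ?_⟩
  · change expUnit (n • q) ∈ closure (S : Set Aˣ)
    rw [expUnit_nsmul]
    exact hpow _ hq n
  · have h1 : n • q - u = (n : ℝ) • (q - d • u) + ((n : ℝ) * d - 1) • u := by
      rw [← Nat.cast_smul_eq_nsmul ℝ, smul_sub, sub_smul, smul_smul, one_smul]
      abel
    rw [dist_comm, dist_eq_norm, h1]
    refine (norm_add_le _ _).trans_lt ?_
    rw [norm_smul, norm_smul, Real.norm_of_nonneg n.cast_nonneg, Real.norm_eq_abs]
    have h2 : |(n : ℝ) * d - 1| ≤ d := by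
      rw [abs_le]
      constructor <;> nlinarith
    have h3 : (n : ℝ) * ‖q - d • u‖ ≤ η / 4 := by
      calc (n : ℝ) * ‖q - d • u‖ ≤ n * (η / 4 * d) := by gcongr
        _ = η / 4 * (n * d) := by ring
        _ ≤ η / 4 * 1 := by gcongr; nlinarith
        _ = _ := mul_one _
    have h4 : |(n : ℝ) * d - 1| * ‖u‖ ≤ d * ‖u‖ := by gcongr
    linarith

/-- The main theorem for the regular representation of a commutative algebra. -/
theorem isOpen_closure_of_coarselyDense [FiniteDimensional ℝ A]
    (T : Set Aˣ) (hT : T.Finite) (C : Set A)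
    (hCne : C.Nonempty) (hCopen : IsOpen C) (hCcone : ∀ x ∈ C, ∀ r : ℝ, 0 < r → r • x ∈ C)
    (D : ℝ) (hcd : ∀ x ∈ C, ∃ s ∈ Subsemigroup.closure T, (s : A) ∈ C ∧ ‖(s : A) - x‖ ≤ D) :
    IsOpen (closure (Subsemigroup.closure T : Set Aˣ)) ∧
      ∀ g ∈ closure (Subsemigroup.closure T : Set Aˣ), ∀ r : ℝ, 0 < r →
        ∃ g' ∈ closure (Subsemigroup.closure T : Set Aˣ), (g' : A) = r • (g : A) := by
  have : CompleteSpace A := FiniteDimensional.complete ℝ A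
  set S := Subsemigroup.closure T with hS
  have hmulmem : ∀ g ∈ closure (S : Set Aˣ), ∀ h ∈ closure (S : Set Aˣ),
      g * h ∈ closure (S : Set Aˣ) := fun g hg h hh =>
    map_mem_closure₂ continuous_mul hg hh fun a ha b hb => mul_mem ha hb
  have hinvT : ∀ t ∈ T, t⁻¹ ∈ closure (S : Set Aˣ) := by
    obtain ⟨f, hf, hpos⟩ | hneg := exists_nonneg_or_neg_mem_closure
      {X : A | expUnit X = 1 ∨ ∃ t ∈ T, expUnit X = t ^ 2}
    · refine (not_nonneg_of_coarselyDense T hT C hCne hCopen hCcone D hcd f hf ?_ ?_).elim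
      · intro Y hY
        have h1 := hpos Y (Or.inl hY)
        have h2 := hpos (-Y) (Or.inl (by rw [expUnit_neg, hY, inv_one]))
        rw [map_neg] at h2
        linarith
      · exact fun t ht X hX => hpos X (Or.inr ⟨t, ht, hX⟩)
    · intro t ht
      have htS : t ∈ S := Subsemigroup.subset_closure ht
      obtain ⟨X, hX⟩ := exists_expUnit_eq_sq t
      have hmap : ∀ Z ∈ AddSubmonoid.closure {X : A | expUnit X = 1 ∨ ∃ t ∈ T, expUnit X = t ^ 2},
          t * expUnit Z ∈ S := by
        intro Z hZ
        suffices h : ∀ s ∈ S, s * expUnit Z ∈ S from h t htS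
        induction hZ using AddSubmonoid.closure_induction with
        | mem Z hZ =>
          intro s hs
          rcases hZ with hZ | ⟨t', ht', hZ⟩
          · rwa [hZ, mul_one]
          · rw [hZ, pow_two]
            have := Subsemigroup.subset_closure ht'
            exact mul_mem hs (mul_mem this this)
        | zero =>
          intro s hs
          rwa [expUnit_zero, mul_one]
        | add Y Z _ _ ihY ihZ =>
          intro s hs
          rw [expUnit_add, ← mul_assoc]
          exact ihZ _ (ihY _ hs)
      have h1 : t * expUnit (-X) ∈ closure (S : Set Aˣ) :=
        map_mem_closure (f := fun Z => t * expUnit Z)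
          (continuous_const.mul continuous_expUnit) (hneg X (Or.inr ⟨t, ht, hX⟩)) hmap
      rwa [expUnit_neg, hX, pow_two, mul_inv, mul_inv_cancel_left] at h1
  have hinv : ∀ s ∈ S, s⁻¹ ∈ closure (S : Set Aˣ) := by
    intro s hs
    induction hs using Subsemigroup.closure_induction with
    | mem t ht => exact hinvT t ht
    | mul g h _ _ ihg ihh => rw [mul_inv]; exact hmulmem _ ihg _ ihh
  have hexp := expUnit_mem_closure_of_inv_mem S C hCne hCopen hCcone D hcd hinv
  refine ⟨isOpen_iff_mem_nhds.2 fun g hg => ?_, fun g hg r hr =>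
    ⟨expUnit (Real.log r • (1 : A)) * g, hmulmem _ (hexp _) _ hg, ?_⟩⟩
  · have h1 : (fun h => g⁻¹ * h) ⁻¹' (expSubgroup A : Set Aˣ) ∈ 𝓝 g :=
      (isOpen_expSubgroup.preimage (continuous_const_mul _)).mem_nhds
        (by simp [(expSubgroup A).one_mem])
    filter_upwards [h1] with h hh
    obtain ⟨X, hX⟩ := hh
    have h2 : h = g * expUnit X := by rw [hX, mul_inv_cancel_left]
    rw [h2]
    exact hmulmem _ hg _ (hexp X)
  · rw [Units.val_mul, val_expUnit_log_smul_one hr, smul_mul_assoc, one_mul]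

end Algebra

theorem isOpen_closure_of_coarselyDense_of_commute {A : Type*} [NormedRing A] [NormedAlgebra ℝ A]
    [FiniteDimensional ℝ A] (hcomm : ∀ a b : A, a * b = b * a) (T : Set Aˣ) (hT : T.Finite)
    (C : Set A) (hCne : C.Nonempty) (hCopen : IsOpen C)
    (hCcone : ∀ x ∈ C, ∀ r : ℝ, 0 < r → r • x ∈ C)
    (D : ℝ) (hcd : ∀ x ∈ C, ∃ s ∈ Subsemigroup.closure T, (s : A) ∈ C ∧ ‖(s : A) - x‖ ≤ D) :
    IsOpen (closure (Subsemigroup.closure T : Set Aˣ)) ∧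
      ∀ g ∈ closure (Subsemigroup.closure T : Set Aˣ), ∀ r : ℝ, 0 < r →
        ∃ g' ∈ closure (Subsemigroup.closure T : Set Aˣ), (g' : A) = r • (g : A) := by
  let : NormedCommRing A := { ‹NormedRing A› with mul_comm := hcomm }
  exact isOpen_closure_of_coarselyDense T hT C hCne hCopen hCcone D hcd

theorem span_eq_top_of_coarselyDense {V : Type*} [NormedAddCommGroup V] [NormedSpace ℝ V]
    [FiniteDimensional ℝ V] (O C : Set V) (hCne : C.Nonempty) (hCopen : IsOpen C)
    (hCcone : ∀ x ∈ C, ∀ r : ℝ, 0 < r → r • x ∈ C) (D : ℝ)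
    (hcd : ∀ x ∈ C, ∃ y ∈ O, dist x y < D) : Submodule.span ℝ O = ⊤ := by
  rw [eq_top_iff]
  rintro v -
  obtain ⟨x, hx⟩ := hCne
  have hclosed : IsClosed (Submodule.span ℝ O : Set V) := Submodule.closed_of_finiteDimensional _
  change v ∈ (Submodule.span ℝ O : Set V)
  rw [← hclosed.closure_eq, Metric.mem_closure_iff]
  intro η hη
  obtain ⟨e, he, hxe⟩ : ∃ e > (0 : ℝ), x + e • v ∈ C := by
    have hcont : Continuous fun e : ℝ => x + e • v := by fun_prop
    have h := (hCopen.preimage hcont).mem_nhds (x := 0) (by simpa using hx)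
    have h' : ∀ᶠ e in 𝓝[>] (0 : ℝ), x + e • v ∈ C := nhdsWithin_le_nhds h
    obtain ⟨e, h1, h2⟩ := (h'.and self_mem_nhdsWithin).exists
    exact ⟨e, h2, h1⟩
  obtain ⟨y₀, -, hy₀⟩ := hcd x hx
  have hD : 0 < D := dist_nonneg.trans_lt hy₀
  obtain ⟨t, ht⟩ : ∃ t : ℝ, t = 2 * D / (e * η) := ⟨_, rfl⟩
  have ht0 : 0 < t := by rw [ht]; positivity
  have hte : t * e * η = 2 * D := by rw [ht]; field_simp
  obtain ⟨y, hy, hyd⟩ := hcd _ (hCcone _ hx t ht0)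
  obtain ⟨z, hz, hzd⟩ := hcd _ (hCcone _ hxe t ht0)
  refine ⟨(t * e)⁻¹ • (z - y), Submodule.smul_mem _ _
    (sub_mem (Submodule.subset_span hz) (Submodule.subset_span hy)), ?_⟩
  have hv : v - (t * e)⁻¹ • (z - y) =
      (t * e)⁻¹ • ((t • (x + e • v) - z) - (t • x - y)) := by
    have : (t • (x + e • v) - z) - (t • x - y) = (t * e) • v - (z - y) := by
      rw [smul_add, smul_smul]; abel
    rw [this, smul_sub _ ((t * e) • v), inv_smul_smul₀ (mul_pos ht0 he).ne']
  rw [dist_eq_norm] at hyd hzd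
  rw [dist_eq_norm, hv, norm_smul, Real.norm_of_nonneg (by positivity), inv_mul_lt_iff₀
    (by positivity), hte]
  linarith [norm_sub_le (t • (x + e • v) - z) (t • x - y)]

theorem Subsemigroup.commute_of_mem_closure {G : Type*} [Semigroup G] (T : Set G)
    (hT : ∀ s ∈ T, ∀ t ∈ T, s * t = t * s) :
    ∀ s ∈ Subsemigroup.closure T, ∀ t ∈ Subsemigroup.closure T, s * t = t * s := by
  intro s hs t ht
  induction hs, ht using Subsemigroup.closure_induction₂ with
  | mem x y hx hy => exact hT x hx y hy
  | mul_left x y z _ _ _ h1 h2 => exact Commute.mul_left h1 h2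
  | mul_right x y z _ _ _ h1 h2 => exact Commute.mul_right h1 h2

section Centralizer
variable {V : Type*} [NormedAddCommGroup V] [NormedSpace ℝ V]

/-- An element of the centralizer of `S` is determined by its value at a vector whose `S`-orbit
spans. -/
theorem ext_of_mem_centralizer {S : Set (V →L[ℝ] V)} {v₀ : V}
    (hspan : Submodule.span ℝ ((fun s : V →L[ℝ] V => s v₀) '' S) = ⊤)
    {a b : V →L[ℝ] V} (ha : a ∈ Subalgebra.centralizer ℝ S)
    (hb : b ∈ Subalgebra.centralizer ℝ S) (h : a v₀ = b v₀) : a = b := by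
  refine ContinuousLinearMap.coe_injective (LinearMap.ext_on hspan ?_)
  rintro _ ⟨s, hs, rfl⟩
  have h1 := DFunLike.congr_fun (Subalgebra.mem_centralizer_iff ℝ |>.1 ha s hs) v₀
  have h2 := DFunLike.congr_fun (Subalgebra.mem_centralizer_iff ℝ |>.1 hb s hs) v₀
  change s (a v₀) = a (s v₀) at h1
  change s (b v₀) = b (s v₀) at h2
  simp only [ContinuousLinearMap.coe_coe]
  rw [← h1, ← h2, h]

theorem surjective_eval_of_subset_centralizer {S : Set (V →L[ℝ] V)} {v₀ : V}
    (hspan : Submodule.span ℝ ((fun s : V →L[ℝ] V => s v₀) '' S) = ⊤) (v : V) :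
    ∃ a ∈ Submodule.span ℝ S, a v₀ = v := by
  have h : v ∈ Submodule.map ((ContinuousLinearMap.apply ℝ V v₀ : (V →L[ℝ] V) →L[ℝ] V) :
      (V →L[ℝ] V) →ₗ[ℝ] V) (Submodule.span ℝ S) := by
    rw [Submodule.map_span]
    exact (hspan ▸ Submodule.mem_top : v ∈ Submodule.span ℝ ((fun s : V →L[ℝ] V => s v₀) '' S))
  exact h

theorem centralizer_comm {S : Set (V →L[ℝ] V)} {v₀ : V}
    (hspan : Submodule.span ℝ ((fun s : V →L[ℝ] V => s v₀) '' S) = ⊤)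
    (hS : S ⊆ Subalgebra.centralizer ℝ S)
    (a b : Subalgebra.centralizer ℝ S) : a * b = b * a := by
  have hcomm : ∀ p ∈ Submodule.span ℝ S, p * (b : V →L[ℝ] V) = b * p := by
    intro p hp
    induction hp using Submodule.span_induction with
    | mem x hx => exact Subalgebra.mem_centralizer_iff ℝ |>.1 b.2 x hx
    | zero => simp
    | add x y _ _ hx hy => rw [add_mul, mul_add, hx, hy]
    | smul r x _ hx => rw [smul_mul_assoc, mul_smul_comm, hx]
  obtain ⟨p, hp, hpa⟩ := surjective_eval_of_subset_centralizer hspan ((a : V →L[ℝ] V) v₀)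
  have hle : Submodule.span ℝ S ≤ Subalgebra.toSubmodule (Subalgebra.centralizer ℝ S) :=
    Submodule.span_le.2 hS
  have hap : (a : V →L[ℝ] V) = p := ext_of_mem_centralizer hspan a.2 (hle hp) hpa.symm
  ext1
  rw [MulMemClass.coe_mul, MulMemClass.coe_mul, hap, hcomm p hp]

end Centralizer

/-- In the situation of the main theorem, the evaluation map
`g ↦ g v₀` is injective on the closure `cl S` of `S` in `GL(V)`, its image
`cl S ⬝ v₀` is an open cone in `V`, and it is a homeomorphism of `cl S` onto
this open cone. -/
theorem evaluation_homeomorphism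
    {V : Type*} [NormedAddCommGroup V] [NormedSpace ℝ V] [FiniteDimensional ℝ V]
    (T : Set (V →L[ℝ] V)ˣ) (hTfin : T.Finite)
    (hTcomm : ∀ s ∈ T, ∀ t ∈ T, s * t = t * s)
    (S : Subsemigroup (V →L[ℝ] V)ˣ) (hS : S = Subsemigroup.closure T)
    (v₀ : V)
    (C : Set V) (hCne : C.Nonempty) (hCopen : IsOpen C)
    (hCcone : ∀ x ∈ C, ∀ r : ℝ, 0 < r → r • x ∈ C)
    (hcd : ∃ D : ℝ, 0 < D ∧ ∀ x ∈ C, ∃ s ∈ S,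
      (s : V →L[ℝ] V) v₀ ∈ C ∧ dist x ((s : V →L[ℝ] V) v₀) < D) :
    Set.InjOn (fun g : (V →L[ℝ] V)ˣ => (g : V →L[ℝ] V) v₀)
        (closure (S : Set (V →L[ℝ] V)ˣ)) ∧
      IsOpen ((fun g : (V →L[ℝ] V)ˣ => (g : V →L[ℝ] V) v₀) ''
        closure (S : Set (V →L[ℝ] V)ˣ)) ∧
      (∀ x ∈ (fun g : (V →L[ℝ] V)ˣ => (g : V →L[ℝ] V) v₀) ''
          closure (S : Set (V →L[ℝ] V)ˣ), ∀ r : ℝ, 0 < r →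
        r • x ∈ (fun g : (V →L[ℝ] V)ˣ => (g : V →L[ℝ] V) v₀) ''
          closure (S : Set (V →L[ℝ] V)ˣ)) ∧
      ∃ h : (closure (S : Set (V →L[ℝ] V)ˣ)) ≃ₜ
          ((fun g : (V →L[ℝ] V)ˣ => (g : V →L[ℝ] V) v₀) ''
            closure (S : Set (V →L[ℝ] V)ˣ)),
        ∀ g : closure (S : Set (V →L[ℝ] V)ˣ),
          (h g : V) = ((g : (V →L[ℝ] V)ˣ) : V →L[ℝ] V) v₀ := by
  obtain ⟨D, hD, hcd⟩ := hcd
  set E : Set (V →L[ℝ] V) := (fun g : (V →L[ℝ] V)ˣ => (g : V →L[ℝ] V)) '' (S : Set (V →L[ℝ] V)ˣ)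
  have hScomm : ∀ s ∈ S, ∀ t ∈ S, s * t = t * s := by
    rw [hS]
    exact Subsemigroup.commute_of_mem_closure T hTcomm
  have hspan : Submodule.span ℝ ((fun s : V →L[ℝ] V => s v₀) '' E) = ⊤ := by
    refine span_eq_top_of_coarselyDense _ C hCne hCopen hCcone D fun x hx => ?_
    obtain ⟨s, hs, -, hd⟩ := hcd x hx
    exact ⟨_, ⟨_, ⟨s, hs, rfl⟩, rfl⟩, hd⟩
  set A := Subalgebra.centralizer ℝ E with hA
  have hSA : ∀ s ∈ S, (s : V →L[ℝ] V) ∈ A := by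
    intro s hs
    rw [hA, Subalgebra.mem_centralizer_iff]
    rintro _ ⟨t, ht, rfl⟩
    exact congrArg Units.val (hScomm t ht s hs)
  have hEA : E ⊆ A := by
    rintro _ ⟨s, hs, rfl⟩
    exact hSA s hs
  have hcomm := centralizer_comm hspan hEA
  have hAclosed : IsClosed (A : Set (V →L[ℝ] V)) :=
    Submodule.closed_of_finiteDimensional (Subalgebra.toSubmodule A)
  have hAfin : FiniteDimensional ℝ A :=
    inferInstanceAs (FiniteDimensional ℝ (Subalgebra.toSubmodule A))
  have hAcomplete : CompleteSpace A := FiniteDimensional.complete ℝ A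
  obtain ⟨φ, hφ⟩ : ∃ φ : A ≃L[ℝ] V, ∀ a : A, φ a = (a : V →L[ℝ] V) v₀ := by
    let ev : A →ₗ[ℝ] V :=
      ((ContinuousLinearMap.apply ℝ V v₀ : (V →L[ℝ] V) →L[ℝ] V) : (V →L[ℝ] V) →ₗ[ℝ] V) ∘ₗ
        A.val.toLinearMap
    have hinj : Function.Injective ev := fun a b hab =>
      Subtype.ext (ext_of_mem_centralizer hspan a.2 b.2 hab)
    have hsurj : Function.Surjective ev := by
      intro v
      obtain ⟨a, ha, hav⟩ := surjective_eval_of_subset_centralizer hspan v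
      exact ⟨⟨a, (Submodule.span_le (p := Subalgebra.toSubmodule A)).2 hEA ha⟩, hav⟩
    exact ⟨(LinearEquiv.ofBijective ev ⟨hinj, hsurj⟩).toContinuousLinearEquiv, fun a => rfl⟩
  let ι : Aˣ →* (V →L[ℝ] V)ˣ := Units.map (A.val : A →* (V →L[ℝ] V))
  have hιval : ∀ u : Aˣ, ((ι u : (V →L[ℝ] V)ˣ) : V →L[ℝ] V) = ((u : A) : V →L[ℝ] V) := fun _ => rfl
  have hιind : IsInducing ι := by
    have h1 : IsInducing (Units.val ∘ ι) :=
      (IsInducing.subtypeVal (t := (A : Set (V →L[ℝ] V)))).comp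
        (Units.isOpenEmbedding_val (R := A)).isInducing
    exact (Units.isOpenEmbedding_val.isInducing.of_comp_iff).1 h1
  have hιinj : Function.Injective ι := Units.map_injective Subtype.val_injective
  have hlift : ∀ u : (V →L[ℝ] V)ˣ, (u : V →L[ℝ] V) ∈ A → ∃ u' : Aˣ, ι u' = u := by
    intro u hu
    have hu' : ((u⁻¹ : (V →L[ℝ] V)ˣ) : V →L[ℝ] V) ∈ A := by
      rw [hA, Subalgebra.mem_centralizer_iff] at hu ⊢
      intro s hs
      exact (show Commute s (u : V →L[ℝ] V) from hu s hs).units_inv_right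
    exact ⟨⟨⟨u, hu⟩, ⟨_, hu'⟩, Subtype.ext u.mul_inv, Subtype.ext u.inv_mul⟩, Units.ext rfl⟩
  set SA := Subsemigroup.closure (ι ⁻¹' T)
  have hSAimage : ι '' (SA : Set Aˣ) = S := by
    apply Subset.antisymm
    · rintro _ ⟨u, hu, rfl⟩
      rw [hS]
      induction hu using Subsemigroup.closure_induction with
      | mem x hx => exact Subsemigroup.subset_closure hx
      | mul x y _ _ hx hy => rw [map_mul]; exact mul_mem hx hy
    · intro s hs
      have hsA := hs
      rw [hS] at hs
      induction hs using Subsemigroup.closure_induction with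
      | mem x hx =>
        obtain ⟨u, hu⟩ := hlift x (hSA x hsA)
        exact ⟨u, Subsemigroup.subset_closure (by rwa [mem_preimage, hu]), hu⟩
      | mul x y hx hy ihx ihy =>
        obtain ⟨u, hu, rfl⟩ := ihx (by rw [hS]; exact hx)
        obtain ⟨w, hw, rfl⟩ := ihy (by rw [hS]; exact hy)
        exact ⟨u * w, mul_mem hu hw, map_mul _ _ _⟩
  have hclA : ∀ g ∈ closure (S : Set (V →L[ℝ] V)ˣ), (g : V →L[ℝ] V) ∈ A := fun g hg =>
    closure_minimal (t := Units.val ⁻¹' (A : Set (V →L[ℝ] V))) hSA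
      (hAclosed.preimage Units.continuous_val) hg
  have hclpre : closure (SA : Set Aˣ) = ι ⁻¹' closure (S : Set (V →L[ℝ] V)ˣ) := by
    rw [hιind.closure_eq_preimage_closure_image, hSAimage]
  have himage : (fun g : (V →L[ℝ] V)ˣ => (g : V →L[ℝ] V) v₀) '' closure (S : Set (V →L[ℝ] V)ˣ) =
      φ '' (Units.val '' closure (SA : Set Aˣ)) := by
    rw [hclpre]
    apply Subset.antisymm
    · rintro _ ⟨g, hg, rfl⟩
      obtain ⟨u, rfl⟩ := hlift g (hclA g hg)
      exact ⟨u, ⟨u, hg, rfl⟩, hφ u⟩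
    · rintro _ ⟨_, ⟨u, hu, rfl⟩, rfl⟩
      exact ⟨ι u, hu, (hφ u).symm⟩
  obtain ⟨hopen, hscale⟩ := isOpen_closure_of_coarselyDense_of_commute hcomm (ι ⁻¹' T)
    (hTfin.preimage hιinj.injOn) (φ ⁻¹' C)
    (by
      obtain ⟨x, hx⟩ := hCne
      exact ⟨φ.symm x, by simpa using hx⟩)
    (hCopen.preimage φ.continuous)
    (fun x hx r hr => by
      rw [mem_preimage, map_smul]
      exact hCcone _ hx r hr)
    (‖(φ.symm : V →L[ℝ] A)‖ * D)
    (fun x hx => by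
      obtain ⟨s, hs, hsC, hsd⟩ := hcd _ hx
      have hs' : s ∈ ι '' (SA : Set Aˣ) := hSAimage ▸ hs
      obtain ⟨u, hu, rfl⟩ := hs'
      have hu' : φ (u : A) = ((ι u : (V →L[ℝ] V)ˣ) : V →L[ℝ] V) v₀ := hφ u
      refine ⟨u, hu, by rwa [mem_preimage, hu'], ?_⟩
      rw [← hu', dist_comm, dist_eq_norm, ← map_sub] at hsd
      have h1 := (φ.symm : V →L[ℝ] A).le_opNorm (φ ((u : A) - x))
      rw [ContinuousLinearEquiv.coe_coe, φ.symm_apply_apply] at h1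
      exact h1.trans (by gcongr))
  have hinj : InjOn (fun g : (V →L[ℝ] V)ˣ => (g : V →L[ℝ] V) v₀)
      (closure (S : Set (V →L[ℝ] V)ˣ)) := fun g hg h hh hgh =>
    Units.ext (ext_of_mem_centralizer hspan (hclA g hg) (hclA h hh) hgh)
  refine ⟨hinj, ?_, ?_, ?_⟩
  · rw [himage]
    exact φ.toHomeomorph.isOpenMap _ (Units.isOpenEmbedding_val.isOpenMap _ hopen)
  · rw [himage]
    rintro _ ⟨_, ⟨u, hu, rfl⟩, rfl⟩ r hr
    obtain ⟨u', hu', h⟩ := hscale u hu r hr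
    exact ⟨u', ⟨u', hu', rfl⟩, by rw [h, map_smul]⟩
  · let j : closure (S : Set (V →L[ℝ] V)ˣ) → A := fun g =>
      ⟨((g : (V →L[ℝ] V)ˣ) : V →L[ℝ] V), hclA g g.2⟩
    have hj : IsInducing j := by
      have h1 : IsInducing (Subtype.val ∘ j) :=
        (Units.isOpenEmbedding_val (R := V →L[ℝ] V)).isInducing.comp IsInducing.subtypeVal
      exact (IsInducing.subtypeVal.of_comp_iff).1 h1
    have hemb : IsEmbedding (fun g : closure (S : Set (V →L[ℝ] V)ˣ) =>
        ((g : (V →L[ℝ] V)ˣ) : V →L[ℝ] V) v₀) := by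
      refine ⟨?_, injOn_iff_injective.1 hinj⟩
      have h1 : IsInducing (φ ∘ j) := φ.toHomeomorph.isInducing.comp hj
      convert h1 using 1
      funext g
      exact (hφ (j g)).symm
    exact ⟨hemb.toHomeomorph.trans (Homeomorph.setCongr (image_eq_range
      (fun g : (V →L[ℝ] V)ˣ => (g : V →L[ℝ] V) v₀) _).symm), fun g => rfl⟩
end

section
/- Let $V$ be a finite dimensional complex normed vector space and let $S$ be a subsemigroup of the group $GL(V)$ of invertible $\mathbb{C}$-linear maps of $V$, generated by a finite set of pairwise commuting elements. Suppose there exist $v_0 \in V$ and a nonempty open cone $C$ in $V$ (a cone with respect to positive real scalars) such that the orbit $S \cdot v_0$ intersected with $C$ is coarsely dense in $C$. Then the orbit $S \cdot v_0$ is dense in $V$. -/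
open Filter Topology

section RealSpace

variable {E : Type*} [NormedAddCommGroup E] [NormedSpace ℝ E]

/-- The cone of vectors `y` such that the ray `q ↦ q • y` stays at bounded distance from a path in
`M` whose forward increments all lie in `M`. -/
def monotoneCone (M : AddSubmonoid E) : ConvexCone ℝ E where
  carrier := {y | ∃ (m : ℝ → E) (B : ℝ), (∀ p q, 0 ≤ p → p ≤ q → m q - m p ∈ M) ∧
    ∀ q, 0 ≤ q → ‖m q - q • y‖ ≤ B}
  smul_mem' := by
    rintro c hc y ⟨m, B, hm, hB⟩
    refine ⟨fun q => m (q * c), B, fun p q hp hpq => hm _ _ (by positivity) (by gcongr),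
      fun q hq => ?_⟩
    simpa [mul_smul] using hB (q * c) (by positivity)
  add_mem' := by
    rintro y ⟨m, B, hm, hB⟩ y' ⟨m', B', hm', hB'⟩
    refine ⟨fun q => m q + m' q, B + B', fun p q hp hpq => ?_, fun q hq => ?_⟩
    · have := add_mem (hm p q hp hpq) (hm' p q hp hpq)
      rwa [sub_add_sub_comm] at this
    · rw [smul_add, ← sub_add_sub_comm]
      exact (norm_add_le _ _).trans (add_le_add (hB q hq) (hB' q hq))

theorem subset_monotoneCone (M : AddSubmonoid E) : (M : Set E) ⊆ monotoneCone M := by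
  intro x hx
  refine ⟨fun q => ⌊q⌋₊ • x, ‖x‖, fun p q _ hpq => ?_, fun q hq => ?_⟩
  · obtain ⟨k, hk⟩ := Nat.exists_eq_add_of_le (Nat.floor_le_floor hpq)
    simp only [hk, add_smul, add_sub_cancel_left]
    exact nsmul_mem hx k
  · dsimp only
    rw [← Nat.cast_smul_eq_nsmul ℝ, ← sub_smul, norm_smul]
    refine mul_le_of_le_one_left (norm_nonneg _) ?_
    rw [Real.norm_eq_abs, abs_le]
    constructor <;> linarith [Nat.floor_le hq, Nat.lt_floor_add_one q]

theorem neg_mem_closure_of_neg_mem_monotoneCone [FiniteDimensional ℝ E] {M : AddSubmonoid E}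
    {x : E} (hx : x ∈ M) (hneg : -x ∈ monotoneCone M) : -x ∈ closure (M : Set E) := by
  obtain ⟨m, B, hm, hB⟩ := hneg
  have : ProperSpace E := FiniteDimensional.proper ℝ E
  let w : ℕ → E := fun n => m n + n • x
  have hw : ∀ n, w n ∈ Metric.closedBall (0 : E) B := fun n => by
    have := hB n n.cast_nonneg
    rw [smul_neg, sub_neg_eq_add, Nat.cast_smul_eq_nsmul] at this
    simpa [w] using this
  obtain ⟨a, -, φ, hφ, hlim⟩ := (isCompact_closedBall (0 : E) B).tendsto_subseq hw
  have hdiff : Tendsto (fun n => w (φ (n + 1)) - w (φ n) - x) atTop (𝓝 (-x)) := by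
    have := ((hlim.comp (tendsto_add_atTop_nat 1)).sub hlim).sub_const x
    simpa using this
  refine mem_closure_of_tendsto hdiff (Eventually.of_forall fun n => ?_)
  obtain ⟨k, hk⟩ := Nat.exists_eq_add_of_lt (hφ n.lt_succ_self)
  have h1 := hm (φ n) (φ (n + 1)) (Nat.cast_nonneg _)
    (Nat.cast_le.2 (hφ n.lt_succ_self).le)
  have : w (φ (n + 1)) - w (φ n) - x = (m (φ (n + 1)) - m (φ n)) + k • x := by
    simp only [w, hk, add_smul, one_smul]
    abel
  rw [this]
  exact add_mem h1 (nsmul_mem hx k)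

/-- A spanning convex cone on which no nonzero functional is nonnegative is the whole space. -/
theorem ConvexCone.coe_eq_univ_of_forall_dual_eq_zero [FiniteDimensional ℝ E] (P : ConvexCone ℝ E)
    (h0 : (0 : E) ∈ P) (hspan : Submodule.span ℝ (P : Set E) = ⊤)
    (hdual : ∀ f : E →L[ℝ] ℝ, (∀ x ∈ P, 0 ≤ f x) → f = 0) : (P : Set E) = Set.univ := by
  have hint : (interior (P : Set E)).Nonempty := by
    rw [P.convex.interior_nonempty_iff_affineSpan_eq_top]
    rw [← SetLike.coe_set_eq, ← affineSpan_insert_zero, Set.insert_eq_of_mem (by exact h0)] at hspan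
    exact SetLike.coe_injective (by simpa using hspan)
  by_contra hne
  obtain ⟨x, hx⟩ := (Set.ne_univ_iff_exists_notMem _).1 hne
  obtain ⟨f, hf⟩ := geometric_hahn_banach_open_point P.convex.interior isOpen_interior
    (fun h => hx (interior_subset h))
  have hcl : ∀ y ∈ P, f y ≤ f x := by
    have : closure (interior (P : Set E)) ⊆ {y | f y ≤ f x} :=
      closure_minimal (fun y hy => (hf y hy).le) (isClosed_le f.continuous continuous_const)
    rw [P.convex.closure_interior_eq_closure_of_nonempty_interior hint] at this
    exact fun y hy => this (subset_closure hy)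
  have hnonpos : ∀ y ∈ P, 0 ≤ (-f) y := by
    intro y hy
    by_contra! hlt
    have hpos : 0 < f y := by simpa using hlt
    have hfx : 0 ≤ f x := by simpa using hcl 0 h0
    have := hcl _ (P.smul_mem (show 0 < (f x + 1) / f y by positivity) hy)
    simp only [map_smul, smul_eq_mul] at this
    rw [div_mul_cancel₀ _ hpos.ne'] at this
    linarith
  obtain ⟨y, hy⟩ := hint
  have hf0 : f = 0 := by simpa using hdual (-f) hnonpos
  simpa [hf0] using hf y hy

theorem AddSubgroup.eq_top_of_isClosed_of_approx {G : AddSubgroup E} (hG : IsClosed (G : Set E))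
    {U : Set E} (hU : IsOpen U) (hne : U.Nonempty) {e : E}
    (h : ∀ ε > 0, ∀ᶠ t : ℝ in atTop, ∀ u ∈ U, ∃ m ∈ G, ‖u + t • e - m‖ ≤ ε) : G = ⊤ := by
  obtain ⟨u₀, hu₀⟩ := hne
  have hsub : ∀ u ∈ U, u - u₀ ∈ G := by
    intro u hu
    rw [← SetLike.mem_coe, ← hG.closure_eq, Metric.mem_closure_iff]
    intro ε hε
    obtain ⟨t, ht⟩ := (h (ε / 3) (by positivity)).exists
    obtain ⟨m, hm, hmu⟩ := ht u hu
    obtain ⟨m₀, hm₀, hmu₀⟩ := ht u₀ hu₀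
    refine ⟨m - m₀, sub_mem hm hm₀, ?_⟩
    rw [dist_eq_norm, show u - u₀ - (m - m₀) = (u + t • e - m) - (u₀ + t • e - m₀) by abel]
    exact (norm_sub_le _ _).trans_lt (by linarith)
  have hnhds : (G : Set E) ∈ 𝓝 0 := by
    have : (fun v => v + u₀) ⁻¹' U ∈ 𝓝 (0 : E) :=
      (continuous_add_const u₀).continuousAt.preimage_mem_nhds (by simpa using hU.mem_nhds hu₀)
    filter_upwards [this] with v hv
    simpa using hsub _ hv
  have := IsClopen.eq_univ ⟨hG, G.isOpen_of_mem_nhds hnhds⟩ ⟨0, G.zero_mem⟩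
  exact SetLike.coe_injective (by simpa using this)

/-- An additive monoid that becomes arbitrarily dense along a moving open set, and on which no nonzero
functional is nonnegative, is dense. -/
theorem dense_addSubmonoid_of_approx [FiniteDimensional ℝ E] {M : AddSubmonoid E}
    {U : Set E} (hU : IsOpen U) (hne : U.Nonempty) {e : E}
    (h : ∀ ε > 0, ∀ᶠ t : ℝ in atTop, ∀ u ∈ U, ∃ m ∈ M, ‖u + t • e - m‖ ≤ ε)
    (hdual : ∀ f : E →L[ℝ] ℝ, (∀ x ∈ M, 0 ≤ f x) → f = 0) : Dense (M : Set E) := by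
  have hspan : Submodule.span ℝ (M : Set E) = ⊤ := by
    have := AddSubgroup.eq_top_of_isClosed_of_approx
      (G := (Submodule.span ℝ (M : Set E)).toAddSubgroup)
      (Submodule.closed_of_finiteDimensional _) hU hne (e := e) (fun ε hε => by
        filter_upwards [h ε hε] with t ht u hu
        obtain ⟨m, hm, hmu⟩ := ht u hu
        exact ⟨m, Submodule.subset_span hm, hmu⟩)
    exact Submodule.toAddSubgroup_injective (by simpa using this)
  have hcone := (monotoneCone M).coe_eq_univ_of_forall_dual_eq_zero
    (subset_monotoneCone M M.zero_mem)
    (top_le_iff.1 (hspan ▸ Submodule.span_mono (subset_monotoneCone M)))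
    (fun f hf => hdual f fun x hx => hf x (subset_monotoneCone M hx))
  have hneg : ∀ x ∈ M.topologicalClosure, -x ∈ M.topologicalClosure := by
    have : closure (M : Set E) ⊆ Neg.neg ⁻¹' closure (M : Set E) :=
      closure_minimal (fun x hx => neg_mem_closure_of_neg_mem_monotoneCone hx
        (by rw [← SetLike.mem_coe, hcone]; trivial)) (isClosed_closure.preimage continuous_neg)
    exact fun x hx => this hx
  let G : AddSubgroup E := { M.topologicalClosure with neg_mem' := fun {x} hx => hneg x hx }
  have hG : G = ⊤ := AddSubgroup.eq_top_of_isClosed_of_approx (e := e)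
    (show IsClosed (closure (M : Set E)) from isClosed_closure) hU hne (fun ε hε => by
      filter_upwards [h ε hε] with t ht u hu
      obtain ⟨m, hm, hmu⟩ := ht u hu
      exact ⟨m, subset_closure hm, hmu⟩)
  intro x
  have : x ∈ G := hG ▸ AddSubgroup.mem_top x
  exact this

end RealSpace

/-- The values of `n ↦ ∑ i, n i * a i` on `ι → ℕ`, for nonnegative `a`, grow polynomially, so they
cannot be exponentially dense along a translated interval. -/
theorem not_forall_exists_sum_approx {ι : Type*} [Fintype ι] (a : ι → ℝ) (ha : ∀ i, 0 ≤ a i)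
    (α c δ K : ℝ) (hδ : 0 < δ) :
    ¬ ∀ᶠ t : ℝ in atTop, ∀ s ∈ Set.Icc 0 δ, ∃ n : ι → ℕ,
      |α + s + t * c - ∑ i, n i * a i| ≤ K * Real.exp (-t) := by
  classical
  intro h
  obtain ⟨b, hb0, hb⟩ : ∃ b : ℝ, 0 ≤ b ∧ ∀ i, a i ≠ 0 → 1 ≤ b * a i := by
    refine ⟨∑ i, (a i)⁻¹, Finset.sum_nonneg fun i _ => inv_nonneg.2 (ha i), fun i hi => ?_⟩
    calc (1 : ℝ) = (a i)⁻¹ * a i := (inv_mul_cancel₀ hi).symm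
      _ ≤ _ := mul_le_mul_of_nonneg_right
        (Finset.single_le_sum (f := fun i => (a i)⁻¹) (fun j _ => inv_nonneg.2 (ha j))
          (Finset.mem_univ i)) (ha i)
  obtain ⟨L, hL⟩ := exists_nat_ge (b * (|α| + δ + |c| + |K|))
  have key : ∀ᶠ k : ℕ in atTop,
      δ ≤ ((L * (k + 1) + 1) ^ Fintype.card ι : ℝ) * (2 * K * Real.exp (-k)) := by
    filter_upwards [tendsto_natCast_atTop_atTop.eventually h] with k hk
    have hK : 0 ≤ K * Real.exp (-k) := by
      obtain ⟨n, hn⟩ := hk 0 ⟨le_rfl, hδ.le⟩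
      exact (abs_nonneg _).trans hn
    have hK1 : K * Real.exp (-k) ≤ |K| := by
      refine (mul_le_mul_of_nonneg_right (le_abs_self K) (Real.exp_nonneg _)).trans ?_
      exact mul_le_of_le_one_right (abs_nonneg _) (Real.exp_le_one_iff.2 (by simp))
    let F : Finset (ι → ℕ) := Fintype.piFinset fun _ => Finset.range (L * (k + 1) + 1)
    have hcover : Set.Icc 0 δ ⊆ ⋃ n ∈ F, Metric.closedBall (∑ i, n i * a i - α - k * c)
        (K * Real.exp (-k)) := by
      intro s hs
      obtain ⟨n, hn⟩ := hk s hs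
      simp only [Set.mem_iUnion, Metric.mem_closedBall, Real.dist_eq, exists_prop]
      refine ⟨fun i => if a i = 0 then 0 else n i, ?_, ?_⟩
      · simp only [F, Fintype.mem_piFinset, Finset.mem_range, Nat.lt_succ_iff]
        intro i
        split_ifs with hi
        · exact Nat.zero_le _
        have h1 : (n i : ℝ) * a i ≤ ∑ i, n i * a i :=
          Finset.single_le_sum (f := fun i => (n i : ℝ) * a i)
            (fun j _ => mul_nonneg (Nat.cast_nonneg _) (ha j)) (Finset.mem_univ i)
        have h2 : ∑ i, n i * a i ≤ (|α| + δ + |c| + |K|) * (k + 1) := by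
          have hk0 : (0 : ℝ) ≤ k := Nat.cast_nonneg k
          have h4 : (k : ℝ) * c ≤ k * |c| := mul_le_mul_of_nonneg_left (le_abs_self c) hk0
          have h3 := (abs_le.1 hn).1
          have := le_abs_self α
          have := hs.2
          nlinarith [mul_nonneg hk0 (abs_nonneg α), mul_nonneg hk0 hδ.le,
            mul_nonneg hk0 (abs_nonneg K), abs_nonneg c]
        have h5 : (n i : ℝ) ≤ L * (k + 1) :=
          calc (n i : ℝ) ≤ n i * (b * a i) := le_mul_of_one_le_right (Nat.cast_nonneg _) (hb i hi)
            _ = b * (n i * a i) := by ring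
            _ ≤ b * ((|α| + δ + |c| + |K|) * (k + 1)) :=
              mul_le_mul_of_nonneg_left (h1.trans h2) hb0
            _ = b * (|α| + δ + |c| + |K|) * (k + 1) := by ring
            _ ≤ L * (k + 1) := by gcongr
        exact_mod_cast h5
      · have : ∑ i, ((if a i = 0 then 0 else n i : ℕ) : ℝ) * a i = ∑ i, n i * a i := by
          refine Finset.sum_congr rfl fun i _ => ?_
          split_ifs with hi <;> simp [hi]
        rw [this]
        convert hn using 2
        ring
    have hvol := (MeasureTheory.measure_mono (μ := MeasureTheory.volume) hcover).trans
      (MeasureTheory.measure_biUnion_finset_le F _)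
    simp only [Real.volume_Icc, sub_zero, Real.volume_closedBall, Finset.sum_const,
      nsmul_eq_mul] at hvol
    rw [← ENNReal.ofReal_natCast, ← ENNReal.ofReal_mul (Nat.cast_nonneg _),
      ENNReal.ofReal_le_ofReal_iff (by positivity)] at hvol
    simpa [F, mul_assoc] using hvol
  have hlim : Tendsto (fun k : ℕ => ((L * (k + 1) + 1) ^ Fintype.card ι : ℝ) *
      (2 * K * Real.exp (-k))) atTop (𝓝 0) := by
    let p : Polynomial ℝ := (Polynomial.C (L : ℝ) * (Polynomial.X + 1) + 1) ^ Fintype.card ι *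
      Polynomial.C (2 * K)
    have := (p.tendsto_div_exp_atTop).comp (tendsto_natCast_atTop_atTop (R := ℝ))
    refine this.congr fun k => ?_
    simp only [Function.comp, p, Polynomial.eval_mul, Polynomial.eval_pow, Polynomial.eval_add,
      Polynomial.eval_C, Polynomial.eval_X, Polynomial.eval_one, Real.exp_neg]
    ring
  exact absurd (ge_of_tendsto hlim key) (not_le.2 hδ)

section Algebra

variable {A : Type*} [NormedCommRing A] [NormedAlgebra ℂ A]

theorem eventually_exists_exp_eq [CompleteSpace A] :
    ∀ᶠ w in 𝓝 (1 : A), ∃ z, NormedSpace.exp z = w ∧ ‖z‖ ≤ 2 * ‖w - 1‖ := by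
  have hexp := hasStrictFDerivAt_exp_zero (𝕂 := ℂ) (𝔸 := A)
  have hmap := hexp.map_nhds_eq_of_equiv (f' := ContinuousLinearEquiv.refl ℂ A)
  rw [NormedSpace.exp_zero] at hmap
  rw [← hmap, eventually_map]
  filter_upwards [hexp.hasFDerivAt.isLittleO.def (show (0 : ℝ) < 1 / 2 by norm_num)] with z hz
  refine ⟨z, rfl, ?_⟩
  simp only [NormedSpace.exp_zero, sub_zero, one_apply_eq_self] at hz
  have := norm_sub_norm_le z (z - (NormedSpace.exp z - 1))
  rw [sub_sub_cancel, ← norm_neg (z - _), neg_sub] at this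
  linarith

theorem spectrum.finite_of_finiteDimensional {R : Type*} [Ring R] [Algebra ℂ R]
    [FiniteDimensional ℂ R] (a : R) : (spectrum ℂ a).Finite := by
  cases subsingleton_or_nontrivial R
  · rw [spectrum.of_subsingleton]
    exact Set.finite_empty
  have hint : IsIntegral ℂ a := Algebra.IsIntegral.isIntegral a
  refine (Polynomial.rootSet_finite (minpoly ℂ a) ℂ).subset fun z hz => ?_
  have := spectrum.subset_polynomial_aeval a (minpoly ℂ a) ⟨z, hz, rfl⟩
  rw [minpoly.aeval, spectrum.zero_eq] at this
  rw [Polynomial.mem_rootSet]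
  exact ⟨minpoly.ne_zero hint, by simpa using this⟩

/-- The exponential of a finite dimensional commutative complex algebra is onto the units. -/
theorem exists_exp_eq_of_isUnit [FiniteDimensional ℂ A] {u : A} (hu : IsUnit u) :
    ∃ x, NormedSpace.exp x = u := by
  have : CompleteSpace A := FiniteDimensional.complete ℂ A
  let : NormedAlgebra ℚ A := NormedAlgebra.restrictScalars ℚ ℂ A
  let w : ℂ → A := fun z => 1 + z • (u - 1)
  have hwc : Continuous w := by fun_prop
  have hfin : {z | ¬ IsUnit (w z)}.Finite := by
    refine ((spectrum.finite_of_finiteDimensional (u - 1)).image fun z => -z⁻¹).subset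
      fun z hz => ⟨-z⁻¹, ?_, by simp⟩
    have hz0 : z ≠ 0 := by
      rintro rfl
      simp [w] at hz
    contrapose! hz
    rw [spectrum.notMem_iff] at hz
    have h := ((hz.neg).smul (Units.mk0 z hz0))
    simp only [Set.mem_ofPred_eq, not_not, w]
    convert h using 1
    simp only [Units.smul_mk0, neg_sub, smul_sub z (u - 1), Algebra.algebraMap_eq_smul_one, smul_smul]
    simp [hz0, add_comm]
  have hconn : IsPreconnected {z | IsUnit (w z)} := by
    have := (hfin.countable.isConnected_compl_of_one_lt_rank (E := ℂ) (by simp)).isPreconnected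
    simpa [Set.compl_ofPred] using this
  obtain ⟨x, hx⟩ := hconn.induction₂ (fun z z' => ∃ x, w z' = w z * NormedSpace.exp x)
    (fun z hz => by
      obtain ⟨v, hv⟩ := hz
      have : Tendsto (fun z' => (↑v⁻¹ : A) * w z') (𝓝 z) (𝓝 1) := by
        have := (hwc.tendsto z).const_mul (↑v⁻¹ : A)
        rwa [← hv, Units.inv_mul] at this
      filter_upwards [mem_nhdsWithin_of_mem_nhds (this.eventually eventually_exists_exp_eq)]
        with z' ⟨x, hx, _⟩
      exact ⟨x, by rw [hx, ← hv, Units.mul_inv_cancel_left]⟩)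
    (fun x y z _ _ _ ⟨a, ha⟩ ⟨b, hb⟩ =>
      ⟨a + b, by rw [hb, ha, NormedSpace.exp_add, mul_assoc]⟩)
    (fun x y _ _ ⟨a, ha⟩ => ⟨-a, by
      rw [ha, mul_assoc, ← NormedSpace.exp_add, add_neg_cancel, NormedSpace.exp_zero, mul_one]⟩)
    (show IsUnit (w 0) by simp [w]) (show IsUnit (w 1) by simpa [w] using hu)
  exact ⟨x, by simpa [w] using hx.symm⟩

theorem dense_setOf_isUnit [FiniteDimensional ℂ A] : Dense {a : A | IsUnit a} := by
  intro x
  have hd : Dense (spectrum ℂ x)ᶜ :=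
    (spectrum.finite_of_finiteDimensional x).countable.dense_compl ℂ
  have hc : Continuous fun z : ℂ => x - algebraMap ℂ A z :=
    continuous_const.sub (continuous_algebraMap ℂ A)
  have := image_closure_subset_closure_image hc (Set.mem_image_of_mem _ (hd 0))
  simp only [map_zero, sub_zero] at this
  refine closure_mono ?_ this
  rintro _ ⟨z, hz, rfl⟩
  have := (spectrum.notMem_iff.1 hz).neg
  rwa [neg_sub] at this

/-- The additive monoid of logarithms of the elements of a multiplicative monoid. -/
noncomputable def logSubmonoid [CompleteSpace A] (M : Submonoid A) : AddSubmonoid A where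
  carrier := {x | NormedSpace.exp x ∈ M}
  zero_mem' := by simp [NormedSpace.exp_zero]
  add_mem' := by
    intro x y hx hy
    let : NormedAlgebra ℚ A := NormedAlgebra.restrictScalars ℚ ℂ A
    simpa [NormedSpace.exp_add] using mul_mem hx hy

theorem mem_logSubmonoid [CompleteSpace A] {M : Submonoid A} {x : A} :
    x ∈ logSubmonoid M ↔ NormedSpace.exp x ∈ M := Iff.rfl

/-- A functional that is nonnegative on the logarithms of a finitely generated monoid takes on
them only the values of a nonnegative integer combination of finitely many nonnegative reals. -/
theorem exists_apply_eq_sum [FiniteDimensional ℂ A] [CompleteSpace A] {T : Set A} [Fintype T]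
    (hT : ∀ t ∈ T, IsUnit t) (f : A →L[ℝ] ℝ)
    (hf : ∀ x ∈ logSubmonoid (Submonoid.closure T), 0 ≤ f x) :
    ∃ a : T → ℝ, (∀ t, 0 ≤ a t) ∧ ∀ x ∈ logSubmonoid (Submonoid.closure T),
      ∃ n : T → ℕ, f x = ∑ t, n t * a t := by
  let : NormedAlgebra ℚ A := NormedAlgebra.restrictScalars ℚ ℂ A
  choose l hl using fun t : T => exists_exp_eq_of_isUnit (hT t t.2)
  refine ⟨fun t => f (l t), fun t => hf _ ?_, fun x hx => ?_⟩
  · rw [mem_logSubmonoid, hl]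
    exact Submonoid.subset_closure t.2
  have hker : ∀ x, NormedSpace.exp x = 1 → f x = 0 := by
    intro x hx
    refine le_antisymm ?_ (hf x ?_)
    · have := hf (-x) ?_
      · simpa using this
      · have : NormedSpace.exp (-x) = 1 := by
          simpa [hx, NormedSpace.exp_zero] using (NormedSpace.exp_add (x := x) (y := -x)).symm
        simp [mem_logSubmonoid, this]
    · simp [mem_logSubmonoid, hx]
  rw [mem_logSubmonoid] at hx
  obtain ⟨n, hn⟩ := Submonoid.mem_closure_iff_of_fintype.1 hx
  refine ⟨n, ?_⟩
  have h0 : NormedSpace.exp (x - ∑ t, n t • l t) = 1 := by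
    have h1 : NormedSpace.exp (∑ t, n t • l t) = NormedSpace.exp x := by
      rw [NormedSpace.exp_sum, hn]
      exact Finset.prod_congr rfl fun t _ => by rw [NormedSpace.exp_nsmul, hl]
    rw [sub_eq_add_neg, NormedSpace.exp_add, ← h1, ← NormedSpace.exp_add, add_neg_cancel,
      NormedSpace.exp_zero]
  have := hker _ h0
  rw [map_sub, sub_eq_zero] at this
  rw [this, map_sum]
  exact Finset.sum_congr rfl fun t _ => by rw [map_nsmul, nsmul_eq_mul]

/-- A monoid coarsely dense in an open cone has logarithms that are exponentially dense along the
translates of an open set in direction `1`. -/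
theorem exists_open_forall_exists_mem_logSubmonoid [FiniteDimensional ℂ A] [CompleteSpace A]
    {M : Submonoid A} {C : Set A} (hCne : C.Nonempty) (hCopen : IsOpen C)
    (hCcone : ∀ x ∈ C, ∀ r : ℝ, 0 < r → r • x ∈ C) {D : ℝ}
    (hD : ∀ x ∈ C, ∃ s ∈ M, dist x s < D) :
    ∃ (U : Set A) (K : ℝ), IsOpen U ∧ U.Nonempty ∧ ∀ᶠ t : ℝ in atTop, ∀ u ∈ U,
      ∃ m ∈ logSubmonoid M, ‖u + t • (1 : A) - m‖ ≤ K * Real.exp (-t) := by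
  let : NormedAlgebra ℚ A := NormedAlgebra.restrictScalars ℚ ℂ A
  have hexpr : ∀ t : ℝ, NormedSpace.exp (t • (1 : A)) = Real.exp t • (1 : A) := by
    intro t
    rw [← Algebra.algebraMap_eq_smul_one, ← Algebra.algebraMap_eq_smul_one, Real.exp_eq_exp_ℝ,
      NormedSpace.algebraMap_exp_comm]
  obtain ⟨y, hyC, hy⟩ := dense_setOf_isUnit.inter_open_nonempty C hCopen hCne
  obtain ⟨u₀, rfl⟩ := exists_exp_eq_of_isUnit hy
  have hexp : Continuous (NormedSpace.exp : A → A) := NormedSpace.exp_continuous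
  let B := ‖NormedSpace.exp (-u₀)‖ + 1
  refine ⟨NormedSpace.exp ⁻¹' C ∩ {u | ‖NormedSpace.exp (-u)‖ < B}, 2 * (B * D),
    (hCopen.preimage hexp).inter (isOpen_lt (by fun_prop) continuous_const),
    ⟨u₀, hyC, lt_add_one ‖NormedSpace.exp (-u₀)‖⟩, ?_⟩
  obtain ⟨ρ, hρ, hlog⟩ := Metric.eventually_nhds_iff.1 (eventually_exists_exp_eq (A := A))
  have hlim : Tendsto (fun t : ℝ => B * D * Real.exp (-t)) atTop (𝓝 0) := by
    simpa using (Real.tendsto_exp_neg_atTop_nhds_zero.const_mul (B * D))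
  filter_upwards [hlim.eventually_lt_const hρ] with t ht u hu
  obtain ⟨s, hs, hsD⟩ := hD _ (hCcone _ hu.1 _ (Real.exp_pos t))
  have hw : ‖NormedSpace.exp (-(u + t • (1 : A))) * s - 1‖ ≤ B * D * Real.exp (-t) := by
    have h1 : NormedSpace.exp (-(u + t • (1 : A))) = Real.exp (-t) • NormedSpace.exp (-u) := by
      rw [neg_add, ← neg_smul, NormedSpace.exp_add, hexpr, mul_smul_comm, mul_one]
    have h2 : Real.exp (-t) • NormedSpace.exp (-u) * (Real.exp t • NormedSpace.exp u) = 1 := by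
      rw [smul_mul_smul_comm, ← Real.exp_add, ← NormedSpace.exp_add]
      simp [NormedSpace.exp_zero]
    rw [h1, ← h2, ← mul_sub]
    rw [dist_eq_norm'] at hsD
    calc _ ≤ ‖Real.exp (-t) • NormedSpace.exp (-u)‖ * ‖s - Real.exp t • NormedSpace.exp u‖ :=
          norm_mul_le _ _
      _ = ‖NormedSpace.exp (-u)‖ * ‖s - Real.exp t • NormedSpace.exp u‖ * Real.exp (-t) := by
          rw [norm_smul, Real.norm_eq_abs, Real.abs_exp]
          ring
      _ ≤ _ := by
          gcongr
          exact hu.2.le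
  obtain ⟨z, hz, hzn⟩ := hlog (show dist (NormedSpace.exp (-(u + t • (1 : A))) * s) 1 < ρ by
    rw [dist_eq_norm]
    exact hw.trans_lt ht)
  refine ⟨u + t • (1 : A) + z, ?_, ?_⟩
  · rw [mem_logSubmonoid, NormedSpace.exp_add, hz, ← mul_assoc, ← NormedSpace.exp_add,
      add_neg_cancel, NormedSpace.exp_zero, one_mul]
    exact hs
  · rw [sub_add_cancel_left, norm_neg]
    linarith

/-- A finitely generated monoid of units that is coarsely dense in an open cone of a finite
dimensional commutative complex algebra is dense in the algebra. -/
theorem dense_closure_of_approx_cone [FiniteDimensional ℂ A] {T : Set A} (hTfin : T.Finite)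
    (hT : ∀ t ∈ T, IsUnit t) {C : Set A} (hCne : C.Nonempty) (hCopen : IsOpen C)
    (hCcone : ∀ x ∈ C, ∀ r : ℝ, 0 < r → r • x ∈ C) {D : ℝ}
    (hD : ∀ x ∈ C, ∃ s ∈ Submonoid.closure T, dist x s < D) :
    Dense (Submonoid.closure T : Set A) := by
  have : CompleteSpace A := FiniteDimensional.complete ℂ A
  have : FiniteDimensional ℝ A := FiniteDimensional.trans ℝ ℂ A
  let : NormedAlgebra ℚ A := NormedAlgebra.restrictScalars ℚ ℂ A
  have := hTfin.fintype
  obtain ⟨U, K, hU, ⟨u₀, hu₀⟩, hK⟩ :=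
    exists_open_forall_exists_mem_logSubmonoid hCne hCopen hCcone hD
  have hlog : Dense (logSubmonoid (Submonoid.closure T) : Set A) := by
    refine dense_addSubmonoid_of_approx hU ⟨u₀, hu₀⟩ (e := 1) (fun ε hε => ?_) fun f hf => ?_
    · have hlim : Tendsto (fun t : ℝ => K * Real.exp (-t)) atTop (𝓝 0) := by
        simpa using (Real.tendsto_exp_neg_atTop_nhds_zero.const_mul K)
      filter_upwards [hK, hlim.eventually_lt_const hε] with t ht htε u hu
      obtain ⟨m, hm, hmu⟩ := ht u hu
      exact ⟨m, hm, hmu.trans htε.le⟩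
    · by_contra hf0
      obtain ⟨v, hv⟩ : ∃ v, f v ≠ 0 := by
        contrapose! hf0
        ext v
        exact hf0 v
      obtain ⟨a, ha, hfa⟩ := exists_apply_eq_sum hT f hf
      have hc : Continuous fun s : ℝ => u₀ + s • ((f v)⁻¹ • v) := by fun_prop
      obtain ⟨δ, hδ, hball⟩ := Metric.mem_nhds_iff.1
        ((hU.preimage hc).mem_nhds (show (0 : ℝ) ∈ _ by simpa using hu₀))
      refine not_forall_exists_sum_approx a ha (f u₀) (f 1) (δ / 2) (‖f‖ * K) (by positivity) ?_
      filter_upwards [hK] with t ht s hs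
      obtain ⟨m, hm, hmu⟩ := ht _ (hball (show s ∈ Metric.ball 0 δ by
        rw [Metric.mem_ball, Real.dist_0_eq_abs, abs_of_nonneg hs.1]
        linarith [hs.2]))
      obtain ⟨n, hn⟩ := hfa m hm
      refine ⟨n, ?_⟩
      have h1 := (f.le_opNorm _).trans (mul_le_mul_of_nonneg_left hmu (norm_nonneg f))
      rw [map_sub, hn] at h1
      simpa [hv, mul_assoc] using h1
  have hrange : DenseRange (NormedSpace.exp : A → A) :=
    dense_setOf_isUnit.mono fun _ hu => exists_exp_eq_of_isUnit hu
  refine (hrange.dense_image NormedSpace.exp_continuous hlog).mono ?_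
  rintro _ ⟨x, hx, rfl⟩
  exact hx

end Algebra

theorem dense_closure_of_approx_cone_of_commute {A : Type*} [NormedRing A] [NormedAlgebra ℂ A]
    [FiniteDimensional ℂ A] (hcomm : ∀ a b : A, a * b = b * a) {T : Set A} (hTfin : T.Finite)
    (hT : ∀ t ∈ T, IsUnit t) {C : Set A} (hCne : C.Nonempty) (hCopen : IsOpen C)
    (hCcone : ∀ x ∈ C, ∀ r : ℝ, 0 < r → r • x ∈ C) {D : ℝ}
    (hD : ∀ x ∈ C, ∃ s ∈ Submonoid.closure T, dist x s < D) :
    Dense (Submonoid.closure T : Set A) :=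
  let : NormedCommRing A := { ‹NormedRing A› with mul_comm := hcomm }
  dense_closure_of_approx_cone hTfin hT hCne hCopen hCcone hD


/-- Let `V` be a finite dimensional complex normed vector space and `S`
a subsemigroup of `GL(V)` (invertible `ℂ`-linear maps) generated by a finite set of
pairwise commuting elements.  If for some `v₀ ∈ V` and some nonempty open cone `C`
(with respect to positive real scalars) the set `S ⬝ v₀ ∩ C` is coarsely dense in `C`,
then the orbit `S ⬝ v₀` is dense in `V`. -/
theorem complex_orbit_dense
    {V : Type*} [NormedAddCommGroup V] [NormedSpace ℂ V] [FiniteDimensional ℂ V]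
    (T : Set (V →L[ℂ] V)ˣ) (hTfin : T.Finite)
    (hTcomm : ∀ s ∈ T, ∀ t ∈ T, s * t = t * s)
    (S : Subsemigroup (V →L[ℂ] V)ˣ) (hS : S = Subsemigroup.closure T)
    (v₀ : V)
    (C : Set V) (hCne : C.Nonempty) (hCopen : IsOpen C)
    (hCcone : ∀ x ∈ C, ∀ r : ℝ, 0 < r → r • x ∈ C)
    (hcd : ∃ D : ℝ, 0 < D ∧ ∀ x ∈ C, ∃ s ∈ S,
      (s : V →L[ℂ] V) v₀ ∈ C ∧ dist x ((s : V →L[ℂ] V) v₀) < D) :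
    Dense {w : V | ∃ s ∈ S, (s : V →L[ℂ] V) v₀ = w} := by
  subst hS
  obtain ⟨D, -, hD⟩ := hcd
  let TL : Set (V →L[ℂ] V) := Units.val '' T
  let A : Subalgebra ℂ (V →L[ℂ] V) := Algebra.adjoin ℂ TL
  have hcomm : ∀ a b : A, a * b = b * a := by
    have : ∀ a ∈ TL, ∀ b ∈ TL, a * b = b * a := by
      rintro _ ⟨s, hs, rfl⟩ _ ⟨t, ht, rfl⟩
      exact congrArg Units.val (hTcomm s hs t ht)
    exact (Algebra.isMulCommutative_adjoin ℂ this).is_comm.comm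
  let TA : Set A := Subtype.val ⁻¹' TL
  have hTAfin : TA.Finite := (hTfin.image _).preimage Subtype.val_injective.injOn
  have hTA : ∀ t ∈ TA, IsUnit t := by
    rintro t ⟨u, -, hu⟩
    have hinj : Function.Injective (LinearMap.mulLeft ℂ t) := by
      intro a b hab
      have h : (t : V →L[ℂ] V) * a = t * b := congrArg Subtype.val hab
      rw [← hu] at h
      exact Subtype.ext (u.isUnit.mul_left_cancel h)
    obtain ⟨b, hb⟩ := LinearMap.surjective_of_injective hinj 1
    exact isUnit_iff_exists.2 ⟨b, hb, (hcomm b t).trans hb⟩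
  have hSM : ∀ s ∈ Subsemigroup.closure T, ∃ a ∈ Submonoid.closure TA, (a : V →L[ℂ] V) = s := by
    intro s hs
    induction hs using Subsemigroup.closure_induction with
    | mem t ht =>
      exact ⟨⟨t, Algebra.subset_adjoin ⟨t, ht, rfl⟩⟩, Submonoid.subset_closure ⟨t, ht, rfl⟩, rfl⟩
    | mul s t _ _ hs ht =>
      obtain ⟨a, ha, has⟩ := hs
      obtain ⟨b, hb, hbt⟩ := ht
      exact ⟨a * b, mul_mem ha hb, by simp [has, hbt]⟩
  have hMS : ∀ a ∈ Submonoid.closure TA, a = 1 ∨ ∃ s ∈ Subsemigroup.closure T,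
      (s : V →L[ℂ] V) = a := by
    intro a ha
    induction ha using Submonoid.closure_induction with
    | mem t ht =>
      obtain ⟨u, hu, hut⟩ := ht
      exact .inr ⟨u, Subsemigroup.subset_closure hu, hut⟩
    | one => exact .inl rfl
    | mul a b _ _ ha hb =>
      obtain rfl | ⟨s, hs, hsa⟩ := ha
      · simpa using hb
      obtain rfl | ⟨t, ht, htb⟩ := hb
      · exact .inr ⟨s, hs, by simpa using hsa⟩
      exact .inr ⟨s * t, mul_mem hs ht, by simp [hsa, htb]⟩
  let ev : A →ₗ[ℂ] V :=
    (ContinuousLinearMap.apply ℂ V v₀).toLinearMap ∘ₗ A.val.toLinearMap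
  have hev : ∀ a : A, ev a = (a : V →L[ℂ] V) v₀ := fun _ => rfl
  have hsurj : Function.Surjective ev := by
    rw [← LinearMap.range_eq_top]
    refine Submodule.eq_top_of_nonempty_interior' _
      (hCne.mono (hCopen.subset_interior_iff.2 fun x hx => ?_))
    rw [← (Submodule.closed_of_finiteDimensional (LinearMap.range ev)).closure_eq,
      Metric.mem_closure_iff]
    intro ε hε
    have hD0 : 0 < D := by
      obtain ⟨s, -, -, hs⟩ := hD x hx
      exact dist_nonneg.trans_lt hs
    have hr : 0 < D / ε := by positivity
    obtain ⟨s, hs, -, hsD⟩ := hD _ (hCcone x hx _ hr)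
    obtain ⟨a, -, ha⟩ := hSM s hs
    refine ⟨(D / ε)⁻¹ • (s : V →L[ℂ] V) v₀, ?_, ?_⟩
    · refine ⟨((D / ε)⁻¹ : ℝ) • a, ?_⟩
      rw [hev, ← ha]
      rfl
    · have h1 : x = (D / ε)⁻¹ • (D / ε) • x := by rw [smul_smul, inv_mul_cancel₀ hr.ne', one_smul]
      rw [h1, dist_smul₀, Real.norm_of_nonneg (by positivity)]
      calc _ < (D / ε)⁻¹ * D := by gcongr
        _ = ε := by field_simp
  have hinj : Function.Injective ev := by
    rw [injective_iff_map_eq_zero]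
    intro a ha
    ext w
    obtain ⟨b, rfl⟩ := hsurj w
    have h := congrArg (fun c : A => (c : V →L[ℂ] V) v₀) (hcomm a b)
    simp only [hev] at ha ⊢
    simpa [ha] using h
  let e : A ≃L[ℂ] V := (LinearEquiv.ofBijective ev ⟨hinj, hsurj⟩).toContinuousLinearEquiv
  have he : ∀ a : A, e a = (a : V →L[ℂ] V) v₀ := fun _ => rfl
  have hdense : Dense (Submonoid.closure TA : Set A) := by
    refine dense_closure_of_approx_cone_of_commute hcomm hTAfin hTA (C := e ⁻¹' C)
      (D := (‖(e.symm : V →L[ℂ] A)‖ + 1) * D) ?_ (hCopen.preimage e.continuous) ?_ ?_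
    · obtain ⟨x, hx⟩ := hCne
      exact ⟨e.symm x, by simpa using hx⟩
    · intro a ha r hr
      exact hCcone _ ha r hr
    · intro a ha
      obtain ⟨s, hs, -, hsD⟩ := hD _ ha
      obtain ⟨b, hb, hbs⟩ := hSM s hs
      refine ⟨b, hb, ?_⟩
      rw [← hbs, ← he, dist_eq_norm, ← map_sub] at hsD
      have h1 := (e.symm : V →L[ℂ] A).le_opNorm (e (a - b))
      have h2 : (e.symm : V →L[ℂ] A) (e (a - b)) = a - b := e.symm_apply_apply _
      rw [h2] at h1
      rw [dist_eq_norm]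
      nlinarith [norm_nonneg (e.symm : V →L[ℂ] A), norm_nonneg (e (a - b))]
  cases subsingleton_or_nontrivial V
  · obtain ⟨x, hx⟩ := hCne
    obtain ⟨s, hs, -⟩ := hD x hx
    exact fun w => subset_closure ⟨s, hs, Subsingleton.elim _ _⟩
  have : Nontrivial A := e.symm.injective.nontrivial
  have : (𝓝[≠] (1 : A)).NeBot := Module.punctured_nhds_neBot ℂ A 1
  refine (e.surjective.denseRange.dense_image e.continuous (hdense.sdiff_singleton 1)).mono ?_
  rintro _ ⟨a, ⟨ha, ha1⟩, rfl⟩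
  obtain h | ⟨s, hs, hsa⟩ := hMS a ha
  · exact absurd h ha1
  · exact ⟨s, hs, by rw [hsa, he]⟩
end
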